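/- arXiv:1705.01594 — 3 statements merged into one kernel-verified Lean document; each statement's English description precedes it below -/
import Mathlib

section
/- Let R be a commutative Noetherian ring and I ⊆ J ideals of R with cd(J, R) = 1. Then for every R-module M and every finitely generated R-module N with Supp N ⊆ V(J), Ext_R^j(N, H^i_I(M)) = 0 for all integers i ≥ 2 and j ≥ 0. -/
open CategoryTheory

noncomputable section

universe u

/-- `Tor_i^R(A, B)` as an object of `ModuleCat R`. -/
def TorMod (R : Type u) [CommRing R] (i : ℕ) (A B : ModuleCat.{u} R) : ModuleCat.{u} R :=
  ((Tor (ModuleCat.{u} R) i).obj A).obj B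

/-- `Ext^i_R(A, B)` as an object of `ModuleCat R`. -/
def ExtMod (R : Type u) [CommRing R] (i : ℕ) (A B : ModuleCat.{u} R) : ModuleCat.{u} R :=
  ((Ext R (ModuleCat.{u} R) i).obj (Opposite.op A)).obj B

/-- `H^i_I(M)`, the `i`-th local cohomology of `M` with support in `I`. -/
def LC (R : Type u) [CommRing R] (I : Ideal R) (i : ℕ) (M : ModuleCat.{u} R) : ModuleCat.{u} R :=
  (localCohomology I i).obj M

/-- `M` is `I`-cofinite: `Supp M ⊆ V(I)` and all `Ext^i_R(R/I, M)` are finitely generated. -/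
def IsCofinite (R : Type u) [CommRing R] (I : Ideal R) (M : ModuleCat.{u} R) : Prop :=
  Module.support R M ⊆ PrimeSpectrum.zeroLocus (I : Set R) ∧
    ∀ i : ℕ, Module.Finite R (ExtMod R i (ModuleCat.of R (R ⧸ I)) M)

/-- `Γ_I(M) = ⋃ₙ (0 :_M Iⁿ)`, the `I`-torsion submodule of `M`. -/
def torsionGamma (R : Type u) [CommRing R] (I : Ideal R) (M : Type u) [AddCommGroup M]
    [Module R M] : Submodule R M :=
  ⨆ n : ℕ, Submodule.torsionBySet R M ((I ^ n : Ideal R) : Set R)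

section Part1
variable {R : Type u} [CommRing R]

abbrev s16K (M : ModuleCat.{u} R) {A : ModuleCat.{u} R} (P : ProjectiveResolution A) :
    ChainComplex (ModuleCat.{u} R)ᵒᵖ ℕ :=
  (((linearYoneda R (ModuleCat.{u} R)).obj M).rightOp.mapHomologicalComplex _).obj P.complex

/-- cocycles -/
abbrev s16Z (M : ModuleCat.{u} R) {A : ModuleCat.{u} R} (P : ProjectiveResolution A) (n : ℕ) :
    ModuleCat.{u} R := ((s16K M P).opcycles n).unop

/-- cocycle to map -/
def s16t (M : ModuleCat.{u} R) {A : ModuleCat.{u} R} (P : ProjectiveResolution A) (n : ℕ) :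
    s16Z M P n →ₗ[R] (P.complex.X n ⟶ M) :=
  ((s16K M P).pOpcycles n).unop.hom

def s16s (M : ModuleCat.{u} R) {A : ModuleCat.{u} R} (P : ProjectiveResolution A) (n : ℕ) :
    s16Z M P n →ₗ[R] ((s16K M P).homology n).unop :=
  ((s16K M P).homologyι n).unop.hom

lemma s16t_inj (M : ModuleCat.{u} R) {A : ModuleCat.{u} R} (P : ProjectiveResolution A) (n : ℕ) :
    Function.Injective (s16t M P n) := by
  have : Mono ((s16K M P).pOpcycles n).unop := inferInstance
  exact (ModuleCat.mono_iff_injective _).1 this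

lemma s16s_surj (M : ModuleCat.{u} R) {A : ModuleCat.{u} R} (P : ProjectiveResolution A) (n : ℕ) :
    Function.Surjective (s16s M P n) := by
  have : Epi ((s16K M P).homologyι n).unop := inferInstance
  exact (ModuleCat.epi_iff_surjective _).1 this

lemma s16t_cocycle (M : ModuleCat.{u} R) {A : ModuleCat.{u} R} (P : ProjectiveResolution A) (n : ℕ)
    (c : s16Z M P n) : P.complex.d (n+1) n ≫ s16t M P n c = 0 := by
  have h := congrArg Quiver.Hom.unop ((s16K M P).d_pOpcycles (n+1) n)
  have h2 := congrArg (fun f => f.hom c) h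
  exact h2

lemma s16t_range (M : ModuleCat.{u} R) {A : ModuleCat.{u} R} (P : ProjectiveResolution A) (n : ℕ)
    (f : P.complex.X n ⟶ M) (hf : P.complex.d (n+1) n ≫ f = 0) : ∃ c, s16t M P n c = f := by
  let g : ModuleCat.of R R ⟶ ((s16K M P).X n).unop :=
    ModuleCat.ofHom (LinearMap.toSpanSingleton R (P.complex.X n ⟶ M) f)
  have hg : (s16K M P).d (n+1) n ≫ g.op = 0 := by
    apply Quiver.Hom.unop_inj
    ext
    change P.complex.d (n+1) n ≫ ((1 : R) • f) = 0
    rw [one_smul, hf]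
  let k := (s16K M P).descOpcycles g.op (n+1) (by simp) hg
  have hk : (s16K M P).pOpcycles n ≫ k = g.op := (s16K M P).p_descOpcycles _ _ _ _
  refine ⟨k.unop.hom (1 : R), ?_⟩
  have h2 := congrArg (fun f => f.hom (1 : R)) (congrArg Quiver.Hom.unop hk)
  refine h2.trans ?_
  change (1 : R) • f = f
  rw [one_smul]

lemma s16s_zero (M : ModuleCat.{u} R) {A : ModuleCat.{u} R} (P : ProjectiveResolution A) (n : ℕ)
    (c : s16Z M P (n+1)) : s16s M P (n+1) c = 0 ↔
      ∃ g : P.complex.X n ⟶ M, P.complex.d (n+1) n ≫ g = s16t M P (n+1) c := by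
  have hex : (ShortComplex.mk ((s16K M P).homologyι (n+1)) ((s16K M P).fromOpcycles (n+1) n)
      (by simp)).Exact := ShortComplex.exact_of_f_is_kernel _
        ((s16K M P).homologyIsKernel (n+1) n (by simp))
  have hex2 := (ShortComplex.moduleCat_exact_iff _).1 hex.unop
  have hp := congrArg Quiver.Hom.unop ((s16K M P).p_fromOpcycles (n+1) n)
  have hp2 : ∀ g : P.complex.X n ⟶ M,
      s16t M P (n+1) (((s16K M P).fromOpcycles (n+1) n).unop.hom g) = P.complex.d (n+1) n ≫ g :=
    fun g => congrArg (fun f => f.hom g) hp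
  constructor
  · intro h
    obtain ⟨g, hg⟩ := hex2 c h
    refine ⟨g, ?_⟩
    refine (hp2 g).symm.trans ?_
    exact congrArg (s16t M P (n+1)) hg
  · rintro ⟨g, hg⟩
    rw [← hp2] at hg
    have := s16t_inj _ _ _ hg
    rw [← this]
    have h0 := congrArg Quiver.Hom.unop ((s16K M P).homologyι_comp_fromOpcycles (n+1) n)
    exact congrArg (fun f => f.hom g) h0

abbrev NExt (A M : ModuleCat.{u} R) (n : ℕ) : Type u := Abelian.Ext.{u} A M n

lemma s16_smul_extMk {M : ModuleCat.{u} R} {A : ModuleCat.{u} R} (P : ProjectiveResolution A)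
    {n : ℕ} (f : P.complex.X n ⟶ M) (m : ℕ) (hm : n + 1 = m) (hf : P.complex.d m n ≫ f = 0)
    (r : R) : (r • P.extMk f m hm hf : NExt A M n) = P.extMk (r • f) m hm (by simp [hf]) := by
  rw [Abelian.Ext.smul_eq_comp_mk₀, ProjectiveResolution.extMk_comp_mk₀]
  simp

def s16e (M : ModuleCat.{u} R) {A : ModuleCat.{u} R} (P : ProjectiveResolution A) (n : ℕ) :
    s16Z M P n →ₗ[R] NExt A M n where
  toFun c := P.extMk (s16t M P n c) (n+1) rfl (s16t_cocycle M P n c)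
  map_add' x y := by
    rw [ProjectiveResolution.add_extMk]
    congr 1
    exact map_add _ _ _
  map_smul' r x := by
    rw [RingHom.id_apply, s16_smul_extMk]
    congr 1
    exact map_smul _ _ _

lemma s16e_surj (M : ModuleCat.{u} R) {A : ModuleCat.{u} R} (P : ProjectiveResolution A) (n : ℕ) :
    Function.Surjective (s16e M P n) := by
  intro α
  obtain ⟨f, hf, rfl⟩ := P.extMk_surjective α (n+1) rfl
  obtain ⟨c, rfl⟩ := s16t_range M P n f hf
  exact ⟨c, rfl⟩

lemma s16_ker (M : ModuleCat.{u} R) {A : ModuleCat.{u} R} (P : ProjectiveResolution A) (n : ℕ) :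
    LinearMap.ker (s16s M P (n+1)) = LinearMap.ker (s16e M P (n+1)) := by
  ext c
  rw [LinearMap.mem_ker, LinearMap.mem_ker, s16s_zero]
  exact (P.extMk_eq_zero_iff _ _ rfl (s16t_cocycle M P (n+1) c) n rfl).symm

/-- homology vs. Ext -/
def s16he (M : ModuleCat.{u} R) {A : ModuleCat.{u} R} (P : ProjectiveResolution A) (n : ℕ) :
    ((s16K M P).homology (n+1)).unop ≃ₗ[R] NExt A M (n+1) :=
  ((s16s M P (n+1)).quotKerEquivOfSurjective (s16s_surj M P (n+1))).symm ≪≫ₗ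
    Submodule.quotEquivOfEq _ _ (s16_ker M P n) ≪≫ₗ
    ((s16e M P (n+1)).quotKerEquivOfSurjective (s16e_surj M P (n+1)))

lemma s16he_apply (M : ModuleCat.{u} R) {A : ModuleCat.{u} R} (P : ProjectiveResolution A) (n : ℕ)
    (c : s16Z M P (n+1)) : s16he M P n (s16s M P (n+1) c) = s16e M P (n+1) c := by
  have : ((s16s M P (n+1)).quotKerEquivOfSurjective (s16s_surj M P (n+1))).symm
      (s16s M P (n+1) c) = Submodule.Quotient.mk c := by
    rw [LinearEquiv.symm_apply_eq]; rfl
  simp only [s16he, LinearEquiv.trans_apply, this]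
  rfl

abbrev OExt (A M : ModuleCat.{u} R) (n : ℕ) : ModuleCat.{u} R :=
  ((Ext R (ModuleCat.{u} R) n).obj (Opposite.op A)).obj M

/-- old Ext vs homology -/
def s16oh (M : ModuleCat.{u} R) {A : ModuleCat.{u} R} (P : ProjectiveResolution A) (n : ℕ) :
    OExt A M n ≃ₗ[R] ((s16K M P).homology n).unop :=
  ((P.isoLeftDerivedObj ((linearYoneda R (ModuleCat.{u} R)).obj M).rightOp n).unop.symm).toLinearEquiv

def s16θ (A M : ModuleCat.{u} R) (n : ℕ) : OExt A M (n+1) ≃ₗ[R] NExt A M (n+1) :=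
  s16oh M (projectiveResolution A) (n+1) ≪≫ₗ s16he M (projectiveResolution A) n

lemma s16oh_nat (M : ModuleCat.{u} R) {A B : ModuleCat.{u} R} (f : A ⟶ B)
    (P : ProjectiveResolution A) (Q : ProjectiveResolution B) (n : ℕ) (φ : P.Hom Q f)
    (x : OExt B M n) (c : s16Z M Q n) (hc : s16oh M Q n x = s16s M Q n c) :
    ∃ c' : s16Z M P n, s16oh M P n (((Ext R (ModuleCat.{u} R) n).map f.op).app M x) = s16s M P n c' ∧
      s16t M P n c' = φ.hom.f n ≫ s16t M Q n c := by
  let ψ := (((linearYoneda R (ModuleCat.{u} R)).obj M).rightOp.mapHomologicalComplex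
    (ComplexShape.down ℕ)).map φ.hom
  refine ⟨(HomologicalComplex.opcyclesMap ψ n).unop.hom c, ?_, ?_⟩
  · have h1 := ProjectiveResolution.isoLeftDerivedObj_inv_naturality f P Q φ.hom
      (by have := φ.hom_f_zero_comp_π_f_zero; exact this)
      ((linearYoneda R (ModuleCat.{u} R)).obj M).rightOp n
    have h2 := congrArg (fun f => f.hom x) (congrArg Quiver.Hom.unop h1)
    have h3 := congrArg (fun f => f.hom c) (congrArg Quiver.Hom.unop
      (HomologicalComplex.homologyι_naturality ψ n))
    refine h2.trans ?_
    refine Eq.trans ?_ h3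
    exact congrArg (HomologicalComplex.homologyMap ψ n).unop.hom hc
  · have h3 := congrArg (fun f => f.hom c) (congrArg Quiver.Hom.unop
      (HomologicalComplex.p_opcyclesMap ψ n))
    exact h3

lemma s16θ_nat (M : ModuleCat.{u} R) {A B : ModuleCat.{u} R} (f : A ⟶ B) (n : ℕ)
    (x : OExt B M (n+1)) :
    s16θ A M n (((Ext R (ModuleCat.{u} R) (n+1)).map f.op).app M x) =
      (Abelian.Ext.mk₀ f).comp (s16θ B M n x) (zero_add _) := by
  obtain ⟨c, hc⟩ := s16s_surj M (projectiveResolution B) (n+1)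
    (s16oh M (projectiveResolution B) (n+1) x)
  let φ : (projectiveResolution A).Hom (projectiveResolution B) f :=
    ⟨ProjectiveResolution.lift f _ _, by simpa using ProjectiveResolution.lift_commutes_zero f _ _⟩
  obtain ⟨c', h1, h2⟩ := s16oh_nat M f _ _ _ φ x c hc.symm
  simp only [s16θ, LinearEquiv.trans_apply, h1, ← hc, s16he_apply]
  have he : ∀ (D : ModuleCat.{u} R) (c : s16Z M (projectiveResolution D) (n+1)),
      s16e M (projectiveResolution D) (n+1) c = (projectiveResolution D).extMk
        (s16t M (projectiveResolution D) (n+1) c) (n+1+1) rfl (s16t_cocycle _ _ _ c) :=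
    fun _ _ => rfl
  rw [he, he, ProjectiveResolution.mk₀_comp_extMk (φ := φ)]
  congr 1

lemma s16_old_zero (N X : ModuleCat.{u} R) (h : ∀ j, Subsingleton (NExt N X j)) (j : ℕ) :
    Subsingleton (OExt N X j) := by
  cases j with
  | succ n => exact (s16θ N X n).toEquiv.subsingleton
  | zero =>
    have h0 : ∀ f : N ⟶ X, f = 0 := fun f => by
      have := h 0
      have := Subsingleton.elim (Abelian.Ext.mk₀ f : NExt N X 0) 0
      simpa using this
    let P := projectiveResolution N
    have hz : Subsingleton (s16Z X P 0) := by
      refine ⟨fun a b => s16t_inj _ _ _ ?_⟩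
      have key : ∀ a, s16t X P 0 a = 0 := by
        intro a
        have hc := s16t_cocycle X P 0 a
        have hh : P.π.f 0 ≫ P.exact₀.desc (s16t X P 0 a) hc = s16t X P 0 a := P.exact₀.g_desc _ _
        rw [← hh, h0 (P.exact₀.desc (s16t X P 0 a) hc)]
        exact Limits.comp_zero
      rw [key, key]
    have : Subsingleton ((s16K X P).homology 0).unop := (s16s_surj X P 0).subsingleton
    exact (s16oh X P 0).toEquiv.subsingleton

end Part1

section Part2
open Abelian
variable {R : Type u} [CommRing R]

abbrev s16Im (A : Ideal R) : ModuleCat.{u} R := ModuleCat.of R A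

abbrev s16incl {A B : Ideal R} (h : A ≤ B) : s16Im A ⟶ s16Im B :=
  ModuleCat.ofHom (Submodule.inclusion h)

lemma s16incl_comp {A B C : Ideal R} (h : A ≤ B) (h' : B ≤ C) :
    s16incl h ≫ s16incl h' = s16incl (h.trans h') := rfl

def s16res {A B : Ideal R} (h : A ≤ B) {M : ModuleCat.{u} R} {i : ℕ}
    (α : NExt (s16Im B) M i) : NExt (s16Im A) M i :=
  (Ext.mk₀ (s16incl h)).comp α (zero_add _)

lemma s16res_res {A B C : Ideal R} (h : A ≤ B) (h' : B ≤ C) {M : ModuleCat.{u} R} {i : ℕ}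
    (α : NExt (s16Im C) M i) : s16res h (s16res h' α) = s16res (h.trans h') α := by
  simp only [s16res, Ext.mk₀_comp_mk₀_assoc, s16incl_comp]

@[simp] lemma s16res_zero {A B : Ideal R} (h : A ≤ B) {M : ModuleCat.{u} R} {i : ℕ} :
    s16res h (0 : NExt (s16Im B) M i) = 0 := by simp [s16res]

/-- restriction is zero on Ext in degrees at least `d`. -/
def s16Zr (d : ℕ) (A B : Ideal R) : Prop :=
  ∃ h : A ≤ B, ∀ (M : ModuleCat.{u} R) (i : ℕ) (α : NExt (s16Im B) M i), d ≤ i → s16res h α = 0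

lemma s16Zr.mono {d d' : ℕ} {A A' B B' : Ideal R} (hz : s16Zr d A B) (hA : A' ≤ A) (hB : B ≤ B')
    (hd : d ≤ d') : s16Zr d' A' B' := by
  obtain ⟨h, hz⟩ := hz
  refine ⟨hA.trans (h.trans hB), fun M i α hi => ?_⟩
  rw [← s16res_res hA (h.trans hB), ← s16res_res h hB, hz _ _ _ (hd.trans hi), s16res_zero]

lemma s16Zr_of_factor {d : ℕ} {T S K K' : Ideal R} (hz : s16Zr d K K') (hTS : T ≤ S)
    (f : T →ₗ[R] K) (v : K' →ₗ[R] S)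
    (hfv : ∀ t : T, (v ⟨(f t : R), hz.1 (f t).2⟩ : R) = t) : s16Zr d T S := by
  obtain ⟨h, hz⟩ := hz
  refine ⟨hTS, fun M i α hi => ?_⟩
  have : s16incl hTS = ModuleCat.ofHom f ≫ s16incl h ≫ ModuleCat.ofHom v := by
    ext t
    exact (hfv t).symm
  have h2 := hz M i ((Ext.mk₀ (ModuleCat.ofHom v)).comp α (zero_add _)) hi
  simp only [s16res] at h2 ⊢
  rw [this, ← Ext.mk₀_comp_mk₀_assoc, ← Ext.mk₀_comp_mk₀_assoc, h2, Ext.comp_zero]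

lemma s16Zr_fac {d : ℕ} {T S K K' : Ideal R} (hz : s16Zr d K K') (x : R) (m c : ℕ)
    (hx : ∀ a : R, x ^ (m + c) * a = 0 → x ^ c * a = 0)
    (hT : ∀ t ∈ T, ∃ a ∈ K, x ^ (m + c) * a = t)
    (hS : ∀ a ∈ K', x ^ m * a ∈ S) : s16Zr d T S := by
  have hTS : T ≤ S := by
    intro t ht
    obtain ⟨a, ha, rfl⟩ := hT t ht
    rw [pow_add, mul_assoc]
    exact hS _ (Ideal.mul_mem_left _ _ (hz.1 ha))
  choose! g hg hg' using hT
  have uniq : ∀ a b : R, x ^ (m + c) * a = x ^ (m + c) * b → x ^ c * a = x ^ c * b := by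
    intro a b hab
    rw [← sub_eq_zero, ← mul_sub]
    apply hx
    rw [mul_sub, hab, sub_self]
  let f : T →ₗ[R] K :=
    { toFun := fun t => ⟨x ^ c * g t, Ideal.mul_mem_left _ _ (hg t t.2)⟩
      map_add' := fun s t => by
        ext
        change x ^ c * g (s + t : R) = x ^ c * g s + x ^ c * g t
        rw [← mul_add]
        apply uniq
        rw [mul_add, hg' _ (T.add_mem s.2 t.2), hg' _ s.2, hg' _ t.2]
      map_smul' := fun r t => by
        ext
        change x ^ c * g (r * t : R) = r * (x ^ c * g t)
        rw [mul_left_comm]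
        apply uniq
        rw [mul_left_comm, hg' _ (T.mul_mem_left r t.2), hg' _ t.2] }
  let v : K' →ₗ[R] S := ((LinearMap.mulLeft R (x ^ m)).restrict hS)
  refine s16Zr_of_factor hz hTS f v ?_
  intro t
  change x ^ m * (x ^ c * g t) = t
  rw [← mul_assoc, ← pow_add, hg' _ t.2]

lemma s16_stab [IsNoetherianRing R] (x : R) : ∃ c : ℕ, ∀ (m : ℕ) (a : R),
    x ^ (m + c) * a = 0 → x ^ c * a = 0 := by
  let F : ℕ →o Ideal R := ⟨fun n => LinearMap.ker (LinearMap.mulLeft R (x ^ n)), by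
    refine monotone_nat_of_le_succ fun n a ha => ?_
    simp only [LinearMap.mem_ker, LinearMap.mulLeft_apply] at ha ⊢
    rw [pow_succ', mul_assoc, ha, mul_zero]⟩
  obtain ⟨c, hc⟩ := monotone_stabilizes_iff_noetherian.2 ‹IsNoetherianRing R› F
  refine ⟨c, fun m a h => ?_⟩
  have h1 : a ∈ F (m + c) := h
  rw [← hc (m + c) (Nat.le_add_left _ _)] at h1
  exact h1

lemma s16Zr_top : s16Zr 1 (⊤ : Ideal R) ⊤ := by
  refine ⟨le_rfl, fun M i α hi => ?_⟩
  obtain ⟨i, rfl⟩ := Nat.exists_eq_add_of_le' hi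
  have : Module.Projective R (⊤ : Ideal R) := Module.Projective.of_equiv (Submodule.topEquiv).symm
  have : Projective (s16Im (⊤ : Ideal R)) := (IsProjective.iff_projective _).1 this
  rw [Ext.eq_zero_of_projective α, s16res_zero]

/-- Mayer-Vietoris -/
def s16MV (A B : Ideal R) : ShortComplex (ModuleCat.{u} R) :=
  ShortComplex.mk (X₁ := s16Im (A ⊓ B)) (X₂ := ModuleCat.of R (A × B)) (X₃ := s16Im (A ⊔ B))
    (ModuleCat.ofHom ((Submodule.inclusion inf_le_left).prod (-Submodule.inclusion inf_le_right)))
    (ModuleCat.ofHom ((Submodule.inclusion le_sup_left).coprod (Submodule.inclusion le_sup_right)))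
    (by
      ext t
      change (t : R) + -(t : R) = 0
      simp)

lemma s16MV_exact (A B : Ideal R) : (s16MV A B).ShortExact where
  exact := by
    rw [ShortComplex.moduleCat_exact_iff]
    rintro ⟨a, b⟩ h
    have h' : (a : R) + b = 0 := congrArg Subtype.val h
    have hab : (b : R) = -a := by linear_combination h'
    refine ⟨⟨a, a.2, ?_⟩, ?_⟩
    · rw [← neg_neg (a : R), ← hab]; exact B.neg_mem b.2
    · refine Prod.ext (Subtype.ext rfl) (Subtype.ext ?_)
      change -(a : R) = b
      rw [hab]
  mono_f := by
    rw [ModuleCat.mono_iff_injective]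
    intro a b h
    exact Subtype.ext (congrArg (fun z : A × B => (z.1 : R)) h)
  epi_g := by
    rw [ModuleCat.epi_iff_surjective]
    rintro ⟨t, ht⟩
    obtain ⟨a, ha, b, hb, rfl⟩ := Submodule.mem_sup.1 ht
    exact ⟨(⟨a, ha⟩, ⟨b, hb⟩), rfl⟩

def s16MVmap {A B A' B' : Ideal R} (hA : A' ≤ A) (hB : B' ≤ B) : s16MV A' B' ⟶ s16MV A B where
  τ₁ := s16incl (inf_le_inf hA hB)
  τ₂ := ModuleCat.ofHom ((Submodule.inclusion hA).prodMap (Submodule.inclusion hB))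
  τ₃ := s16incl (sup_le_sup hA hB)

lemma s16_prod_zero {A B : Type u} [AddCommGroup A] [AddCommGroup B] [Module R A] [Module R B]
    {M : ModuleCat.{u} R} {i : ℕ} (γ : NExt (ModuleCat.of R (A × B)) M i)
    (h1 : (Ext.mk₀ (ModuleCat.ofHom (LinearMap.inl R A B))).comp γ (zero_add _) = 0)
    (h2 : (Ext.mk₀ (ModuleCat.ofHom (LinearMap.inr R A B))).comp γ (zero_add _) = 0) : γ = 0 := by
  have hid : 𝟙 (ModuleCat.of R (A × B)) =
      ModuleCat.ofHom (LinearMap.fst R A B) ≫ ModuleCat.ofHom (LinearMap.inl R A B) +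
      ModuleCat.ofHom (LinearMap.snd R A B) ≫ ModuleCat.ofHom (LinearMap.inr R A B) := by
    ext <;> simp
  rw [← Ext.mk₀_id_comp γ, hid, Ext.mk₀_add, Ext.add_comp, ← Ext.mk₀_comp_mk₀_assoc,
    ← Ext.mk₀_comp_mk₀_assoc, h1, h2]
  simp

lemma s16_nat {S₁ S₂ : ShortComplex (ModuleCat.{u} R)} (h₁ : S₁.ShortExact) (h₂ : S₂.ShortExact)
    (f : S₁ ⟶ S₂) {M : ModuleCat.{u} R} {i j : ℕ} (β : NExt S₂.X₁ M i) (hij : 1 + i = j) :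
    (Ext.mk₀ f.τ₃).comp (h₂.extClass.comp β hij) (zero_add _) =
      h₁.extClass.comp ((Ext.mk₀ f.τ₁).comp β (zero_add _)) hij := by
  have nat := ShortComplex.ShortExact.extClass_naturality h₁ h₂ f
  rw [← Ext.comp_assoc _ _ _ (zero_add 1) hij (by omega), ← nat,
    Ext.comp_assoc _ _ _ (add_zero 1) (zero_add i) (by omega)]

lemma s16_nat_zero {S₁ S₂ : ShortComplex (ModuleCat.{u} R)} (h₁ : S₁.ShortExact)
    (h₂ : S₂.ShortExact)
    (f : S₁ ⟶ S₂) {M : ModuleCat.{u} R} {i j : ℕ} (β : NExt S₂.X₁ M i) (hij : 1 + i = j)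
    (hb : (Ext.mk₀ f.τ₁).comp β (zero_add _) = 0) :
    (Ext.mk₀ f.τ₃).comp (h₂.extClass.comp β hij) (zero_add _) = 0 := by
  rw [s16_nat h₁ h₂ f, hb, Ext.comp_zero]

lemma s16MV_g_zero {A B : Ideal R} {M : ModuleCat.{u} R} {i : ℕ} (δ : NExt (s16Im (A ⊔ B)) M i)
    (h1 : s16res le_sup_left δ = 0) (h2 : s16res le_sup_right δ = 0) :
    (Ext.mk₀ (s16MV A B).g).comp δ (zero_add _) = 0 := by
  apply s16_prod_zero
  · refine (Ext.mk₀_comp_mk₀_assoc _ _ _).trans (Eq.trans ?_ h1)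
    refine congrArg (fun f : s16Im A ⟶ s16Im (A ⊔ B) => (Ext.mk₀ f).comp δ (zero_add _)) ?_
    ext t
    refine Subtype.ext ?_
    change (t : R) + 0 = t
    simp
  · refine (Ext.mk₀_comp_mk₀_assoc _ _ _).trans (Eq.trans ?_ h2)
    refine congrArg (fun f : s16Im B ⟶ s16Im (A ⊔ B) => (Ext.mk₀ f).comp δ (zero_add _)) ?_
    ext t
    refine Subtype.ext ?_
    change 0 + (t : R) = t
    simp

lemma s16_step [IsNoetherianRing R] (J' : Ideal R) (x : R) (d : ℕ) (hd : 1 ≤ d)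
    (hQ : ∀ n, ∃ m, n ≤ m ∧ s16Zr d (J' ^ m) (J' ^ n)) :
    ∀ n, ∃ m, n ≤ m ∧ s16Zr (d+1) ((J' ⊔ Ideal.span {x}) ^ m) ((J' ⊔ Ideal.span {x}) ^ n) := by
  intro n
  obtain ⟨c, hc⟩ := s16_stab x
  obtain ⟨m2, hm2, hz2⟩ := hQ n
  let m := max m2 (n + c)
  have hzA : s16Zr d (J' ^ m) (J' ^ n) :=
    hz2.mono (Ideal.pow_le_pow_right (le_max_left _ _)) le_rfl le_rfl
  have hzB : s16Zr d (Ideal.span {x} ^ m) (Ideal.span {x} ^ n) := by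
    refine (s16Zr_fac s16Zr_top x n c (hc n) (T := Ideal.span {x} ^ (n + c)) ?_ ?_).mono
      (Ideal.pow_le_pow_right (le_max_right _ _)) le_rfl hd
    · intro t ht
      rw [Ideal.span_singleton_pow, Ideal.mem_span_singleton'] at ht
      obtain ⟨a, rfl⟩ := ht
      exact ⟨a, trivial, mul_comm _ _⟩
    · intro a _
      rw [Ideal.span_singleton_pow]
      exact Ideal.mul_mem_right _ _ (Ideal.mem_span_singleton_self _)
  obtain ⟨q, hmq, hq⟩ := hQ m
  obtain ⟨k, hk⟩ := Ideal.exists_pow_inf_eq_pow_smul J' (M := R) (Ideal.span {x ^ (m + c)})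
  let p := max (q + k) (m + c)
  have hmp : m ≤ p := (Nat.le_add_right m c).trans (le_max_right _ _)
  have hint : s16Zr d (J' ^ p ⊓ Ideal.span {x} ^ p) (J' ^ m ⊓ Ideal.span {x} ^ m) := by
    refine s16Zr_fac hq x m c (hc m) ?_ ?_
    · intro t ht
      have h1 : t ∈ J' ^ p • (⊤ : Submodule R R) ⊓ Ideal.span {x ^ (m + c)} := by
        refine ⟨by simpa using ht.1, ?_⟩
        rw [← Ideal.span_singleton_pow]
        exact Ideal.pow_le_pow_right (le_max_right _ _) ht.2
      rw [hk p ((Nat.le_add_left k q).trans (le_max_left _ _))] at h1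
      have h2 : t ∈ J' ^ q * Ideal.span {x ^ (m + c)} := by
        refine Submodule.smul_mono (Ideal.pow_le_pow_right ?_) inf_le_right h1
        have : q + k ≤ p := le_max_left _ _
        omega
      obtain ⟨a, ha, rfl⟩ := Ideal.mem_mul_span_singleton.1 h2
      exact ⟨a, ha, mul_comm _ _⟩
    · intro a ha
      refine ⟨Ideal.mul_mem_left _ _ ha, ?_⟩
      rw [Ideal.span_singleton_pow]
      exact Ideal.mul_mem_right _ _ (Ideal.mem_span_singleton_self _)
  have hsup : J' ^ m ⊔ Ideal.span {x} ^ m ≤ (J' ⊔ Ideal.span {x}) ^ n :=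
    sup_le ((Ideal.pow_le_pow_right ((hm2.trans (le_max_left _ _)))).trans
        (Ideal.pow_right_mono le_sup_left n))
      ((Ideal.pow_le_pow_right ((hm2.trans (le_max_left _ _)))).trans
        (Ideal.pow_right_mono le_sup_right n))
  have hpp : J' ^ p ⊔ Ideal.span {x} ^ p ≤ J' ^ m ⊔ Ideal.span {x} ^ m :=
    sup_le_sup (Ideal.pow_le_pow_right hmp) (Ideal.pow_le_pow_right hmp)
  have main : s16Zr (d+1) (J' ^ p ⊔ Ideal.span {x} ^ p) ((J' ⊔ Ideal.span {x}) ^ n) := by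
    refine ⟨hpp.trans hsup, fun M i α hi => ?_⟩
    rw [← s16res_res hpp hsup]
    obtain ⟨i, rfl⟩ := Nat.exists_eq_add_of_le' (show 1 ≤ i by omega)
    have hr : (Ext.mk₀ (s16MV (J' ^ m) (Ideal.span {x} ^ m)).g).comp (s16res hsup α)
        (zero_add _) = 0 := by
      apply s16MV_g_zero
      · rw [s16res_res, ← s16res_res hzA.1 (Ideal.pow_right_mono le_sup_left n)]
        exact hzA.2 M (i+1) _ (by omega)
      · rw [s16res_res, ← s16res_res hzB.1 (Ideal.pow_right_mono le_sup_right n)]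
        exact hzB.2 M (i+1) _ (by omega)
    obtain ⟨β, hβ⟩ := Ext.contravariant_sequence_exact₃ (s16MV_exact _ _) M (s16res hsup α) hr
      (add_comm 1 i)
    have hb := hint.2 M i β (by omega)
    rw [← hβ]
    exact s16_nat_zero (s16MV_exact _ _) (s16MV_exact _ _)
      (s16MVmap (Ideal.pow_le_pow_right hmp) (Ideal.pow_le_pow_right hmp) :
        s16MV (J' ^ p) (Ideal.span {x} ^ p) ⟶ s16MV (J' ^ m) (Ideal.span {x} ^ m)) β _ hb
  refine ⟨p + p + n, by omega, main.mono ?_ le_rfl le_rfl⟩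
  exact (Ideal.pow_le_pow_right (Nat.le_add_right _ _)).trans Ideal.sup_pow_add_le_pow_sup_pow

lemma s16_Q [IsNoetherianRing R] (J : Ideal R) : ∃ d, 1 ≤ d ∧
    ∀ n, ∃ m, n ≤ m ∧ s16Zr d (J ^ m) (J ^ n) := by
  obtain ⟨s, rfl⟩ := (isNoetherianRing_iff_ideal_fg R).1 ‹_› J
  classical
  induction s using Finset.induction_on with
  | empty =>
    refine ⟨1, le_rfl, fun n => ⟨n + 1, by omega, Ideal.pow_le_pow_right (by omega), ?_⟩⟩
    intro M i α hi
    have : s16incl (R := R) (A := Ideal.span ((∅ : Finset R) : Set R) ^ (n+1))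
        (B := Ideal.span ((∅ : Finset R) : Set R) ^ n) (Ideal.pow_le_pow_right (by omega)) = 0 := by
      ext t
      have := t.2
      simp at this
      rw [this]
      simp
    rw [s16res, this]
    simp
  | insert x s _ ih =>
    obtain ⟨d, hd, h⟩ := ih
    refine ⟨d + 1, by omega, ?_⟩
    have := s16_step _ x d hd h
    rw [Finset.coe_insert, Ideal.span_insert, sup_comm]
    exact this

end Part2

section Part3
open Abelian Limits
variable {R : Type u} [CommRing R]

/-- the sequence of an ideal -/
def s16Sq (A : Ideal R) : ShortComplex (ModuleCat.{u} R) :=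
  ShortComplex.mk (X₁ := s16Im A) (X₂ := ModuleCat.of R R) (X₃ := ModuleCat.of R (R ⧸ A))
    (ModuleCat.ofHom (Submodule.subtype A)) (ModuleCat.ofHom (Submodule.mkQ A))
    (by
      ext t
      exact (Submodule.Quotient.mk_eq_zero A).2 t.2)

lemma s16Sq_exact (A : Ideal R) : (s16Sq A).ShortExact where
  exact := by
    rw [ShortComplex.moduleCat_exact_iff]
    intro a h
    exact ⟨⟨a, (Submodule.Quotient.mk_eq_zero A).1 h⟩, rfl⟩
  mono_f := by
    rw [ModuleCat.mono_iff_injective]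
    intro a b h
    exact Subtype.ext h
  epi_g := by
    rw [ModuleCat.epi_iff_surjective]
    exact Submodule.mkQ_surjective A

abbrev s16q {A B : Ideal R} (h : A ≤ B) : ModuleCat.of R (R ⧸ A) ⟶ ModuleCat.of R (R ⧸ B) :=
  ModuleCat.ofHom (Submodule.mapQ A B LinearMap.id h)

def s16Sqmap {A B : Ideal R} (h : A ≤ B) : s16Sq A ⟶ s16Sq B where
  τ₁ := s16incl h
  τ₂ := 𝟙 _
  τ₃ := s16q h

instance : Projective (ModuleCat.of R R) := (IsProjective.iff_projective R).1 inferInstance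

/-- connecting map -/
def s16δ (A : Ideal R) (M : ModuleCat.{u} R) (e : ℕ) :
    NExt (s16Im A) M e →ₗ[R] NExt (ModuleCat.of R (R ⧸ A)) M (e+1) where
  toFun x := (s16Sq_exact A).extClass.comp x (add_comm 1 e)
  map_add' _ _ := Ext.comp_add _ _ _ _
  map_smul' _ _ := Ext.comp_smul _ _ _ _

lemma s16δ_nat {A B : Ideal R} (h : A ≤ B) (M : ModuleCat.{u} R) (e : ℕ) (x : NExt (s16Im B) M e) :
    (Ext.mk₀ (s16q h)).comp (s16δ B M e x) (zero_add _) = s16δ A M e (s16res h x) :=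
  s16_nat (s16Sq_exact A) (s16Sq_exact B) (s16Sqmap h) x (add_comm 1 e)

lemma s16δ_surj (A : Ideal R) (M : ModuleCat.{u} R) (e : ℕ) : Function.Surjective (s16δ A M e) := by
  intro y
  have h0 : (Ext.mk₀ (s16Sq A).g).comp y (zero_add _) = 0 :=
    Ext.eq_zero_of_projective (P := ModuleCat.of R R) _
  obtain ⟨x, hx⟩ := Ext.contravariant_sequence_exact₃ (s16Sq_exact A) M y h0 (add_comm 1 e)
  exact ⟨x, hx⟩

lemma s16δ_inj (A : Ideal R) (M : ModuleCat.{u} R) (e : ℕ) :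
    Function.Injective (s16δ A M (e+1)) := by
  rw [injective_iff_map_eq_zero]
  intro x hx
  obtain ⟨y, hy⟩ := Ext.contravariant_sequence_exact₁ (s16Sq_exact A) M x (add_comm 1 (e+1)) hx
  have h0 : y = 0 := Ext.eq_zero_of_projective (P := ModuleCat.of R R) _
  rw [← hy, h0, Ext.comp_zero]
  rfl

/-- the evaluated diagram -/
abbrev s16D (I : Ideal R) (i : ℕ) (M : ModuleCat.{u} R) : (ℕᵒᵖ)ᵒᵖ ⥤ ModuleCat.{u} R :=
  localCohomology.diagram (localCohomology.idealPowersDiagram I) i ⋙ (evaluation _ _).obj M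

def s16c (I : Ideal R) (i : ℕ) (M : ModuleCat.{u} R) : Cocone (s16D I i M) :=
  ((evaluation _ _).obj M).mapCocone
    (colimit.cocone (localCohomology.diagram (localCohomology.idealPowersDiagram I) i))

def s16hc (I : Ideal R) (i : ℕ) (M : ModuleCat.{u} R) : IsColimit (s16c I i M) :=
  isColimitOfPreserves ((evaluation _ _).obj M) (colimit.isColimit _)

abbrev s16LC (I : Ideal R) (i : ℕ) (M : ModuleCat.{u} R) : ModuleCat.{u} R :=
  (localCohomology I i).obj M

def s16ι (I : Ideal R) (i : ℕ) (M : ModuleCat.{u} R) (n : ℕ) :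
    OExt (ModuleCat.of R (R ⧸ I ^ n)) M i →ₗ[R] s16LC I i M :=
  ((s16c I i M).ι.app (Opposite.op (Opposite.op n))).hom

def s16tr (I : Ideal R) (i : ℕ) (M : ModuleCat.{u} R) {n m : ℕ} (h : n ≤ m) :
    OExt (ModuleCat.of R (R ⧸ I ^ n)) M i →ₗ[R] OExt (ModuleCat.of R (R ⧸ I ^ m)) M i :=
  (((Ext R (ModuleCat R) i).map (s16q (Ideal.pow_le_pow_right h)).op).app M).hom

lemma s16ι_tr (I : Ideal R) (i : ℕ) (M : ModuleCat.{u} R) {n m : ℕ} (h : n ≤ m)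
    (x : OExt (ModuleCat.of R (R ⧸ I ^ n)) M i) :
    s16ι I i M m (s16tr I i M h x) = s16ι I i M n x := by
  have := (s16c I i M).w (homOfLE h).op.op
  exact congrArg (fun f => f.hom x) this

instance s16pres (I : Ideal R) (i : ℕ) (M : ModuleCat.{u} R) :
    PreservesColimit (s16D I i M) (forget (ModuleCat.{u} R)) := by
  have : PreservesFilteredColimitsOfSize.{0, 0} (forget (ModuleCat.{u} R)) :=
    preservesFilteredColimitsOfSize_shrink.{0, u, 0, u} _
  infer_instance

lemma s16ι_rep (I : Ideal R) (i : ℕ) (M : ModuleCat.{u} R) (z : s16LC I i M) :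
    ∃ n x, s16ι I i M n x = z := by
  obtain ⟨j, x, hx⟩ := Concrete.isColimit_exists_rep _ (s16hc I i M) z
  exact ⟨j.unop.unop, x, hx⟩

lemma s16ι_zero (I : Ideal R) (i : ℕ) (M : ModuleCat.{u} R) (n : ℕ)
    (x : OExt (ModuleCat.of R (R ⧸ I ^ n)) M i) (hx : s16ι I i M n x = 0) :
    ∃ m, ∃ h : n ≤ m, s16tr I i M h x = 0 := by
  obtain ⟨k, f, g, hk⟩ := Concrete.isColimit_exists_of_rep_eq (s16D I i M) (s16hc I i M)
    (i := Opposite.op (Opposite.op n)) (j := Opposite.op (Opposite.op n)) x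
    (0 : OExt (ModuleCat.of R (R ⧸ I ^ n)) M i) (hx.trans (map_zero (s16ι I i M n)).symm)
  refine ⟨k.unop.unop, leOfHom f.unop.unop, ?_⟩
  refine hk.trans ?_
  exact map_zero ((s16D I i M).map g).hom

/-- colimit maps via Ext of the powers -/
def s16κ (I : Ideal R) (e : ℕ) (M : ModuleCat.{u} R) (n : ℕ) :
    NExt (s16Im (I ^ n)) M e →ₗ[R] s16LC I (e+1) M :=
  s16ι I (e+1) M n ∘ₗ (s16θ _ M e).symm.toLinearMap ∘ₗ s16δ (I ^ n) M e

lemma s16θ_symm_tr (I : Ideal R) (e : ℕ) (M : ModuleCat.{u} R) {n m : ℕ} (h : n ≤ m)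
    (x : NExt (s16Im (I ^ n)) M e) :
    s16tr I (e+1) M h ((s16θ _ M e).symm (s16δ (I ^ n) M e x)) =
      (s16θ _ M e).symm (s16δ (I ^ m) M e (s16res (Ideal.pow_le_pow_right h) x)) := by
  rw [LinearEquiv.eq_symm_apply, ← s16δ_nat]
  refine (s16θ_nat M (s16q (Ideal.pow_le_pow_right h)) e _).trans ?_
  rw [LinearEquiv.apply_symm_apply]

lemma s16κ_res (I : Ideal R) (e : ℕ) (M : ModuleCat.{u} R) {n m : ℕ} (h : n ≤ m)
    (x : NExt (s16Im (I ^ n)) M e) :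
    s16κ I e M m (s16res (Ideal.pow_le_pow_right h) x) = s16κ I e M n x := by
  change s16ι I (e+1) M m _ = s16ι I (e+1) M n _
  rw [← s16ι_tr _ _ _ h]
  exact congrArg _ (s16θ_symm_tr I e M h x).symm

lemma s16κ_rep (I : Ideal R) (e : ℕ) (M : ModuleCat.{u} R) (z : s16LC I (e+1) M) :
    ∃ n x, s16κ I e M n x = z := by
  obtain ⟨n, y, rfl⟩ := s16ι_rep _ _ _ z
  obtain ⟨x, hx⟩ := s16δ_surj (I ^ n) M e (s16θ _ M e y)
  refine ⟨n, x, ?_⟩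
  change s16ι I (e+1) M n ((s16θ _ M e).symm (s16δ (I ^ n) M e x)) = _
  rw [hx, LinearEquiv.symm_apply_apply]

lemma s16κ_zero (I : Ideal R) (e : ℕ) (M : ModuleCat.{u} R) (n : ℕ)
    (x : NExt (s16Im (I ^ n)) M (e+1)) (hx : s16κ I (e+1) M n x = 0) :
    ∃ m, ∃ h : n ≤ m, s16res (Ideal.pow_le_pow_right h : I ^ m ≤ I ^ n) x = 0 := by
  obtain ⟨m, h, hm⟩ := s16ι_zero _ _ _ _ _ hx
  refine ⟨m, h, ?_⟩
  apply s16δ_inj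
  apply (s16θ _ M (e+1)).symm.injective
  rw [map_zero, map_zero]
  exact (s16θ_symm_tr I (e+1) M h x).symm.trans hm

end Part3

section Part4
open Abelian Limits
variable {R : Type u} [CommRing R]

lemma s16res_comp {A B : Ideal R} (h : A ≤ B) {M M' : ModuleCat.{u} R} {i j k : ℕ}
    (α : NExt (s16Im B) M i) (β : NExt M M' j) (hij : i + j = k) :
    s16res h (α.comp β hij) = (s16res h α).comp β hij := by
  unfold s16res
  rw [Ext.comp_assoc _ _ _ (zero_add i) hij (by omega)]

def s16Die (J : Ideal R) (e : ℕ) (K : ModuleCat.{u} R) : Prop :=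
  ∀ (n : ℕ) (α : NExt (s16Im (J ^ n)) K e), ∃ m, ∃ h : n ≤ m,
    s16res (Ideal.pow_le_pow_right h : J ^ m ≤ J ^ n) α = 0

lemma s16Die_step {J : Ideal R} {e : ℕ} {S : ShortComplex (ModuleCat.{u} R)} (hS : S.ShortExact)
    (h2 : s16Die J e S.X₂) (h1 : s16Die J (e+1) S.X₁) : s16Die J e S.X₃ := by
  intro n α
  obtain ⟨m, hm, h⟩ := h1 n (α.comp hS.extClass rfl)
  rw [s16res_comp] at h
  obtain ⟨β, hβ⟩ := Ext.covariant_sequence_exact₃ _ hS _ _ h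
  obtain ⟨p, hp, h'⟩ := h2 m β
  refine ⟨p, hm.trans hp, ?_⟩
  rw [← s16res_res (Ideal.pow_le_pow_right hp) (Ideal.pow_le_pow_right hm), ← hβ, s16res_comp, h',
    Ext.zero_comp]

lemma s16_pi_id (k : ℕ) : 𝟙 (ModuleCat.of R (Fin k → R)) =
    ∑ l : Fin k, ModuleCat.ofHom (LinearMap.proj l : (Fin k → R) →ₗ[R] R) ≫
      ModuleCat.ofHom (LinearMap.single R (fun _ => R) l) := by
  ext v j
  simp [Finset.sum_apply, Pi.single_apply]

lemma s16Die_free {J : Ideal R} {e : ℕ} (h : s16Die J e (ModuleCat.of R R)) (k : ℕ) :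
    s16Die J e (ModuleCat.of R (Fin k → R)) := by
  intro n α
  choose m hm hz using fun l : Fin k => h n
    (α.comp (Ext.mk₀ (ModuleCat.ofHom (LinearMap.proj l : (Fin k → R) →ₗ[R] R))) (add_zero _))
  let p := n + ∑ l, m l
  have hp : ∀ l, m l ≤ p := fun l =>
    (Finset.single_le_sum (f := m) (fun _ _ => Nat.zero_le _) (Finset.mem_univ l)).trans
      (Nat.le_add_left _ _)
  refine ⟨p, Nat.le_add_right _ _, ?_⟩
  rw [← Ext.comp_mk₀_id α, s16_pi_id, Ext.mk₀_sum, Ext.comp_sum]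
  unfold s16res
  rw [Ext.comp_sum]
  refine Finset.sum_eq_zero fun l _ => ?_
  change s16res _ _ = 0
  rw [← Ext.mk₀_comp_mk₀, ← Ext.comp_assoc _ _ _ (add_zero e) (zero_add 0) (by omega), s16res_comp,
    ← s16res_res (Ideal.pow_le_pow_right (hp l)) (Ideal.pow_le_pow_right (hm l)), hz l, s16res_zero,
    Ext.zero_comp]

lemma s16Die_R {J : Ideal R} (hJ : ∀ i : ℕ, 2 ≤ i → Subsingleton (s16LC J i (ModuleCat.of R R)))
    (e : ℕ) : s16Die J (e+1) (ModuleCat.of R R) := by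
  intro n α
  have := hJ (e+1+1) (by omega)
  exact s16κ_zero J e _ n α (Subsingleton.elim _ _)

lemma s16Die_all [IsNoetherianRing R] {J : Ideal R}
    (hJ : ∀ i : ℕ, 2 ≤ i → Subsingleton (s16LC J i (ModuleCat.of R R)))
    (e : ℕ) (K : Type u) [AddCommGroup K] [Module R K] [Module.Finite R K] :
    s16Die J (e+1) (ModuleCat.of R K) := by
  obtain ⟨d, hd, hQ⟩ := s16_Q J
  have key : ∀ t e : ℕ, d ≤ e + 1 + t → ∀ (K : Type u) [AddCommGroup K] [Module R K]
      [Module.Finite R K], s16Die J (e+1) (ModuleCat.of R K) := by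
    intro t
    induction t with
    | zero =>
      intro e he K _ _ _ n α
      obtain ⟨m, hm, _, hz⟩ := hQ n
      exact ⟨m, hm, hz _ _ _ (by omega)⟩
    | succ t ih =>
      intro e he K _ _ _
      obtain ⟨k, f, hf⟩ := Module.Finite.exists_fin' R K
      exact s16Die_step (LinearMap.shortExact_shortComplexKer hf)
        (s16Die_free (s16Die_R hJ e) k) (ih (e+1) (by omega) (LinearMap.ker f))
  exact key d e (by omega) K

lemma s16_split [IsNoetherianRing R] {J : Ideal R}
    (hJ : ∀ i : ℕ, 2 ≤ i → Subsingleton (s16LC J i (ModuleCat.of R R))) :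
    ∃ (n k : ℕ) (x : Fin k → R) (g : Fin k → ((J ^ n : Ideal R) →ₗ[R] R)), (∀ l, x l ∈ J) ∧
      ∀ a : (J ^ n : Ideal R), ∑ l, x l * g l a = a := by
  obtain ⟨k, f, hf⟩ := Module.Finite.exists_fin' R J
  have hS := LinearMap.shortExact_shortComplexKer hf
  have h1 : J ^ 1 ≤ J := (pow_one J).le
  obtain ⟨m, hm, h⟩ := s16Die_all hJ 0 (LinearMap.ker f) 1 (s16res h1 (hS.extClass))
  rw [s16res_res] at h
  obtain ⟨β, hβ⟩ := Ext.covariant_sequence_exact₃ _ hS _ _ h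
  obtain ⟨γ, rfl⟩ := (Ext.mk₀_bijective _ _).2 β
  rw [Ext.mk₀_comp_mk₀] at hβ
  have hγ := (Ext.mk₀_bijective _ _).1 hβ
  have hγ' : ∀ a : (J ^ m : Ideal R), ((f (γ.hom a) : J) : R) = a := fun a =>
    congrArg (fun z => ((z.hom a : J) : R)) hγ
  refine ⟨m, k, fun l => f (Pi.single l 1), fun l => LinearMap.proj l ∘ₗ γ.hom, fun l => (f _).2,
    fun a => ?_⟩
  rw [← hγ' a]
  have : (γ.hom a : Fin k → R) = ∑ l, (γ.hom a : Fin k → R) l • Pi.single l 1 := by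
    simpa using (pi_eq_sum_univ' (γ.hom a : Fin k → R))
  conv_rhs => rw [this]
  rw [map_sum, Submodule.coe_sum]
  refine Finset.sum_congr rfl fun l _ => ?_
  rw [map_smul, mul_comm]
  rfl

end Part4

section Part5
open Abelian Limits
variable {R : Type u} [CommRing R]

lemma s16_desc (I : Ideal R) (e : ℕ) (M : ModuleCat.{u} R) (X : Type u) [AddCommGroup X]
    [Module R X] (φ : ∀ n, NExt (s16Im (I ^ n)) M (e+1) →ₗ[R] X)
    (hφ : ∀ (n m : ℕ) (h : n ≤ m) (x), φ m (s16res (Ideal.pow_le_pow_right h) x) = φ n x) :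
    ∃ Φ : s16LC I (e+1+1) M →ₗ[R] X, ∀ n x, Φ (s16κ I (e+1) M n x) = φ n x := by
  have wd0 : ∀ n x, s16κ I (e+1) M n x = 0 → φ n x = 0 := by
    intro n x hx
    obtain ⟨m, h, hz⟩ := s16κ_zero I e M n x hx
    rw [← hφ n m h, hz, map_zero]
  have wd : ∀ n x m y, s16κ I (e+1) M n x = s16κ I (e+1) M m y → φ n x = φ m y := by
    intro n x m y hxy
    rw [← s16κ_res I _ M (le_max_left n m), ← s16κ_res I _ M (le_max_right n m), ← sub_eq_zero,
      ← map_sub] at hxy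
    have := wd0 _ _ hxy
    rwa [map_sub, hφ _ _ (le_max_left n m), hφ _ _ (le_max_right n m), sub_eq_zero] at this
  choose N Y hY using s16κ_rep I (e+1) M
  have key : ∀ n x, φ (N (s16κ I (e+1) M n x)) (Y (s16κ I (e+1) M n x)) = φ n x :=
    fun n x => wd _ _ _ _ (hY _)
  refine ⟨{ toFun := fun z => φ (N z) (Y z), map_add' := ?_, map_smul' := ?_ }, key⟩
  · intro a b
    have h := key (max (N a) (N b))
      (s16res (Ideal.pow_le_pow_right (le_max_left (N a) (N b))) (Y a) +
        s16res (Ideal.pow_le_pow_right (le_max_right (N a) (N b))) (Y b))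
    rw [map_add, map_add, s16κ_res I _ M (le_max_left _ _), s16κ_res I _ M (le_max_right _ _),
      hφ _ _ (le_max_left _ _), hφ _ _ (le_max_right _ _), hY, hY] at h
    exact h
  · intro r a
    have h := key (N a) (r • Y a)
    rw [map_smul, map_smul, hY] at h
    exact h

lemma s16g_mem {I J : Ideal R} (hIJ : I ≤ J) (n : ℕ) (g : (J ^ n : Ideal R) →ₗ[R] R) (m : ℕ)
    (a : R) (ha : a ∈ I ^ (m + n)) (ha' : a ∈ J ^ n) : g ⟨a, ha'⟩ ∈ I ^ m := by
  rw [pow_add] at ha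
  suffices H : ∃ h : a ∈ J ^ n, g ⟨a, h⟩ ∈ I ^ m from H.2
  clear ha'
  induction ha using Submodule.mul_induction_on' with
  | mem_mul_mem b hb c hc =>
    have hc' : c ∈ J ^ n := Ideal.pow_right_mono hIJ n hc
    refine ⟨Ideal.mul_mem_left _ _ hc', ?_⟩
    have : (⟨b * c, Ideal.mul_mem_left _ _ hc'⟩ : (J ^ n : Ideal R)) = b • ⟨c, hc'⟩ := rfl
    rw [this, map_smul]
    exact Ideal.mul_mem_right _ _ hb
  | add b _ c _ hb hc =>
    obtain ⟨hb, hb'⟩ := hb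
    obtain ⟨hc, hc'⟩ := hc
    refine ⟨Ideal.add_mem _ hb hc, ?_⟩
    have : (⟨b + c, Ideal.add_mem _ hb hc⟩ : (J ^ n : Ideal R)) = ⟨b, hb⟩ + ⟨c, hc⟩ := rfl
    rw [this, map_add]
    exact Ideal.add_mem _ hb' hc'

def s16gm {I J : Ideal R} (hIJ : I ≤ J) (n : ℕ) (g : (J ^ n : Ideal R) →ₗ[R] R) (m : ℕ) :
    s16Im (I ^ (m + n)) ⟶ s16Im (I ^ m) :=
  ModuleCat.ofHom (LinearMap.codRestrict (I ^ m)
    (g ∘ₗ Submodule.inclusion ((Ideal.pow_le_pow_right (Nat.le_add_left n m)).trans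
      (Ideal.pow_right_mono hIJ n)))
    (fun a => s16g_mem hIJ n g m a a.2 _))

lemma s16gm_comm {I J : Ideal R} (hIJ : I ≤ J) (n : ℕ) (g : (J ^ n : Ideal R) →ₗ[R] R) {m p : ℕ}
    (h : m ≤ p) : s16gm hIJ n g p ≫ s16incl (Ideal.pow_le_pow_right h) =
      s16incl (Ideal.pow_le_pow_right (Nat.add_le_add_right h n)) ≫ s16gm hIJ n g m := rfl

def s16ψ {I J : Ideal R} (hIJ : I ≤ J) (n : ℕ) (g : (J ^ n : Ideal R) →ₗ[R] R) (e : ℕ)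
    (M : ModuleCat.{u} R) (m : ℕ) :
    NExt (s16Im (I ^ m)) M e →ₗ[R] NExt (s16Im (I ^ (m + n))) M e where
  toFun x := (Ext.mk₀ (s16gm hIJ n g m)).comp x (zero_add _)
  map_add' _ _ := Ext.comp_add _ _ _ _
  map_smul' _ _ := Ext.comp_smul _ _ _ _

lemma s16ψ_res {I J : Ideal R} (hIJ : I ≤ J) (n : ℕ) (g : (J ^ n : Ideal R) →ₗ[R] R) (e : ℕ)
    (M : ModuleCat.{u} R) {m p : ℕ} (h : m ≤ p) (x : NExt (s16Im (I ^ m)) M e) :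
    s16ψ hIJ n g e M p (s16res (Ideal.pow_le_pow_right h) x) =
      s16res (Ideal.pow_le_pow_right (Nat.add_le_add_right h n)) (s16ψ hIJ n g e M m x) := by
  refine (Ext.mk₀_comp_mk₀_assoc _ _ _).trans ?_
  rw [s16gm_comm hIJ n g h]
  exact (Ext.mk₀_comp_mk₀_assoc _ _ _).symm

lemma s16_end {I J : Ideal R} (hIJ : I ≤ J) (n k : ℕ) (x : Fin k → R)
    (g : Fin k → ((J ^ n : Ideal R) →ₗ[R] R))
    (hg : ∀ a : (J ^ n : Ideal R), ∑ l, x l * g l a = a) (e : ℕ) (M : ModuleCat.{u} R) :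
    ∃ φ : Fin k → (s16LC I (e+1+1) M ⟶ s16LC I (e+1+1) M),
      ∑ l, x l • φ l = 𝟙 (s16LC I (e+1+1) M) := by
  choose Φ hΦ using fun l => s16_desc I e M (s16LC I (e+1+1) M)
    (fun m => s16κ I (e+1) M (m+n) ∘ₗ s16ψ hIJ n (g l) (e+1) M m) (by
      intro m p h y
      simp only [LinearMap.comp_apply]
      rw [s16ψ_res _ _ _ _ _ h, s16κ_res _ _ _ (Nat.add_le_add_right h n)])
  refine ⟨fun l => ModuleCat.ofHom (Φ l), ?_⟩
  ext z
  obtain ⟨m, y, rfl⟩ := s16κ_rep I (e+1) M z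
  have h1 : ∑ l, x l • s16ψ hIJ n (g l) (e+1) M m y =
      s16res (Ideal.pow_le_pow_right (Nat.le_add_right m n)) y := by
    have h2 : ∑ l, x l • s16gm hIJ n (g l) m =
        s16incl (Ideal.pow_le_pow_right (Nat.le_add_right m n)) := by
      ext a
      simp only [ModuleCat.hom_sum, ModuleCat.hom_smul, LinearMap.sum_apply, LinearMap.smul_apply]
      rw [Submodule.coe_sum]
      exact hg ⟨a, _⟩
    unfold s16res
    rw [← h2, Ext.mk₀_sum, Ext.sum_comp]
    refine Finset.sum_congr rfl fun l _ => ?_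
    rw [Ext.mk₀_smul, Ext.smul_comp]
    rfl
  simp only [ModuleCat.hom_sum, ModuleCat.hom_smul, LinearMap.sum_apply, LinearMap.smul_apply]
  have h3 := congrArg (s16κ I (e+1) M (m+n)) h1
  rw [s16κ_res _ _ _ (Nat.le_add_right m n), map_sum] at h3
  refine Eq.trans (Finset.sum_congr rfl fun l _ => ?_) h3
  rw [map_smul]
  exact congrArg _ (hΦ l m y)

lemma s16_final [IsNoetherianRing R] (J : Ideal R) (X : ModuleCat.{u} R) (k : ℕ) (x : Fin k → R)
    (hx : ∀ l, x l ∈ J) (φ : Fin k → (X ⟶ X)) (hφ : ∑ l, x l • φ l = 𝟙 X)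
    (N : Type u) [AddCommGroup N] [Module R N] [Module.Finite R N]
    (hN : Module.support R N ⊆ PrimeSpectrum.zeroLocus (J : Set R)) (j : ℕ) :
    Subsingleton (NExt (ModuleCat.of R N) X j) := by
  rw [Module.support_eq_zeroLocus, PrimeSpectrum.zeroLocus_subset_zeroLocus_iff] at hN
  obtain ⟨t, ht⟩ := Ideal.exists_pow_le_of_le_radical_of_fg hN (IsNoetherian.noetherian J)
  have htop : (⊤ : Submodule R (NExt (ModuleCat.of R N) X j)) ≤ J • ⊤ := by
    intro α _
    rw [← Ext.comp_mk₀_id α, ← hφ, Ext.mk₀_sum, Ext.comp_sum]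
    refine Submodule.sum_mem _ fun l _ => ?_
    rw [Ext.mk₀_smul, Ext.comp_smul]
    exact Submodule.smul_mem_smul (hx l) trivial
  have hpow : ∀ s : ℕ, (⊤ : Submodule R (NExt (ModuleCat.of R N) X j)) ≤ J ^ s • ⊤ := by
    intro s
    induction s with
    | zero => simp
    | succ s ih =>
      refine ih.trans ?_
      rw [pow_succ, Submodule.mul_smul]
      exact Submodule.smul_mono le_rfl htop
  have hbot : J ^ t • (⊤ : Submodule R (NExt (ModuleCat.of R N) X j)) ≤ ⊥ := by
    rw [Submodule.smul_le]
    intro r hr α _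
    have h0 : r • 𝟙 (ModuleCat.of R N) = 0 := by
      ext y
      exact Module.mem_annihilator.1 (ht hr) y
    rw [Submodule.mem_bot, ← Ext.mk₀_id_comp α, ← Ext.smul_comp, ← Ext.mk₀_smul, h0, Ext.mk₀_zero,
      Ext.zero_comp]
  refine ⟨fun a b => ?_⟩
  have ha : a ∈ (⊥ : Submodule R _) := hbot (hpow t (trivial : a ∈ (⊤ : Submodule R _)))
  have hb : b ∈ (⊥ : Submodule R _) := hbot (hpow t (trivial : b ∈ (⊤ : Submodule R _)))
  rw [Submodule.mem_bot] at ha hb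
  rw [ha, hb]

end Part5

theorem stmt16 (R : Type u) [CommRing R] [IsNoetherianRing R] (I J : Ideal R) (hIJ : I ≤ J)
    (hJcd₁ : ¬ Subsingleton (LC R J 1 (ModuleCat.of R R)))
    (hJcd₂ : ∀ i : ℕ, 2 ≤ i → Subsingleton (LC R J i (ModuleCat.of R R)))
    (M : Type u) [AddCommGroup M] [Module R M]
    (N : Type u) [AddCommGroup N] [Module R N] [Module.Finite R N]
    (hN : Module.support R N ⊆ PrimeSpectrum.zeroLocus (J : Set R)) :
    ∀ i j : ℕ, 2 ≤ i →
      Subsingleton (ExtMod R j (ModuleCat.of R N) (LC R I i (ModuleCat.of R M))) := by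
  intro i j hi
  obtain ⟨e, rfl⟩ := Nat.exists_eq_add_of_le' hi
  obtain ⟨n, k, x, g, hx, hg⟩ := s16_split (J := J) hJcd₂
  obtain ⟨φ, hφ⟩ := s16_end hIJ n k x g hg e (ModuleCat.of R M)
  exact s16_old_zero _ _ (fun j => s16_final J _ k x hx φ hφ N hN j) j
end
end

section
/- Let R be a commutative Noetherian ring, I ⊆ J ideals of R with cd(J, R) = 1, M an R-module, and p ∈ V(J) a prime ideal. Then all Bass numbers μ^j(p, H^i_I(M)) and all Betti numbers β_j(p, H^i_I(M)) vanish for all i ≥ 2 and j ≥ 0. -/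
open CategoryTheory

noncomputable section

universe u

set_option linter.unusedSectionVars false

namespace LCP
open Limits Opposite


section Abs
universe v₁ u₁ v₂ u₂
variable {C : Type u₁} [Category.{v₁} C] [Abelian C] [HasProjectiveResolutions C]
  {D : Type u₂} [Category.{v₂} D] [Abelian D]

def K {A : C} (P : ProjectiveResolution A) (F : C ⥤ D) [F.Additive] : ChainComplex D ℕ :=
  (F.mapHomologicalComplex _).obj P.complex

def isoK {A : C} (P : ProjectiveResolution A) (F : C ⥤ D) [F.Additive] (n : ℕ) :
    (F.leftDerived n).obj A ≅ (K P F).homology n := P.isoLeftDerivedObj F n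

def iota {A : C} (P : ProjectiveResolution A) (F : C ⥤ D) [F.Additive] (n : ℕ) :
    (F.leftDerived n).obj A ⟶ (K P F).opcycles n :=
  (isoK P F n).hom ≫ HomologicalComplex.homologyι (K P F) n

instance {A : C} (P : ProjectiveResolution A) (F : C ⥤ D) [F.Additive] (n : ℕ) :
    Mono (iota P F n) := by
  unfold iota
  infer_instance

lemma iota_w {A : C} (P : ProjectiveResolution A) (F : C ⥤ D) [F.Additive] (n : ℕ) :
    iota P F (n+1) ≫ (K P F).fromOpcycles (n+1) n = 0 := by
  simp [iota]

lemma iota_exact {A : C} (P : ProjectiveResolution A) (F : C ⥤ D) [F.Additive] (n : ℕ) :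
    (ShortComplex.mk _ _ (iota_w P F n)).Exact := by
  have h1 := (ShortComplex.exact_of_f_is_kernel
    (ShortComplex.mk _ _ ((K P F).homologyι_comp_fromOpcycles (n+1) n))
    ((K P F).homologyIsKernel (n+1) n (by simp)))
  refine (ShortComplex.exact_iff_of_iso ?_).2 h1
  exact ShortComplex.isoMk (isoK P F (n+1)) (Iso.refl _) (Iso.refl _)
    (by simp [iota]) (by simp)

lemma iota_pre {A A' : C} (P : ProjectiveResolution A) (P' : ProjectiveResolution A') (f : A' ⟶ A)
   (φ : P'.complex ⟶ P.complex) (comm : φ.f 0 ≫ P.π.f 0 = P'.π.f 0 ≫ f)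
   (F : C ⥤ D) [F.Additive] (n : ℕ) :
   ∃ ψ : (K P' F).opcycles n ⟶ (K P F).opcycles n,
     (F.leftDerived n).map f ≫ iota P F n = iota P' F n ≫ ψ ∧
     (K P' F).pOpcycles n ≫ ψ = F.map (φ.f n) ≫ (K P F).pOpcycles n := by
  let φ' : K P' F ⟶ K P F := (F.mapHomologicalComplex _).map φ
  refine ⟨HomologicalComplex.opcyclesMap φ' n, ?_, ?_⟩
  · have h1 : (F.leftDerived n).map f ≫ (isoK P F n).hom = (isoK P' F n).hom ≫
      HomologicalComplex.homologyMap φ' n :=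
      P'.isoLeftDerivedObj_hom_naturality f P φ comm F n
    simp only [iota, Category.assoc]
    rw [reassoc_of% h1, HomologicalComplex.homologyι_naturality]
  · exact HomologicalComplex.p_opcyclesMap φ' n

lemma iota_post {A : C} (P : ProjectiveResolution A)
   {F F' : C ⥤ D} [F.Additive] [F'.Additive] (α : F' ⟶ F) (n : ℕ) :
   ∃ ψ : (K P F').opcycles n ⟶ (K P F).opcycles n,
     (NatTrans.leftDerived α n).app A ≫ iota P F n = iota P F' n ≫ ψ ∧
     (K P F').pOpcycles n ≫ ψ = α.app (P.complex.X n) ≫ (K P F).pOpcycles n := by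
  let φ' : K P F' ⟶ K P F := (NatTrans.mapHomologicalComplex α _).app P.complex
  refine ⟨HomologicalComplex.opcyclesMap φ' n, ?_, ?_⟩
  · have h1 : (NatTrans.leftDerived α n).app A = (isoK P F' n).hom ≫
      HomologicalComplex.homologyMap φ' n ≫ (isoK P F n).inv :=
      ProjectiveResolution.leftDerived_app_eq α P n
    simp only [iota, Category.assoc]
    rw [h1]
    simp only [Category.assoc, Iso.inv_hom_id_assoc]
    rw [HomologicalComplex.homologyι_naturality]
  · exact HomologicalComplex.p_opcyclesMap φ' n

lemma p_exact {A : C} (P : ProjectiveResolution A) (F : C ⥤ D) [F.Additive] (n : ℕ) :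
   (ShortComplex.mk _ _ ((K P F).d_pOpcycles (n+1) n)).Exact :=
  ShortComplex.exact_of_g_is_cokernel _
    ((K P F).opcyclesIsCokernel (n+1) n (by simp))

lemma p_from {A : C} (P : ProjectiveResolution A) (F : C ⥤ D) [F.Additive] (n : ℕ) :
   (K P F).pOpcycles (n+1) ≫ (K P F).fromOpcycles (n+1) n = F.map (P.complex.d (n+1) n) := by
  rw [HomologicalComplex.p_fromOpcycles]; rfl
end Abs

section Old
variable {R : Type u} [CommRing R] {A A' : ModuleCat.{u} R}

abbrev Old (n : ℕ) (A Y : ModuleCat.{u} R) : ModuleCat.{u} R :=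
  ((Ext R (ModuleCat.{u} R) n).obj (op A)).obj Y

abbrev G (Y : ModuleCat.{u} R) : ModuleCat.{u} R ⥤ (ModuleCat.{u} R)ᵒᵖ :=
  ((linearYoneda R (ModuleCat.{u} R)).obj Y).rightOp

abbrev OC (P : ProjectiveResolution A) (Y : ModuleCat.{u} R) (n : ℕ) : ModuleCat.{u} R :=
  ((K P (G Y)).opcycles n).unop

def qq (P : ProjectiveResolution A) (Y : ModuleCat.{u} R) (n : ℕ) :
    OC P Y n →ₗ[R] (P.complex.X n ⟶ Y) :=
  ((K P (G Y)).pOpcycles n).unop.hom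

def rho (P : ProjectiveResolution A) (Y : ModuleCat.{u} R) (n : ℕ) :
    OC P Y n →ₗ[R] Old n A Y :=
  (iota P (G Y) n).unop.hom

lemma qq_inj (P : ProjectiveResolution A) (Y : ModuleCat.{u} R) (n : ℕ) :
    Function.Injective (qq P Y n) := by
  have : Epi ((K P (G Y)).pOpcycles n) := inferInstance
  exact (ModuleCat.mono_iff_injective _).1 (inferInstanceAs (Mono ((K P (G Y)).pOpcycles n).unop))

lemma rho_surj (P : ProjectiveResolution A) (Y : ModuleCat.{u} R) (n : ℕ) :
    Function.Surjective (rho P Y n) := by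
  exact (ModuleCat.epi_iff_surjective _).1 (inferInstanceAs (Epi (iota P (G Y) n).unop))

lemma qq_cocycle (P : ProjectiveResolution A) (Y : ModuleCat.{u} R) (n : ℕ) 
    (z : OC P Y n) : P.complex.d (n+1) n ≫ (qq P Y n z) = 0 := by
  have h : (K P (G Y)).d (n+1) n ≫ (K P (G Y)).pOpcycles n = 0 := HomologicalComplex.d_pOpcycles _ _ _
  exact congrArg (fun f => f.unop.hom z) h

lemma qq_exists (P : ProjectiveResolution A) (Y : ModuleCat.{u} R) (n : ℕ) 
    (c : P.complex.X n ⟶ Y) (hc : P.complex.d (n+1) n ≫ c = 0) :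
    ∃ z, qq P Y n z = c := by
  have h1 := (p_exact P (G Y) n).unop
  rw [ShortComplex.moduleCat_exact_iff] at h1
  exact h1 c hc

lemma rho_zero (P : ProjectiveResolution A) (Y : ModuleCat.{u} R) (n : ℕ) 
    (z : OC P Y (n+1)) :
    rho P Y (n+1) z = 0 ↔ ∃ b : P.complex.X n ⟶ Y, P.complex.d (n+1) n ≫ b = qq P Y (n+1) z := by
  have h1 := (iota_exact P (G Y) n).unop
  rw [ShortComplex.moduleCat_exact_iff] at h1
  have hq : ∀ b : P.complex.X n ⟶ Y, qq P Y (n+1) (((K P (G Y)).fromOpcycles (n+1) n).unop.hom b) = 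
      P.complex.d (n+1) n ≫ b := by
    intro b
    exact congrArg (fun f => f.unop.hom b) (p_from P (G Y) n)
  constructor
  · intro h
    obtain ⟨b, hb⟩ := h1 z h
    exact ⟨b, (hq b).symm.trans (congrArg (qq P Y (n+1)) hb)⟩
  · rintro ⟨b, hb⟩
    rw [← hq] at hb
    have := qq_inj P Y (n+1) hb
    rw [← this]
    exact congrArg (fun f => f.unop.hom b) (iota_w P (G Y) n)

lemma nat_pre (P : ProjectiveResolution A) (P' : ProjectiveResolution A') (f : A' ⟶ A) 
   (φ : P'.complex ⟶ P.complex) (comm : φ.f 0 ≫ P.π.f 0 = P'.π.f 0 ≫ f)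
   (Y : ModuleCat.{u} R) (n : ℕ) (z) (z') 
   (h : qq P' Y n z' = φ.f n ≫ qq P Y n z) : 
   ((Ext R (ModuleCat.{u} R) n).map f.op).app Y (rho P Y n z) = rho P' Y n z' := by
  obtain ⟨ψ, h1, h2⟩ := iota_pre P P' f φ comm (G Y) n
  have hz : ψ.unop.hom z = z' := by
    apply qq_inj
    rw [h]
    exact congrArg (fun f => f.unop.hom z) h2
  rw [← hz]
  exact congrArg (fun f => f.unop.hom z) h1

lemma nat_post (P : ProjectiveResolution A) {Y Y' : ModuleCat.{u} R} (g : Y ⟶ Y')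
   (n : ℕ) (z) (z') 
   (h : qq P Y' n z' = qq P Y n z ≫ g) : 
   ((Ext R (ModuleCat.{u} R) n).obj (op A)).map g (rho P Y n z) = rho P Y' n z' := by
  let α : G Y' ⟶ G Y := NatTrans.rightOp ((linearYoneda R (ModuleCat.{u} R)).map g)
  obtain ⟨ψ, h1, h2⟩ := iota_post P α n
  have hz : ψ.unop.hom z = z' := by
    apply qq_inj
    rw [h]
    exact congrArg (fun f => f.unop.hom z) h2
  rw [← hz]
  exact congrArg (fun f => f.unop.hom z) h1
end Old


section Rel
variable {R : Type u} [CommRing R] {A A' Y Y' : ModuleCat.{u} R} {n : ℕ}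

abbrev PR (A : ModuleCat.{u} R) : ProjectiveResolution A := projectiveResolution A

def Rel (x : Old (n+1) A Y) (y : Abelian.Ext A Y (n+1)) : Prop :=
  ∃ z, rho (PR A) Y _ z = x ∧ (PR A).extMk (qq (PR A) Y _ z) (n+2) rfl (qq_cocycle _ _ _ z) = y

lemma rel_left (x : Old (n+1) A Y) : ∃ y, Rel x y := by
  obtain ⟨z, hz⟩ := rho_surj (PR A) Y (n+1) x
  exact ⟨_, z, hz, rfl⟩

lemma rel_right (y : Abelian.Ext A Y (n+1)) : ∃ x, Rel x y := by
  obtain ⟨c, hc, h⟩ := (PR A).extMk_surjective y (n+2) rfl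
  obtain ⟨z, hz⟩ := qq_exists (PR A) Y (n+1) c hc
  subst hz
  exact ⟨_, z, rfl, h⟩

lemma rel_zero {x : Old (n+1) A Y} {y : Abelian.Ext A Y (n+1)} (h : Rel x y) :
    x = 0 ↔ y = 0 := by
  obtain ⟨z, rfl, rfl⟩ := h
  rw [rho_zero, (PR A).extMk_eq_zero_iff _ _ _ _ n rfl]

lemma rel_sub {x x' : Old (n+1) A Y} {y y' : Abelian.Ext A Y (n+1)} (h : Rel x y) (h' : Rel x' y') :
    Rel (x - x') (y - y') := by
  obtain ⟨z, rfl, rfl⟩ := h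
  obtain ⟨z', rfl, rfl⟩ := h'
  refine ⟨z - z', map_sub _ _ _, ?_⟩
  rw [(PR A).sub_extMk]
  congr 1
  exact map_sub _ _ _

lemma rel_inj {x x' : Old (n+1) A Y} {y : Abelian.Ext A Y (n+1)} (h : Rel x y) (h' : Rel x' y) :
    x = x' := by
  rw [← sub_eq_zero, rel_zero (rel_sub h h'), sub_self]

lemma rel_post {x : Old (n+1) A Y} {y : Abelian.Ext A Y (n+1)} (h : Rel x y) (g : Y ⟶ Y') :
    Rel (((Ext R (ModuleCat.{u} R) (n+1)).obj (op A)).map g x)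
      (y.comp (Abelian.Ext.mk₀ g) (add_zero _)) := by
  obtain ⟨z, rfl, rfl⟩ := h
  obtain ⟨z', hz'⟩ := qq_exists (PR A) Y' (n+1) (qq (PR A) Y _ z ≫ g) (by
    rw [← Category.assoc, qq_cocycle, zero_comp])
  refine ⟨z', (nat_post _ g _ z z' hz').symm, ?_⟩
  rw [(PR A).extMk_comp_mk₀]
  congr 1

lemma rel_pre {x : Old (n+1) A Y} {y : Abelian.Ext A Y (n+1)} (h : Rel x y) (f : A' ⟶ A) :
    Rel (((Ext R (ModuleCat.{u} R) (n+1)).map f.op).app Y x)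
      ((Abelian.Ext.mk₀ f).comp y (zero_add _)) := by
  obtain ⟨z, rfl, rfl⟩ := h
  let φ : ProjectiveResolution.Hom (PR A') (PR A) f := 
    ⟨ProjectiveResolution.lift f (PR A') (PR A), ProjectiveResolution.lift_commutes_zero f _ _⟩
  obtain ⟨z', hz'⟩ := qq_exists (PR A') Y (n+1) (φ.hom.f (n+1) ≫ qq (PR A) Y _ z) (by
    rw [← φ.hom.comm_assoc, qq_cocycle, comp_zero])
  refine ⟨z', (nat_pre _ _ f φ.hom φ.hom_f_zero_comp_π_f_zero _ _ z z' hz').symm, ?_⟩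
  rw [ProjectiveResolution.mk₀_comp_extMk _ _ _ _ φ]
  congr 1
end Rel

section LCs
variable {R : Type u} [CommRing R] (J : Ideal R)

abbrev LCF (i : ℕ) : ModuleCat.{u} R ⥤ ModuleCat.{u} R := localCohomology J i

def Q (m : ℕ) : ModuleCat.{u} R := ModuleCat.of R (R ⧸ J ^ m)

def pr {m m' : ℕ} (h : m ≤ m') : Q J m' ⟶ Q J m :=
  ModuleCat.ofHom (Submodule.mapQ _ _ LinearMap.id (Ideal.pow_le_pow_right h))

lemma pr_eq {m m' : ℕ} (h : m ≤ m') : pr J h = 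
  (localCohomology.ringModIdeals (localCohomology.idealPowersDiagram J)).map (homOfLE h).op := rfl

lemma pr_comp {m m' m'' : ℕ} (h : m ≤ m') (h' : m' ≤ m'') : pr J h' ≫ pr J h = pr J (h.trans h') := by
  apply ModuleCat.hom_ext
  apply Submodule.linearMap_qext
  rfl

def lcCocone (i : ℕ) (X : ModuleCat.{u} R) :=
  ((evaluation _ _).obj X).mapCocone
    (colimit.cocone (localCohomology.diagram (localCohomology.idealPowersDiagram J) i))

def lcIsColimit (i : ℕ) (X : ModuleCat.{u} R) : IsColimit (lcCocone J i X) :=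
  isColimitOfPreserves ((evaluation _ _).obj X) (colimit.isColimit _)

def lcι (i m : ℕ) (X : ModuleCat.{u} R) : Old i (Q J m) X →ₗ[R] (LCF J i).obj X :=
  ((lcCocone J i X).ι.app (op (op m))).hom

instance presInst : PreservesFilteredColimitsOfSize.{0,0} (forget (ModuleCat.{u} R)) :=
  preservesFilteredColimitsOfSize_shrink.{0,u,0,u} _

instance filtInst : IsFiltered ℕᵒᵖᵒᵖ := IsFiltered.of_equivalence (opOpEquivalence ℕ).symm

instance presInst' : PreservesColimitsOfShape ℕᵒᵖᵒᵖ (forget (ModuleCat.{u} R)) :=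
  PreservesFilteredColimitsOfSize.preserves_filtered_colimits _

lemma lc_exists (i : ℕ) (X : ModuleCat.{u} R) (x : (LCF J i).obj X) :
    ∃ m y, lcι J i m X y = x := by
  obtain ⟨m, y, h⟩ := Concrete.isColimit_exists_rep _ (lcIsColimit J i X) x
  exact ⟨m.unop.unop, y, h⟩

lemma lc_trans (i : ℕ) (X : ModuleCat.{u} R) {m m' : ℕ} (h : m ≤ m') (y : Old i (Q J m) X) :
    lcι J i m' X (((Ext R (ModuleCat.{u} R) i).map (pr J h).op).app X y) = lcι J i m X y := by
  have := (lcCocone J i X).w (homOfLE h).op.op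
  exact congrArg (fun f => f.hom y) this

lemma lc_nat (i : ℕ) {X Y : ModuleCat.{u} R} (g : X ⟶ Y) {m : ℕ} (y : Old i (Q J m) X) :
    (LCF J i).map g (lcι J i m X y) = 
      lcι J i m Y (((Ext R (ModuleCat.{u} R) i).obj (op (Q J m))).map g y) := by
  have := (colimit.ι (localCohomology.diagram (localCohomology.idealPowersDiagram J) i) (op (op m))).naturality g
  exact (congrArg (fun f => f.hom y) this).symm

lemma lc_zero (i : ℕ) (X : ModuleCat.{u} R) {m : ℕ} (y : Old i (Q J m) X) 
   (h : lcι J i m X y = 0) : ∃ (m' : ℕ) (h : m ≤ m'),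
     ((Ext R (ModuleCat.{u} R) i).map (pr J h).op).app X y = 0 := by
  have := (Concrete.isColimit_rep_eq_iff_exists _ (lcIsColimit J i X) (i := op (op m)) (j := op (op m)) y 0).1
    (h.trans (map_zero (lcι J i m X)).symm)
  obtain ⟨k, f, g, hf⟩ := this
  refine ⟨k.unop.unop, leOfHom f.unop.unop, ?_⟩
  refine Eq.trans ?_ (hf.trans (map_zero _))
  rfl

def V (i : ℕ) (X : ModuleCat.{u} R) : Prop := 
  ∀ m (x : Abelian.Ext (Q J m) X i), ∃ (m' : ℕ) (h : m ≤ m'),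
    (Abelian.Ext.mk₀ (pr J h)).comp x (zero_add i) = 0

lemma V_of_sub (i : ℕ) (X : ModuleCat.{u} R) (h : Subsingleton ((LCF J (i+1)).obj X)) :
    V J (i+1) X := by
  intro m x
  obtain ⟨y, hy⟩ := rel_right x
  obtain ⟨m', h', hm⟩ := lc_zero J (i+1) X y (Subsingleton.elim _ _)
  exact ⟨m', h', (rel_zero (rel_pre hy (pr J h'))).1 hm⟩

lemma lc_bij (i : ℕ) {X Y : ModuleCat.{u} R} (f : X ⟶ Y)
    (hi : ∀ m (x : Abelian.Ext (Q J m) X (i+1)), x.comp (Abelian.Ext.mk₀ f) (add_zero _) = 0 → 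
      ∃ (m' : ℕ) (h : m ≤ m'), (Abelian.Ext.mk₀ (pr J h)).comp x (zero_add _) = 0)
    (hs : ∀ m (y : Abelian.Ext (Q J m) Y (i+1)), 
      ∃ (m' : ℕ) (h : m ≤ m') (x : Abelian.Ext (Q J m') X (i+1)), 
        x.comp (Abelian.Ext.mk₀ f) (add_zero _) = (Abelian.Ext.mk₀ (pr J h)).comp y (zero_add _)) :
    Function.Bijective ((LCF J (i+1)).map f) := by
  constructor
  · refine (injective_iff_map_eq_zero ((LCF J (i+1)).map f).hom).2 fun x hx => ?_
    obtain ⟨m, y, rfl⟩ := lc_exists _ _ _ x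
    replace hx := (lc_nat J (i+1) f y).symm.trans hx
    obtain ⟨m', h', hm⟩ := lc_zero _ _ _ _ hx
    obtain ⟨y', hy'⟩ := rel_left y
    have h1 := (rel_zero (rel_pre (rel_post hy' f) (pr J h'))).1 hm
    rw [← Abelian.Ext.comp_assoc (a₁₂ := i+1) _ _ _ (by lia) (by lia) (by lia)] at h1
    obtain ⟨m'', h'', hm''⟩ := hi _ _ h1
    rw [← lc_trans J _ _ h', ← lc_trans J _ _ h'',
      (rel_zero (rel_pre (rel_pre hy' (pr J h')) (pr J h''))).2 hm'', map_zero]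
  · intro y
    obtain ⟨m, y, rfl⟩ := lc_exists _ _ _ y
    obtain ⟨y', hy'⟩ := rel_left y
    obtain ⟨m', h, x, hx⟩ := hs m y'
    obtain ⟨x', hx'⟩ := rel_right x
    refine ⟨lcι J _ m' X x', ?_⟩
    rw [lc_nat, ← lc_trans J _ _ h]
    congr 1
    have := rel_post hx' f
    rw [hx] at this
    exact rel_inj this (rel_pre hy' _)
end LCs


section VS
variable {R : Type u} [CommRing R] (J : Ideal R)

def res {m m' : ℕ} (h : m ≤ m') {X : ModuleCat.{u} R} {i : ℕ} (x : Abelian.Ext (Q J m) X i) :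
    Abelian.Ext (Q J m') X i := (Abelian.Ext.mk₀ (pr J h)).comp x (zero_add i)

lemma res_res {m m' m'' : ℕ} (h : m ≤ m') (h' : m' ≤ m'') {X : ModuleCat.{u} R} {i : ℕ}
    (x : Abelian.Ext (Q J m) X i) : res J h' (res J h x) = res J (h.trans h') x := by
  unfold res
  rw [← pr_comp J h h', ← Abelian.Ext.mk₀_comp_mk₀, Abelian.Ext.comp_assoc_of_second_deg_zero]

lemma res_comp {m m' : ℕ} (h : m ≤ m') {X Y : ModuleCat.{u} R} {i j k : ℕ}
    (x : Abelian.Ext (Q J m) X i) (y : Abelian.Ext X Y j) (hk : i + j = k) : 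
    (res J h x).comp y hk = res J h (x.comp y hk) := by
  unfold res
  rw [Abelian.Ext.comp_assoc _ _ _ _ _ (by lia)]

lemma res_zero {m m' : ℕ} (h : m ≤ m') {X : ModuleCat.{u} R} {i : ℕ} :
    res J h (0 : Abelian.Ext (Q J m) X i) = 0 := by
  unfold res
  rw [Abelian.Ext.comp_zero]

variable {J}
lemma V_mid {S : ShortComplex (ModuleCat.{u} R)} (hS : S.ShortExact) {i : ℕ} 
    (h1 : V J i S.X₁) (h3 : V J i S.X₃) : V J i S.X₂ := by
  intro m x
  obtain ⟨m1, hm1, h⟩ := h3 m (x.comp (Abelian.Ext.mk₀ S.g) (add_zero _))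
  change res J hm1 _ = 0 at h
  rw [← res_comp] at h
  obtain ⟨y, hy⟩ := Abelian.Ext.covariant_sequence_exact₂ _ hS _ h
  obtain ⟨m2, hm2, h'⟩ := h1 m1 y
  change res J hm2 _ = 0 at h'
  refine ⟨m2, hm1.trans hm2, ?_⟩
  change res J _ _ = 0
  rw [← res_res J hm1 hm2, ← hy, ← res_comp, h', Abelian.Ext.zero_comp]

lemma V_left {S : ShortComplex (ModuleCat.{u} R)} (hS : S.ShortExact) {i : ℕ} 
    (h3 : V J i S.X₃) (h2 : V J (i+1) S.X₂) : V J (i+1) S.X₁ := by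
  intro m x
  obtain ⟨m1, hm1, h⟩ := h2 m (x.comp (Abelian.Ext.mk₀ S.f) (add_zero _))
  change res J hm1 _ = 0 at h
  rw [← res_comp] at h
  obtain ⟨y, hy⟩ := Abelian.Ext.covariant_sequence_exact₁ _ hS _ h rfl
  obtain ⟨m2, hm2, h'⟩ := h3 m1 y
  change res J hm2 _ = 0 at h'
  refine ⟨m2, hm1.trans hm2, ?_⟩
  change res J _ _ = 0
  rw [← res_res J hm1 hm2, ← hy, ← res_comp, h', Abelian.Ext.zero_comp]

lemma V_right {S : ShortComplex (ModuleCat.{u} R)} (hS : S.ShortExact) {i : ℕ} 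
    (h2 : V J i S.X₂) (h1 : V J (i+1) S.X₁) : V J i S.X₃ := by
  intro m x
  obtain ⟨m1, hm1, h⟩ := h1 m (x.comp hS.extClass rfl)
  change res J hm1 _ = 0 at h
  rw [← res_comp] at h
  obtain ⟨y, hy⟩ := Abelian.Ext.covariant_sequence_exact₃ _ hS _ rfl h
  obtain ⟨m2, hm2, h'⟩ := h2 m1 y
  change res J hm2 _ = 0 at h'
  refine ⟨m2, hm1.trans hm2, ?_⟩
  change res J _ _ = 0
  rw [← res_res J hm1 hm2, ← hy, ← res_comp, h', Abelian.Ext.zero_comp]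

lemma V_inj (E : ModuleCat.{u} R) [Injective E] (i : ℕ) : V J (i+1) E := 
  fun m _ => ⟨m, le_rfl, Abelian.Ext.eq_zero_of_injective _⟩
end VS

section Tors
variable {R : Type u} [CommRing R] 

def Gam (b : Ideal R) (E : Type u) [AddCommGroup E] [Module R E] : Submodule R E where
  carrier := {x | ∃ n, ∀ r ∈ b ^ n, r • x = 0}
  zero_mem' := ⟨0, by simp⟩
  add_mem' := by
    rintro x y ⟨n, hn⟩ ⟨m, hm⟩
    refine ⟨max n m, fun r hr => ?_⟩
    rw [smul_add, hn r (Ideal.pow_le_pow_right (le_max_left _ _) hr), 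
      hm r (Ideal.pow_le_pow_right (le_max_right _ _) hr), add_zero]
  smul_mem' := by
    rintro c x ⟨n, hn⟩
    exact ⟨n, fun r hr => by rw [smul_comm, hn r hr, smul_zero]⟩

lemma fg_unif (b : Ideal R) (E : Type u) [AddCommGroup E] [Module R E] (N : Submodule R E)
    (hN : N.FG) (h : N ≤ Gam b E) : ∃ n, ∀ r ∈ b ^ n, ∀ x ∈ N, r • x = 0 := by
  induction N, hN using Submodule.fg_induction with
  | singleton x => 
    obtain ⟨n, hn⟩ := h (Submodule.mem_span_singleton_self x)
    refine ⟨n, fun r hr y hy => ?_⟩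
    obtain ⟨c, rfl⟩ := Submodule.mem_span_singleton.1 hy
    rw [smul_comm, hn r hr, smul_zero]
  | sup N₁ N₂ _ _ h1 h2 =>
    obtain ⟨n, hn⟩ := h1 (le_sup_left.trans h)
    obtain ⟨m, hm⟩ := h2 (le_sup_right.trans h)
    refine ⟨max n m, fun r hr z hz => ?_⟩
    obtain ⟨x, hx, y, hy, rfl⟩ := Submodule.mem_sup.1 hz
    rw [smul_add, hn r (Ideal.pow_le_pow_right (le_max_left _ _) hr) x hx, 
      hm r (Ideal.pow_le_pow_right (le_max_right _ _) hr) y hy, add_zero]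

def Tors (b : Ideal R) (T : Type u) [AddCommGroup T] [Module R T] : Prop :=
  ∀ x : T, ∃ n, ∀ r ∈ b ^ n, r • x = 0

lemma V_bot (T : ModuleCat.{u} R) (i : ℕ) : V (⊥ : Ideal R) (i+1) T := by
  intro m x
  refine ⟨max m 1, le_max_left _ _, ?_⟩
  have h : (⊥ : Ideal R) ^ (max m 1) = ⊥ := by
    rw [← Ideal.zero_eq_bot, zero_pow]
    have := le_max_right m 1
    lia
  have : Module.Projective R (R ⧸ (⊥ : Ideal R) ^ (max m 1)) := 
    Module.Projective.of_equiv (Submodule.quotEquivOfEqBot _ h).symm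
  have : Projective (Q (⊥ : Ideal R) (max m 1)) := by
    unfold Q
    infer_instance
  exact Abelian.Ext.eq_zero_of_projective _

def prI {J' J : Ideal R} (h : J' ≤ J) (m : ℕ) : Q J' m ⟶ Q J m :=
  ModuleCat.ofHom (Submodule.mapQ _ _ LinearMap.id (Ideal.pow_right_mono h m))

variable [IsNoetherianRing R]

lemma gam_inj (b : Ideal R) (E : Type u) [AddCommGroup E] [Module R E] [hE : Module.Injective R E] :
    Module.Injective R (Gam b E) := by
  apply Module.Baer.injective
  intro a g
  obtain ⟨n, hn⟩ := fg_unif b E (LinearMap.range ((Gam b E).subtype ∘ₗ g)) (Submodule.FG.of_finite)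
    (by rintro _ ⟨x, rfl⟩; exact (g x).2)
  obtain ⟨k, hk⟩ := Ideal.exists_pow_inf_eq_pow_smul (M := R) b a
  have hk := hk (n + k) (by lia)
  have hle : b ^ (n+k) ⊓ a ≤ b ^ n * a := by
    have : b ^ (n+k) ⊓ a = b ^ (n + k) • ⊤ ⊓ a := by simp
    rw [this, hk, Nat.add_sub_cancel]
    rw [← smul_eq_mul]
    exact Submodule.smul_mono le_rfl inf_le_right
  have hg : ∀ (x : a), x.1 ∈ b ^ n * a → g x = 0 := by
    have key : b ^ n * a ≤ (LinearMap.ker g).map a.subtype := by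
      rw [Ideal.mul_le]
      intro r hr x hx
      refine ⟨r • ⟨x, hx⟩, ?_, rfl⟩
      change g (r • ⟨x, hx⟩) = 0
      rw [map_smul]
      exact Subtype.ext (hn r hr _ ⟨⟨x, hx⟩, rfl⟩)
    intro x hx
    obtain ⟨y, hy, h⟩ := key hx
    have : y = x := Subtype.ext h
    subst this
    exact hy
  let N : Submodule R a := Submodule.comap a.subtype (b ^ (n+k))
  let g1 : (a ⧸ N) →ₗ[R] E := N.liftQ ((Gam b E).subtype ∘ₗ g) (by
    intro x hx
    have := hg x (hle ⟨hx, x.2⟩)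
    simp [this])
  let j : (a ⧸ N) →ₗ[R] (R ⧸ b ^ (n+k)) := N.mapQ (b ^ (n+k)) a.subtype le_rfl
  have hj : Function.Injective j := by
    rw [← LinearMap.ker_eq_bot, Submodule.ker_mapQ]
    simp [N]
  obtain ⟨h, hh⟩ := hE.out j hj g1
  have hmem : h (Submodule.Quotient.mk 1) ∈ Gam b E := by
    refine ⟨n + k, fun r hr => ?_⟩
    rw [← map_smul, ← Submodule.Quotient.mk_smul, (Submodule.Quotient.mk_eq_zero _).2 (by simpa using hr),
      map_zero]
  refine ⟨LinearMap.toSpanSingleton R _ ⟨_, hmem⟩, fun x hx => Subtype.ext ?_⟩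
  have := hh (Submodule.Quotient.mk ⟨x, hx⟩)
  refine Eq.trans ?_ this
  change x • h (Submodule.Quotient.mk 1) = h (Submodule.Quotient.mk x)
  rw [← map_smul, ← Submodule.Quotient.mk_smul, smul_eq_mul, mul_one]

lemma tors_embed (b : Ideal R) (T : ModuleCat.{u} R) (hT : Tors b T) : 
    ∃ (E C : ModuleCat.{u} R) (f : T ⟶ E) (g : E ⟶ C) (w : f ≫ g = 0), 
      (ShortComplex.mk f g w).ShortExact ∧ Injective E ∧ Tors b E ∧ Tors b C := by
  let E0 := Injective.under T
  have : Module.Injective R E0 := 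
    Module.injective_module_of_injective_object R E0 (inj := inferInstanceAs (Injective (Injective.under T)))
  have hi : Function.Injective (Injective.ι T) := (ModuleCat.mono_iff_injective _).1 inferInstance
  let f0 : T →ₗ[R] Gam b E0 := (Injective.ι T).hom.codRestrict _ (by
    intro x
    obtain ⟨n, hn⟩ := hT x
    refine ⟨n, fun r hr => ?_⟩
    rw [← map_smul, hn r hr, map_zero])
  have hf0 : Function.Injective f0 := fun x y h => hi (congrArg Subtype.val h)
  have := gam_inj b E0
  have htE : Tors b (Gam b E0) := fun x => by
    obtain ⟨n, hn⟩ := x.2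
    exact ⟨n, fun r hr => Subtype.ext (hn r hr)⟩
  refine ⟨ModuleCat.of R (Gam b E0), ModuleCat.of R (Gam b E0 ⧸ LinearMap.range f0), ModuleCat.ofHom f0,
    ModuleCat.ofHom (Submodule.mkQ _), ?_, ?_, Module.injective_object_of_injective_module R _, htE, ?_⟩
  · apply ModuleCat.hom_ext
    exact LinearMap.range_mkQ_comp f0
  · refine ModuleCat.shortComplex_shortExact _ ?_ hf0 (Submodule.mkQ_surjective _)
    exact LinearMap.exact_map_mkQ_range f0
  · intro x
    obtain ⟨x, rfl⟩ := Submodule.mkQ_surjective _ x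
    obtain ⟨n, hn⟩ := htE x
    exact ⟨n, fun r hr => by rw [← map_smul, hn r hr, map_zero]⟩

lemma lemS (b J' : Ideal R) (i : ℕ) : ∀ (T : ModuleCat.{u} R), Tors b T → V J' (i+1) T →
    V (J' ⊔ b) (i+1) T := by
  induction i with
  | zero =>
    intro T hT hV m x
    obtain ⟨E, C, f, g, w, hS, hE, hE2, hC⟩ := tors_embed b T hT
    obtain ⟨g0, hg0⟩ := Abelian.Ext.covariant_sequence_exact₁ _ hS x 
      (Abelian.Ext.eq_zero_of_injective _) rfl
    obtain ⟨g0, rfl⟩ := (Abelian.Ext.mk₀_bijective _ _).2 g0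
    dsimp at g0
    let p' := prI (le_sup_left : J' ≤ J' ⊔ b) m
    obtain ⟨m', hm', h⟩ := hV m ((Abelian.Ext.mk₀ p').comp x (zero_add _))
    rw [← hg0, Abelian.Ext.mk₀_comp_mk₀_assoc, Abelian.Ext.mk₀_comp_mk₀_assoc] at h
    obtain ⟨k, hk⟩ := Abelian.Ext.covariant_sequence_exact₃ _ hS _ _ h
    obtain ⟨k, rfl⟩ := (Abelian.Ext.mk₀_bijective _ _).2 k
    rw [Abelian.Ext.mk₀_comp_mk₀] at hk
    replace hk := (Abelian.Ext.mk₀_bijective _ _).1 hk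
    let e : E := k.hom (Submodule.Quotient.mk 1 : R ⧸ J' ^ m')
    have he : g.hom e = g0.hom (Submodule.Quotient.mk 1 : R ⧸ (J' ⊔ b) ^ m) := by
      exact congrArg (fun f => f.hom (Submodule.Quotient.mk 1 : R ⧸ J' ^ m')) hk
    have he1 : ∀ r ∈ J' ^ m', r • e = 0 := by
      intro r hr
      have : r • (Submodule.Quotient.mk 1 : R ⧸ J' ^ m') = 0 := by
        rw [← Submodule.Quotient.mk_smul, Submodule.Quotient.mk_eq_zero]
        simpa using hr
      exact (map_smul k.hom r (Submodule.Quotient.mk 1 : R ⧸ J' ^ m')).symm.trans 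
        ((congrArg k.hom this).trans (map_zero _))
    obtain ⟨n, hn⟩ := hE2 e
    have he2 : ∀ r ∈ (J' ⊔ b) ^ (m' + n), r • e = 0 := by
      intro r hr
      have hr := Ideal.sup_pow_add_le_pow_sup_pow hr
      obtain ⟨r1, h1, r2, h2, rfl⟩ := Submodule.mem_sup.1 hr
      rw [add_smul, he1 _ h1, hn _ h2, add_zero]
    let N := m + (m' + n)
    let l : (R ⧸ (J' ⊔ b) ^ N) →ₗ[R] E := Submodule.liftQ _ (LinearMap.toSpanSingleton R E e) (by
      intro r hr
      exact he2 r (Ideal.pow_le_pow_right (by lia) hr))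
    refine ⟨N, by lia, ?_⟩
    let l' : Q (J' ⊔ b) N ⟶ (ShortComplex.mk f g w).X₂ := ModuleCat.ofHom l
    have hl : pr (J' ⊔ b) (by lia : m ≤ N) ≫ g0 = l' ≫ (ShortComplex.mk f g w).g := by
      apply ModuleCat.hom_ext
      apply Submodule.linearMap_qext
      apply LinearMap.ext_ring
      change g0.hom (Submodule.Quotient.mk 1 : R ⧸ (J' ⊔ b) ^ m) = g.hom ((1 : R) • e)
      rw [← he, one_smul]
    rw [← hg0, Abelian.Ext.mk₀_comp_mk₀_assoc]
    rw [hl, ← Abelian.Ext.mk₀_comp_mk₀_assoc]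
    rw [hS.comp_extClass, Abelian.Ext.comp_zero]
  | succ i ih => 
    intro T hT hV
    obtain ⟨E, C, f, g, w, hS, hE, hE2, hC⟩ := tors_embed b T hT
    exact V_left hS (ih C hC (V_right hS (V_inj E i) hV)) (V_inj E _)

end Tors


section Bnd
variable {R : Type u} [CommRing R] 

lemma Tors.mono {b c : Ideal R} (h : c ≤ b) {T : Type u} [AddCommGroup T] [Module R T] 
    (hT : Tors b T) : Tors c T := fun x => by
  obtain ⟨n, hn⟩ := hT x
  exact ⟨n, fun r hr => hn r (Ideal.pow_right_mono h n hr)⟩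

def kerS {X Y : ModuleCat.{u} R} (f : X ⟶ Y) : ShortComplex (ModuleCat.{u} R) :=
  ShortComplex.mk (X₁ := ModuleCat.of R (LinearMap.ker f.hom)) (X₂ := X) 
    (X₃ := ModuleCat.of R (LinearMap.range f.hom))
    (ModuleCat.ofHom (LinearMap.ker f.hom).subtype) (ModuleCat.ofHom f.hom.rangeRestrict) (by
      apply ModuleCat.hom_ext
      ext x
      exact x.2)

lemma kerS_exact {X Y : ModuleCat.{u} R} (f : X ⟶ Y) : (kerS f).ShortExact := by
  refine ModuleCat.shortComplex_shortExact _ ?_ (Subtype.val_injective) (LinearMap.surjective_rangeRestrict f.hom)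
  intro x
  constructor
  · intro h
    exact ⟨⟨x, congrArg Subtype.val h⟩, rfl⟩
  · rintro ⟨y, rfl⟩
    exact Subtype.ext y.2

def cokS {X Y : ModuleCat.{u} R} (f : X ⟶ Y) : ShortComplex (ModuleCat.{u} R) :=
  ShortComplex.mk (X₁ := ModuleCat.of R (LinearMap.range f.hom)) (X₂ := Y) 
    (X₃ := ModuleCat.of R (Y ⧸ LinearMap.range f.hom))
    (ModuleCat.ofHom (LinearMap.range f.hom).subtype) (ModuleCat.ofHom (Submodule.mkQ _)) (by
      apply ModuleCat.hom_ext
      ext x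
      exact (Submodule.Quotient.mk_eq_zero _).2 x.2)

lemma cokS_exact {X Y : ModuleCat.{u} R} (f : X ⟶ Y) : (cokS f).ShortExact := by
  refine ModuleCat.shortComplex_shortExact _ ?_ (Subtype.val_injective) (Submodule.mkQ_surjective _)
  exact LinearMap.exact_subtype_mkQ _

lemma V_unit (J : Ideal R) (a : R) (ha : a ∈ J) (Y : ModuleCat.{u} R) 
    (hY : IsUnit (algebraMap R (Module.End R Y) a)) (i : ℕ) : V J i Y := by
  intro m x
  refine ⟨m, le_rfl, ?_⟩
  suffices x = 0 by rw [this, Abelian.Ext.comp_zero]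
  have h1 : a ^ m • x = 0 := by
    have : (a ^ m • 𝟙 (Q J m)) = 0 := by
      apply ModuleCat.hom_ext
      apply Submodule.linearMap_qext
      apply LinearMap.ext_ring
      change a ^ m • (Submodule.Quotient.mk 1 : R ⧸ J ^ m) = 0
      rw [← Submodule.Quotient.mk_smul, Submodule.Quotient.mk_eq_zero]
      simpa using Ideal.pow_mem_pow ha m
    rw [← Abelian.Ext.mk₀_id_comp x, ← Abelian.Ext.smul_comp, ← Abelian.Ext.mk₀_smul, this,
      Abelian.Ext.mk₀_zero, Abelian.Ext.zero_comp]
  obtain ⟨w, hw⟩ := (hY.pow m).exists_right_inv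
  have h2 : a ^ m • (ModuleCat.ofHom w : Y ⟶ Y) = 𝟙 Y := by
    apply ModuleCat.hom_ext
    rw [← map_pow] at hw
    exact hw
  rw [← Abelian.Ext.comp_mk₀_id x, ← h2, Abelian.Ext.mk₀_smul, Abelian.Ext.comp_smul,
    ← Abelian.Ext.smul_comp, h1, Abelian.Ext.zero_comp]

variable [IsNoetherianRing R]

lemma V_bound (s : Finset R) : ∀ (X : ModuleCat.{u} R) (i : ℕ), s.card < i → 
    V (Ideal.span (s : Set R)) i X := by
  classical
  induction s using Finset.induction_on with
  | empty => 
    intro X i hi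
    obtain ⟨i, rfl⟩ : ∃ k, i = k + 1 := ⟨i - 1, by lia⟩
    simpa using V_bot X i
  | insert a s ha ih =>
    intro X i hi
    rw [Finset.card_insert_of_notMem ha] at hi
    obtain ⟨i, rfl⟩ : ∃ k, i = (k + 1) + 1 := ⟨i - 2, by lia⟩
    have hJ : Ideal.span ((insert a s : Finset R) : Set R) = Ideal.span (s : Set R) ⊔ Ideal.span {a} := by
      rw [Finset.coe_insert, Ideal.span_insert, sup_comm]
    let f : X ⟶ ModuleCat.of R (LocalizedModule (Submonoid.powers a) X) := 
      ModuleCat.ofHom (LocalizedModule.mkLinearMap _ _)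
    have hk : Tors (Ideal.span {a}) (LinearMap.ker f.hom) := by
      intro x
      obtain ⟨⟨_, n, rfl⟩, h⟩ := (IsLocalizedModule.eq_zero_iff (Submonoid.powers a) 
        (LocalizedModule.mkLinearMap (Submonoid.powers a) X)).1 x.2
      refine ⟨n, fun r hr => ?_⟩
      rw [Ideal.span_singleton_pow] at hr
      obtain ⟨c, rfl⟩ := Ideal.mem_span_singleton'.1 hr
      refine Subtype.ext ?_
      rw [mul_smul]
      change c • (a ^ n • x.1) = 0
      rw [show a ^ n • x.1 = 0 from h, smul_zero]
    have hc : Tors (Ideal.span {a}) (ModuleCat.of R (LocalizedModule (Submonoid.powers a) X) ⧸ LinearMap.range f.hom) := by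
      intro x
      obtain ⟨x, rfl⟩ := Submodule.mkQ_surjective _ x
      obtain ⟨⟨y, ⟨_, n, rfl⟩⟩, h⟩ := IsLocalizedModule.surj (Submonoid.powers a) 
        (LocalizedModule.mkLinearMap (Submonoid.powers a) X) x
      refine ⟨n, fun r hr => ?_⟩
      rw [Ideal.span_singleton_pow] at hr
      obtain ⟨c, rfl⟩ := Ideal.mem_span_singleton'.1 hr
      rw [← map_smul]
      refine (Submodule.Quotient.mk_eq_zero _).2 ?_
      rw [mul_smul]
      refine Submodule.smul_mem _ _ ⟨y, h.symm⟩
    rw [hJ]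
    refine V_mid (kerS_exact f) (lemS _ _ _ _ hk (ih _ _ (by lia))) ?_
    refine V_left (cokS_exact f) (lemS _ _ _ _ hc (ih _ _ (by lia))) ?_
    refine V_unit _ a (le_sup_right (a := Ideal.span (s : Set R)) (Ideal.mem_span_singleton_self a)) _ ?_ _
    exact IsLocalizedModule.map_units (S := Submonoid.powers a) 
        (LocalizedModule.mkLinearMap (Submonoid.powers a) X) ⟨a, Submonoid.mem_powers a⟩

lemma V_tors (J : Ideal R) (T : ModuleCat.{u} R) (hT : Tors J T) (i : ℕ) : V J (i+1) T := by
  simpa using lemS J ⊥ i T hT (V_bot T i)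

lemma V_free (J : Ideal R) (i n : ℕ) (h : V J i (ModuleCat.of R R)) : 
    V J i (ModuleCat.of R (Fin n → R)) := by
  intro m x
  choose m' hm' h0 using fun k : Fin n => h m (x.comp (Abelian.Ext.mk₀ 
    (ModuleCat.ofHom (LinearMap.proj k))) (add_zero _))
  have hle : ∀ k, m' k ≤ m + ∑ k, m' k := fun k => 
    (Finset.single_le_sum (f := m') (fun _ _ => Nat.zero_le _) (Finset.mem_univ k)).trans (by lia)
  refine ⟨m + ∑ k, m' k, by lia, ?_⟩
  have h1 : ∀ k : Fin n, (res J (by lia : m ≤ m + ∑ k, m' k) x).comp (Abelian.Ext.mk₀ 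
    (ModuleCat.ofHom (LinearMap.proj (R := R) (φ := fun _ => R) k))) (add_zero _) = 0 := by
    intro k
    rw [res_comp, ← res_res J (hm' k) (hle k)]
    exact (congrArg (res J (hle k)) (h0 k)).trans (res_zero _ _)
  change res J _ x = 0
  have h2 : 𝟙 (ModuleCat.of R (Fin n → R)) = ∑ k : Fin n, (ModuleCat.ofHom (LinearMap.proj k) ≫
      ModuleCat.ofHom (LinearMap.single R (fun _ => R) k)) := by
    apply ModuleCat.hom_ext
    rw [ModuleCat.hom_sum]
    ext j k
    simp [Pi.single_apply]
  rw [← Abelian.Ext.comp_mk₀_id (res J _ x), h2]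
  have h3 : ∀ (s : Finset (Fin n)) , (res J (by lia : m ≤ m + ∑ k, m' k) x).comp (Abelian.Ext.mk₀ (∑ k ∈ s, (ModuleCat.ofHom (LinearMap.proj k) ≫
      ModuleCat.ofHom (LinearMap.single R (fun _ => R) k)))) (add_zero _) = 0 := by
    classical
    intro s
    induction s using Finset.induction_on with
    | empty => simp
    | insert a s ha ih => 
      rw [Finset.sum_insert ha, Abelian.Ext.mk₀_add, Abelian.Ext.comp_add, ih, add_zero,
        ← Abelian.Ext.mk₀_comp_mk₀, ← Abelian.Ext.comp_assoc_of_second_deg_zero, h1, Abelian.Ext.zero_comp]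
  exact h3 _

lemma V_fg (J : Ideal R) (h : ∀ i, 2 ≤ i → V J i (ModuleCat.of R R)) :
    ∀ (X : ModuleCat.{u} R) [Module.Finite R X] (i : ℕ), 2 ≤ i → V J i X := by
  obtain ⟨s, hs⟩ : J.FG := IsNoetherian.noetherian J
  suffices ∀ (d : ℕ) (X : ModuleCat.{u} R) [Module.Finite R X] (i : ℕ), 2 ≤ i → s.card < i + d → V J i X from
    fun X _ i hi => this (s.card + 1) X i hi (by lia)
  intro d
  induction d with
  | zero => 
    intro X _ i hi h'
    subst hs
    exact V_bound s X i h'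
  | succ d ih => 
    intro X _ i hi h'
    obtain ⟨n, f, hf⟩ := Module.Finite.exists_fin' R X
    exact V_right (LinearMap.shortExact_shortComplexKer hf) (V_free J i n (h i hi)) 
      (ih (ModuleCat.of R (LinearMap.ker f)) (i+1) (by lia) (by lia))

def Tn (J : Ideal R) (n : ℕ) : ShortComplex (ModuleCat.{u} R) :=
  ShortComplex.mk (X₁ := ModuleCat.of R ↥(J^n)) (X₂ := ModuleCat.of R R) (X₃ := Q J n)
    (ModuleCat.ofHom (Submodule.subtype _)) (ModuleCat.ofHom (Submodule.mkQ _)) (by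
      apply ModuleCat.hom_ext
      ext x
      exact (Submodule.Quotient.mk_eq_zero _).2 x.2)

lemma Tn_exact (J : Ideal R) (n : ℕ) : (Tn J n).ShortExact := by
  refine ModuleCat.shortComplex_shortExact _ ?_ (Subtype.val_injective) (Submodule.mkQ_surjective _)
  exact LinearMap.exact_subtype_mkQ _

def TnMap (J : Ideal R) {m n : ℕ} (h : m ≤ n) : Tn J n ⟶ Tn J m where
  τ₁ := ModuleCat.ofHom (Submodule.inclusion (Ideal.pow_le_pow_right h))
  τ₂ := 𝟙 _
  τ₃ := pr J h
  comm₁₂ := rfl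
  comm₂₃ := rfl

lemma star (J : Ideal R) (h : ∀ i, 2 ≤ i → V J i (ModuleCat.of R R)) :
    ∃ (n r : ℕ) (a : Fin r → R) (s : Fin r → (↥(J^n) →ₗ[R] R)), (∀ k, a k ∈ J) ∧ 
      ∀ x : ↥(J^n), ∑ k, a k * s k x = x := by
  obtain ⟨r, f, hf⟩ := Module.Finite.exists_fin' R J
  let S := f.shortComplexKer
  have hS : S.ShortExact := LinearMap.shortExact_shortComplexKer hf
  have hfin : Module.Finite R S.X₁ := inferInstanceAs (Module.Finite R (LinearMap.ker f))
  let i1 : ModuleCat.of R ↥(J^1) ⟶ S.X₃ := ModuleCat.ofHom (Submodule.inclusion (by simp))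
  let e : ∀ n, Abelian.Ext (Q J n) (ModuleCat.of R ↥(J^n)) 1 := fun n => (Tn_exact J n).extClass
  obtain ⟨n, hn, h0⟩ := V_fg J h S.X₁ 2 le_rfl 1 
    (((e 1).comp (Abelian.Ext.mk₀ i1) (add_zero 1)).comp hS.extClass rfl)
  let t : ModuleCat.of R ↥(J^n) ⟶ ModuleCat.of R ↥(J^1) := (TnMap J hn).τ₁
  have h2 : (e n).comp (Abelian.Ext.mk₀ t) (add_zero _) = res J hn (e 1) :=
    (Tn_exact J n).extClass_naturality (Tn_exact J 1) (TnMap J hn)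
  change res J hn _ = 0 at h0
  rw [Abelian.Ext.comp_assoc_of_second_deg_zero, ← res_comp] at h0
  rw [← h2, Abelian.Ext.comp_assoc_of_second_deg_zero, Abelian.Ext.mk₀_comp_mk₀_assoc] at h0
  change (Tn_exact J n).extClass.comp _ _ = 0 at h0
  obtain ⟨y, hy⟩ := Abelian.Ext.contravariant_sequence_exact₁ _ _ _ _ h0
  have : Projective (Tn J n).X₂ := inferInstanceAs (Projective (ModuleCat.of R R))
  rw [Abelian.Ext.eq_zero_of_projective (n := 0) y, Abelian.Ext.comp_zero] at hy
  obtain ⟨z, hz⟩ := Abelian.Ext.covariant_sequence_exact₃ _ hS _ _ hy.symm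
  obtain ⟨z, rfl⟩ := (Abelian.Ext.mk₀_bijective _ _).2 z
  rw [Abelian.Ext.mk₀_comp_mk₀] at hz
  replace hz := (Abelian.Ext.mk₀_bijective _ _).1 hz
  let z' : ↥(J^n) →ₗ[R] (Fin r → R) := z.hom
  have hz' : ∀ x : ↥(J^n), (f (z' x) : R) = x := fun x => 
    congrArg (fun φ => (φ.hom x : J).1) hz
  refine ⟨n, r, fun k => f (Pi.single k 1), fun k => LinearMap.proj k ∘ₗ z', fun k => (f _).2, fun x => ?_⟩
  rw [← hz' x, LinearMap.pi_apply_eq_sum_univ f (z' x)]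
  have hh : ∀ k : Fin r, (Pi.single k 1 : Fin r → R) = fun j => if k = j then 1 else 0 := by
    intro k
    ext j
    simp [Pi.single_apply, eq_comm]
  simp [mul_comm, hh]
end Bnd


section Fin7
variable {R : Type u} [CommRing R] 

lemma lc_bij_g (I : Ideal R) {S : ShortComplex (ModuleCat.{u} R)} (hS : S.ShortExact) (i : ℕ)
    (h1 : V I (i+1) S.X₁) (h2 : V I (i+2) S.X₁) : Function.Bijective ((LCF I (i+1)).map S.g) := by
  apply lc_bij
  · intro m x hx
    obtain ⟨y, hy⟩ := Abelian.Ext.covariant_sequence_exact₂ _ hS _ hx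
    obtain ⟨m', h, hm⟩ := h1 _ y
    change res I h _ = 0 at hm
    refine ⟨m', h, ?_⟩
    change res I _ _ = 0
    rw [← hy, ← res_comp, hm, Abelian.Ext.zero_comp]
  · intro m y
    obtain ⟨m', h, hm⟩ := h2 _ (y.comp hS.extClass rfl)
    change res I h _ = 0 at hm
    rw [← res_comp] at hm
    obtain ⟨x, hx⟩ := Abelian.Ext.covariant_sequence_exact₃ _ hS _ _ hm
    exact ⟨m', h, x, hx⟩

lemma lc_bij_f (I : Ideal R) {S : ShortComplex (ModuleCat.{u} R)} (hS : S.ShortExact) (i : ℕ)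
    (h1 : V I i S.X₃) (h2 : V I (i+1) S.X₃) : Function.Bijective ((LCF I (i+1)).map S.f) := by
  apply lc_bij
  · intro m x hx
    obtain ⟨y, hy⟩ := Abelian.Ext.covariant_sequence_exact₁ _ hS _ hx rfl
    obtain ⟨m', h, hm⟩ := h1 _ y
    change res I h _ = 0 at hm
    refine ⟨m', h, ?_⟩
    change res I _ _ = 0
    rw [← hy, ← res_comp, hm, Abelian.Ext.zero_comp]
  · intro m y
    obtain ⟨m', h, hm⟩ := h2 _ (y.comp (Abelian.Ext.mk₀ S.g) (add_zero _))
    change res I h _ = 0 at hm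
    rw [← res_comp] at hm
    obtain ⟨x, hx⟩ := Abelian.Ext.covariant_sequence_exact₂ _ hS _ hm
    exact ⟨m', h, x, hx⟩

lemma lc_sum (I : Ideal R) (i : ℕ) {X Y : ModuleCat.{u} R} {r : ℕ} (a : Fin r → R)
    (g : Fin r → (X ⟶ Y)) (x : (LCF I i).obj X) :
    (LCF I i).map (∑ k, a k • g k) x = ∑ k, a k • (LCF I i).map (g k) x := by
  obtain ⟨m, y, rfl⟩ := lc_exists I i X x
  obtain ⟨z, rfl⟩ := rho_surj (PR _) X i y
  choose z' hz' using fun k => qq_exists (PR (Q I m)) Y i (qq _ _ _ z ≫ g k) (by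
    rw [← Category.assoc, qq_cocycle, zero_comp])
  have h1 : ∀ k, (LCF I i).map (g k) (lcι I i m X (rho (PR (Q I m)) X i z)) = 
      lcι I i m Y (rho (PR (Q I m)) Y i (z' k)) := by
    intro k
    rw [lc_nat, nat_post _ (g k) _ z (z' k) (hz' k)]
  simp only [h1]
  rw [lc_nat, nat_post _ (∑ k, a k • g k) _ z (∑ k, a k • z' k)]
  · rw [map_sum, map_sum]
    simp only [map_smul]
  · rw [map_sum, Preadditive.comp_sum]
    simp only [map_smul, hz', Linear.comp_smul]

variable [IsNoetherianRing R]

lemma lc_tors_bij (I : Ideal R) {X Y : ModuleCat.{u} R} (f : X ⟶ Y) 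
    (hk : Tors I (LinearMap.ker f.hom)) (hc : Tors I (Y ⧸ LinearMap.range f.hom)) (i : ℕ) :
    Function.Bijective ((LCF I (i+2)).map f) := by
  have h1 := lc_bij_g I (kerS_exact f) (i+1) (V_tors I _ hk _) (V_tors I _ hk _)
  have h2 := lc_bij_f I (cokS_exact f) (i+1) (V_tors I _ hc _) (V_tors I _ hc _)
  have h3 : f = (kerS f).g ≫ (cokS f).f := rfl
  have h4 : (LCF I (i+2)).map f = (LCF I (i+2)).map (kerS f).g ≫ (LCF I (i+2)).map (cokS f).f := 
    (LCF I (i+2)).map_comp (kerS f).g (cokS f).f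
  rw [h4]
  exact h2.comp h1

open TensorProduct in
lemma phi (I J : Ideal R) (hIJ : I ≤ J) (h : ∀ i, 2 ≤ i → V J i (ModuleCat.of R R))
    (M : ModuleCat.{u} R) (i : ℕ) : ∃ (r : ℕ) (a : Fin r → R) 
      (φ : Fin r → ((LCF I (i+2)).obj M →ₗ[R] (LCF I (i+2)).obj M)), (∀ k, a k ∈ J) ∧ 
       ∑ k, a k • φ k = LinearMap.id := by
  obtain ⟨n, r, a, s, ha, hs⟩ := star J h
  let μ : (↥(J^n) ⊗[R] M) →ₗ[R] M := TensorProduct.lid R M ∘ₗ LinearMap.rTensor M (J^n).subtype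
  let σ : Fin r → ((↥(J^n) ⊗[R] M) →ₗ[R] M) := fun k => TensorProduct.lid R M ∘ₗ LinearMap.rTensor M (s k)
  have hμ : ∀ (x : ↥(J^n)) (m : M), μ (x ⊗ₜ m) = (x : R) • m := fun x m => rfl
  have hσ : ∑ k, a k • σ k = μ := by
    apply TensorProduct.ext'
    intro x m
    rw [hμ, LinearMap.sum_apply, ← hs x, Finset.sum_smul]
    refine Finset.sum_congr rfl fun k _ => ?_
    rw [mul_smul]
    rfl
  have hk : Tors J (LinearMap.ker μ) := by
    intro t
    refine ⟨n, fun r hr => Subtype.ext ?_⟩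
    have : ∀ t : ↥(J^n) ⊗[R] M, r • t = (⟨r, hr⟩ : ↥(J^n)) ⊗ₜ[R] μ t := by
      intro t
      induction t using TensorProduct.induction_on with
      | zero => simp
      | tmul x m => 
        rw [hμ, TensorProduct.tmul_smul, TensorProduct.smul_tmul', TensorProduct.smul_tmul']
        congr 1
        exact Subtype.ext (mul_comm _ _)
      | add x y h1 h2 => rw [smul_add, h1, h2, map_add, TensorProduct.tmul_add]
    change r • t.1 = 0
    rw [this, show μ t.1 = 0 from t.2, TensorProduct.tmul_zero]
  have hc : Tors J (M ⧸ LinearMap.range μ) := by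
    intro x
    obtain ⟨x, rfl⟩ := Submodule.mkQ_surjective _ x
    refine ⟨n, fun r hr => ?_⟩
    rw [← map_smul]
    exact (Submodule.Quotient.mk_eq_zero _).2 ⟨(⟨r, hr⟩ : ↥(J^n)) ⊗ₜ[R] x, hμ _ _⟩
  let μ' : ModuleCat.of R (↥(J^n) ⊗[R] M) ⟶ M := ModuleCat.ofHom μ
  let σ' : Fin r → (ModuleCat.of R (↥(J^n) ⊗[R] M) ⟶ M) := fun k => ModuleCat.ofHom (σ k)
  have hb := lc_tors_bij I μ' (hk.mono hIJ) (hc.mono hIJ) i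
  have hσ' : ∑ k, a k • σ' k = μ' := by
    apply ModuleCat.hom_ext
    rw [ModuleCat.hom_sum]
    exact hσ
  let e := LinearEquiv.ofBijective ((LCF I (i+2)).map μ').hom hb
  refine ⟨r, a, fun k => ((LCF I (i+2)).map (σ' k)).hom ∘ₗ e.symm.toLinearMap, ha, ?_⟩
  ext y
  obtain ⟨x, rfl⟩ := e.surjective y
  rw [LinearMap.sum_apply]
  have := lc_sum I (i+2) a σ' x
  rw [hσ'] at this
  refine Eq.trans ?_ this.symm
  refine Finset.sum_congr rfl fun k _ => ?_
  simp
end Fin7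

section Fin8

lemma ld_add {C : Type*} [Category C] [Abelian C] [HasProjectiveResolutions C]
    {D : Type*} [Category D] [Abelian D] (F : C ⥤ D) [F.Additive] (n : ℕ) :
    (F.leftDerived n).Additive := by
  refine ⟨fun {X Y f g} => ?_⟩
  let P := projectiveResolution X
  let Q := projectiveResolution Y
  rw [Functor.leftDerived_map_eq F n f (P := P) (Q := Q) _ (ProjectiveResolution.lift_commutes f P Q),
    Functor.leftDerived_map_eq F n g (P := P) (Q := Q) _ (ProjectiveResolution.lift_commutes g P Q),
    Functor.leftDerived_map_eq F n (f + g) (P := P) (Q := Q) 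
      (ProjectiveResolution.lift f P Q + ProjectiveResolution.lift g P Q)]
  · rw [Functor.map_add, Preadditive.add_comp, Preadditive.comp_add]
  · rw [Preadditive.add_comp, ProjectiveResolution.lift_commutes, ProjectiveResolution.lift_commutes,
      ← Preadditive.comp_add]
    congr 1
    apply HomologicalComplex.to_single_hom_ext
    simp [ChainComplex.single₀]


lemma ext_van {A : Type u} [CommRing A] (κ N : ModuleCat.{u} A) {r : ℕ} (a : Fin r → A)
  (ha : ∀ k, ∀ x : κ, a k • x = 0) (φ : Fin r → (N →ₗ[A] N)) (hφ : ∑ k, a k • φ k = LinearMap.id)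
  (j : ℕ) : Subsingleton (Old j κ N) := by
  refine subsingleton_of_forall_eq 0 fun x => ?_
  obtain ⟨z, rfl⟩ := rho_surj (PR _) N j x
  choose z' hz' using fun k => qq_exists (PR κ) N j (qq _ _ _ z ≫ ModuleCat.ofHom (φ k)) (by
    rw [← Category.assoc, qq_cocycle, zero_comp])
  have h1 : z = ∑ k, a k • z' k := by
    apply qq_inj
    rw [map_sum]
    simp only [map_smul, hz', ← Linear.comp_smul]
    rw [← Preadditive.comp_sum]
    have : ∑ k, a k • ModuleCat.ofHom (φ k) = 𝟙 N := by
      apply ModuleCat.hom_ext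
      rw [ModuleCat.hom_sum]
      exact hφ
    rw [this, Category.comp_id]
  rw [h1, map_sum]
  refine Finset.sum_eq_zero fun k _ => ?_
  have h2 := nat_pre (PR κ) (PR κ) (0 : κ ⟶ κ) (a k • 𝟙 _) (by
    apply ModuleCat.hom_ext
    refine LinearMap.ext fun x => ?_
    exact (map_smul ((PR κ).π.f 0).hom (a k) x).trans (ha k _)) N j (z' k) (a k • z' k) (by
      rw [map_smul]
      simp)
  rw [← h2]
  have h3 : ((G N).leftDerived j).map (0 : κ ⟶ κ) = 0 := by
    have : ((G N).leftDerived j).Additive := ld_add _ _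
    exact Functor.map_zero _ _ _
  exact congrArg (fun f => f.unop.hom (rho (PR κ) N j (z' k))) h3

open TensorProduct in
lemma tor_van {A : Type u} [CommRing A] (κ N : ModuleCat.{u} A) {r : ℕ} (a : Fin r → A)
  (ha : ∀ k, ∀ x : κ, a k • x = 0) (φ : Fin r → (N →ₗ[A] N)) (hφ : ∑ k, a k • φ k = LinearMap.id)
  (j : ℕ) : Subsingleton (((Tor (ModuleCat.{u} A) j).obj κ).obj N) := by
  let F := (MonoidalCategory.tensoringLeft (ModuleCat.{u} A)).obj κ
  have h1 : ∀ k, (F.leftDerived j).map (a k • 𝟙 N) = 0 := by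
    intro k
    rw [Functor.leftDerived_map_eq F j (a k • 𝟙 N) (P := PR N) (Q := PR N) (a k • 𝟙 _) ?_]
    · have : (F.mapHomologicalComplex (ComplexShape.down ℕ) ⋙ HomologicalComplex.homologyFunctor _ _ j).map
        (a k • 𝟙 (PR N).complex) = 0 := by
        have : (F.mapHomologicalComplex (ComplexShape.down ℕ)).map
          (a k • 𝟙 (PR N).complex) = 0 := by
          apply HomologicalComplex.hom_ext
          intro n
          apply ModuleCat.hom_ext
          apply TensorProduct.ext'
          intro x y
          change x ⊗ₜ[A] (a k • y) = 0
          rw [TensorProduct.tmul_smul, TensorProduct.smul_tmul', ha, TensorProduct.zero_tmul]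
        rw [Functor.comp_map, this, Functor.map_zero]
      rw [this]
      simp
    · refine HomologicalComplex.to_single_hom_ext ?_
      simp [ChainComplex.single₀]
      rfl
  have h2 : 𝟙 N = ∑ k, ModuleCat.ofHom (φ k) ≫ (a k • 𝟙 N : N ⟶ N) := by
    apply ModuleCat.hom_ext
    rw [ModuleCat.hom_sum]
    exact hφ.symm
  have h3 : 𝟙 ((F.leftDerived j).obj N) = 0 := by
    have : (F.leftDerived j).Additive := ld_add _ _
    rw [← CategoryTheory.Functor.map_id, h2, Functor.map_sum]
    refine Finset.sum_eq_zero fun k _ => ?_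
    rw [Functor.map_comp, h1, comp_zero]
  exact ModuleCat.subsingleton_of_isZero ((IsZero.iff_id_eq_zero _).2 h3)
end Fin8
end LCP

theorem stmt17 (R : Type u) [CommRing R] [IsNoetherianRing R] (I J : Ideal R) (hIJ : I ≤ J)
    (hJcd₁ : ¬ Subsingleton (LC R J 1 (ModuleCat.of R R)))
    (hJcd₂ : ∀ i : ℕ, 2 ≤ i → Subsingleton (LC R J i (ModuleCat.of R R)))
    (M : Type u) [AddCommGroup M] [Module R M]
    (p : PrimeSpectrum R) (hp : J ≤ p.asIdeal) :
    ∀ i j : ℕ, 2 ≤ i →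
      Subsingleton (ExtMod (Localization.AtPrime p.asIdeal) j
          (ModuleCat.of (Localization.AtPrime p.asIdeal)
            (IsLocalRing.ResidueField (Localization.AtPrime p.asIdeal)))
          (ModuleCat.of (Localization.AtPrime p.asIdeal)
            (LocalizedModule p.asIdeal.primeCompl (LC R I i (ModuleCat.of R M))))) ∧
        Subsingleton (TorMod (Localization.AtPrime p.asIdeal) j
          (ModuleCat.of (Localization.AtPrime p.asIdeal)
            (IsLocalRing.ResidueField (Localization.AtPrime p.asIdeal)))
          (ModuleCat.of (Localization.AtPrime p.asIdeal)
            (LocalizedModule p.asIdeal.primeCompl (LC R I i (ModuleCat.of R M))))) := by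
  intro i j hi
  obtain ⟨i, rfl⟩ : ∃ k, i = k + 2 := ⟨i - 2, by lia⟩
  have hV : ∀ i, 2 ≤ i → LCP.V J i (ModuleCat.of R R) := by
    intro i hi
    obtain ⟨k, rfl⟩ : ∃ k, i = k + 1 := ⟨i - 1, by lia⟩
    exact LCP.V_of_sub J k _ (hJcd₂ _ hi)
  obtain ⟨r, a, φ, ha, hφ⟩ := LCP.phi I J hIJ hV (ModuleCat.of R M) i
  let A := Localization.AtPrime p.asIdeal
  let S := p.asIdeal.primeCompl
  have ha' : ∀ k, ∀ x : IsLocalRing.ResidueField A, algebraMap R A (a k) • x = 0 := by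
    intro k x
    have h1 : algebraMap A (IsLocalRing.ResidueField A) (algebraMap R A (a k)) = 0 := by
      rw [IsLocalRing.ResidueField.algebraMap_eq, IsLocalRing.residue_eq_zero_iff]
      exact (IsLocalization.AtPrime.to_map_mem_maximal_iff A p.asIdeal (a k)).2 (hp (ha k))
    rw [Algebra.smul_def, h1, zero_mul]
  have hφ' : ∑ k, algebraMap R A (a k) • LocalizedModule.map S (φ k) = LinearMap.id := by
    have := congrArg (LocalizedModule.map S) hφ
    rw [LocalizedModule.map_id, map_sum] at this
    refine Eq.trans ?_ this
    refine Finset.sum_congr rfl fun k _ => ?_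
    rw [map_smul]
    ext x
    exact algebraMap_smul A (a k) _
  exact ⟨LCP.ext_van (ModuleCat.of A (IsLocalRing.ResidueField A)) 
      (ModuleCat.of A (LocalizedModule S (LC R I (i+2) (ModuleCat.of R M)))) _ ha' _ hφ' j,
    LCP.tor_van (ModuleCat.of A (IsLocalRing.ResidueField A)) 
      (ModuleCat.of A (LocalizedModule S (LC R I (i+2) (ModuleCat.of R M)))) _ ha' _ hφ' j⟩
end
end

section
/- Let R be a commutative Noetherian domain and I, J two non-zero proper ideals of R with cd(J, R) = 1 and J not contained in the radical of I. Then cd(I ∩ J, R) = max{ i ∈ ℤ : Supp H^i_I(R) ⊄ V(J) }. -/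
open CategoryTheory

noncomputable section

universe u

namespace S18
open Opposite Limits

section op
variable {R : Type u} [CommRing R] (K : ChainComplex (ModuleCat.{u} R)ᵒᵖ ℕ)

def KRel (n : ℕ) (f : (K.X n).unop) (x : (K.homology n).unop) : Prop :=
  ∃ c : (K.opcycles n).unop, (K.pOpcycles n).unop c = f ∧ (K.homologyι n).unop c = x

lemma KRel.surj (n : ℕ) (x : (K.homology n).unop) :
    ∃ f, (K.d (n+1) n).unop f = 0 ∧ KRel K n f x := by
  have : Epi (K.homologyι n).unop := inferInstance
  obtain ⟨c, hc⟩ := (ModuleCat.epi_iff_surjective _).1 this x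
  refine ⟨(K.pOpcycles n).unop c, ?_, c, rfl, hc⟩
  rw [← ModuleCat.comp_apply, ← unop_comp, K.d_pOpcycles]
  rfl

lemma KRel.ex (n : ℕ) (f : (K.X n).unop) (hf : (K.d (n+1) n).unop f = 0) :
    ∃ x, KRel K n f x := by
  have h : (ShortComplex.mk _ _ (K.d_pOpcycles (n+1) n)).Exact :=
    ShortComplex.exact_of_g_is_cokernel _ (K.opcyclesIsCokernel (n+1) n (by simp))
  have h2 := h.unop
  rw [ShortComplex.moduleCat_exact_iff] at h2
  obtain ⟨c, hc⟩ := h2 f hf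
  exact ⟨_, c, hc, rfl⟩

lemma KRel.zero (n : ℕ) (f : (K.X (n+1)).unop) (x) (h : KRel K (n+1) f x) :
    x = 0 ↔ ∃ g, (K.d (n+1) n).unop g = f := by
  obtain ⟨c, rfl, rfl⟩ := h
  have h : (ShortComplex.mk _ _ (K.homologyι_comp_fromOpcycles (n+1) n)).Exact :=
    ShortComplex.exact_of_f_is_kernel _ (K.homologyIsKernel (n+1) n (by simp))
  have h2 := h.unop
  rw [ShortComplex.moduleCat_exact_iff] at h2
  have hd : ∀ g, (K.d (n+1) n).unop g = (K.pOpcycles (n+1)).unop ((K.fromOpcycles (n+1) n).unop g) := by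
    intro g
    rw [← ModuleCat.comp_apply, ← unop_comp, K.p_fromOpcycles]
  constructor
  · intro hx
    obtain ⟨g, hg⟩ := h2 c hx
    exact ⟨g, (hd g).trans (congrArg _ hg)⟩
  · rintro ⟨g, hg⟩
    have : Mono (K.pOpcycles (n+1)).unop := inferInstance
    rw [hd] at hg
    rw [← (ModuleCat.mono_iff_injective _).1 this hg]
    rw [← ModuleCat.comp_apply, ← unop_comp, K.homologyι_comp_fromOpcycles]
    rfl

lemma KRel.smul (n : ℕ) (f : (K.X n).unop) (x) (h : KRel K n f x) (s : R) :
    KRel K n (s • f) (s • x) := by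
  obtain ⟨c, rfl, rfl⟩ := h
  exact ⟨s • c, by simp, by simp⟩

lemma KRel.nat (n : ℕ) (f : (K.X n).unop) (x) (h : KRel K n f x)
    (K' : ChainComplex (ModuleCat.{u} R)ᵒᵖ ℕ) (φ : K' ⟶ K) :
    KRel K' n ((φ.f n).unop f) ((HomologicalComplex.homologyMap φ n).unop x) := by
  obtain ⟨c, rfl, rfl⟩ := h
  refine ⟨(HomologicalComplex.opcyclesMap φ n).unop c, ?_, ?_⟩
  · rw [← ModuleCat.comp_apply, ← ModuleCat.comp_apply, ← unop_comp, ← unop_comp,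
      HomologicalComplex.p_opcyclesMap]
  · rw [← ModuleCat.comp_apply, ← ModuleCat.comp_apply, ← unop_comp, ← unop_comp,
      HomologicalComplex.homologyι_naturality]
end op

section oldExt
variable {R : Type u} [CommRing R]

abbrev FY (M : ModuleCat.{u} R) : ModuleCat.{u} R ⥤ (ModuleCat.{u} R)ᵒᵖ :=
  ((linearYoneda R (ModuleCat.{u} R)).obj M).rightOp

abbrev OE (i : ℕ) (A M : ModuleCat.{u} R) : ModuleCat.{u} R :=
  ((Ext R (ModuleCat.{u} R) i).obj (op A)).obj M

abbrev PK {A : ModuleCat.{u} R} (P : ProjectiveResolution A) (M : ModuleCat.{u} R) :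
    ChainComplex (ModuleCat.{u} R)ᵒᵖ ℕ := ((FY M).mapHomologicalComplex _).obj P.complex

def eOld {A : ModuleCat.{u} R} (P : ProjectiveResolution A) (i : ℕ) (M : ModuleCat.{u} R) :
    OE i A M ≃ₗ[R] ((PK P M).homology i).unop :=
  ((P.isoLeftDerivedObj (FY M) i).unop.symm).toLinearEquiv

def toK {A M : ModuleCat.{u} R} (P : ProjectiveResolution A) (i : ℕ) (f : P.complex.X i ⟶ M) :
    ((PK P M).X i).unop := f

def OldRel {A M : ModuleCat.{u} R} (P : ProjectiveResolution A) (i : ℕ)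
    (f : P.complex.X i ⟶ M) (x : OE i A M) : Prop :=
  KRel (PK P M) i (toK P i f) (eOld P i M x)

variable {A M : ModuleCat.{u} R} (P : ProjectiveResolution A) (i : ℕ)

lemma OldRel.surj (x : OE i A M) : ∃ f, P.complex.d (i+1) i ≫ f = 0 ∧ OldRel P i f x :=
  KRel.surj (PK P M) i (eOld P i M x)

lemma OldRel.ex (f : P.complex.X i ⟶ M) (hf : P.complex.d (i+1) i ≫ f = 0) :
    ∃ x, OldRel P i f x := by
  obtain ⟨x, hx⟩ := KRel.ex (PK P M) i (toK P i f) hf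
  refine ⟨(eOld P i M).symm x, ?_⟩
  unfold OldRel
  rw [LinearEquiv.apply_symm_apply]
  exact hx

lemma OldRel.zero (f : P.complex.X (i+1) ⟶ M) (x : OE (i+1) A M) (h : OldRel P (i+1) f x) :
    x = 0 ↔ ∃ g, P.complex.d (i+1) i ≫ g = f := by
  refine Iff.trans ?_ (KRel.zero _ i _ _ h)
  exact (LinearEquiv.map_eq_zero_iff _).symm

lemma OldRel.smul (f : P.complex.X i ⟶ M) (x : OE i A M) (h : OldRel P i f x) (s : R) :
    OldRel P i (s • f) (s • x) := by
  have := KRel.smul _ i _ _ h s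
  rw [← map_smul] at this
  exact this

lemma OldRel.nat (f : P.complex.X i ⟶ M) (x : OE i A M) (h : OldRel P i f x)
    {A' : ModuleCat.{u} R} (P' : ProjectiveResolution A') (g : A' ⟶ A)
    (φ : ProjectiveResolution.Hom P' P g) :
    OldRel P' i (φ.hom.f i ≫ f) ((((Ext R (ModuleCat.{u} R) i).map g.op).app M) x) := by
  have h1 := KRel.nat _ i _ _ h _ (((FY M).mapHomologicalComplex _).map φ.hom)
  have h2 := P'.isoLeftDerivedObj_inv_naturality g P φ.hom (by simpa using φ.hom_f_zero_comp_π_f_zero) (FY M) i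
  have h3 : eOld P' i M ((((Ext R (ModuleCat.{u} R) i).map g.op).app M) x) =
    (HomologicalComplex.homologyMap (((FY M).mapHomologicalComplex _).map φ.hom) i).unop
      (eOld P i M x) := congrArg (fun t => t.unop x) h2
  unfold OldRel
  rw [h3]
  exact h1

/-- correspondence between old and new Ext -/
def W (i : ℕ) (x : OE i A M) (y : Abelian.Ext A M i) : Prop :=
  ∃ (P : ProjectiveResolution A) (f : P.complex.X i ⟶ M) (hf : P.complex.d (i+1) i ≫ f = 0),
    OldRel P i f x ∧ P.extMk f (i+1) rfl hf = y

lemma W.ex1 (x : OE i A M) : ∃ y, W i x y := by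
  obtain ⟨f, hf, h⟩ := OldRel.surj (projectiveResolution A) i x
  exact ⟨_, _, f, hf, h, rfl⟩

lemma W.ex2 (y : Abelian.Ext A M i) : ∃ x, W i x y := by
  obtain ⟨f, hf, h⟩ := (projectiveResolution A).extMk_surjective y (i+1) rfl
  obtain ⟨x, hx⟩ := OldRel.ex _ _ f hf
  exact ⟨x, _, f, hf, hx, h⟩

lemma W.zero {x : OE (i+1) A M} {y} (h : W (i+1) x y) : x = 0 ↔ y = 0 := by
  obtain ⟨P, f, hf, h1, rfl⟩ := h
  rw [P.extMk_eq_zero_iff f _ rfl hf i rfl, OldRel.zero P i f x h1]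

lemma W.smul {x : OE i A M} {y} (h : W i x y) (s : R) : W i (s • x) (s • y) := by
  obtain ⟨P, f, hf, h1, rfl⟩ := h
  refine ⟨P, s • f, by simp [hf], OldRel.smul _ _ _ _ h1 s, ?_⟩
  rw [Abelian.Ext.smul_eq_comp_mk₀, P.extMk_comp_mk₀]
  congr 1
  try simp

lemma W.nat {x : OE i A M} {y} (h : W i x y) {A' : ModuleCat.{u} R} (g : A' ⟶ A) :
    W i ((((Ext R (ModuleCat.{u} R) i).map g.op).app M) x)
      ((Abelian.Ext.mk₀ g).comp y (zero_add _)) := by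
  obtain ⟨P, f, hf, h1, rfl⟩ := h
  let P' := projectiveResolution A'
  let φ : ProjectiveResolution.Hom P' P g := 
    { hom := ProjectiveResolution.lift g P' P
      hom_f_zero_comp_π_f_zero := by
        rw [← HomologicalComplex.comp_f, ← HomologicalComplex.comp_f, ProjectiveResolution.lift_commutes] }
  refine ⟨P', φ.hom.f i ≫ f, ?_, OldRel.nat _ _ _ _ h1 _ _ φ, ?_⟩
  · rw [← φ.hom.comm_assoc, hf, comp_zero]
  · rw [ProjectiveResolution.mk₀_comp_extMk _ _ _ _ φ]
end oldExt
end S18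

namespace S18
open Opposite Limits
section V
variable {R : Type u} [CommRing R]

abbrev Q (I : Ideal R) (n : ℕ) : ModuleCat.{u} R := ModuleCat.of R (R ⧸ I ^ n)

def pr (I : Ideal R) {n m : ℕ} (h : n ≤ m) : Q I m ⟶ Q I n :=
  ModuleCat.ofHom (Submodule.mapQ _ _ LinearMap.id (Ideal.pow_le_pow_right h))

lemma pr_apply (I : Ideal R) {n m : ℕ} (h : n ≤ m) (r : R) :
    pr I h (Ideal.Quotient.mk _ r) = Ideal.Quotient.mk _ r := rfl

lemma pr_comp (I : Ideal R) {n m k : ℕ} (h : n ≤ m) (h' : m ≤ k) :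
    pr I h' ≫ pr I h = pr I (h.trans h') := by
  ext
  rfl

def res (I : Ideal R) {n m : ℕ} (h : n ≤ m) {M : ModuleCat.{u} R} {i : ℕ}
    (x : Abelian.Ext (Q I n) M i) : Abelian.Ext (Q I m) M i :=
  (Abelian.Ext.mk₀ (pr I h)).comp x (zero_add _)

lemma res_res (I : Ideal R) {n m k : ℕ} (h : n ≤ m) (h' : m ≤ k) {M : ModuleCat.{u} R} {i : ℕ}
    (x : Abelian.Ext (Q I n) M i) : res I h' (res I h x) = res I (h.trans h') x := by
  unfold res
  rw [← pr_comp I h h', ← Abelian.Ext.mk₀_comp_mk₀_assoc]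

lemma res_zero (I : Ideal R) {n m : ℕ} (h : n ≤ m) {M : ModuleCat.{u} R} {i : ℕ} :
    res I h (0 : Abelian.Ext (Q I n) M i) = 0 := by
  simp [res]

lemma res_smul (I : Ideal R) {n m : ℕ} (h : n ≤ m) {M : ModuleCat.{u} R} {i : ℕ} (s : R)
    (x : Abelian.Ext (Q I n) M i) : res I h (s • x) = s • res I h x := by
  simp [res]

lemma res_comp (I : Ideal R) {n m : ℕ} (h : n ≤ m) {M N : ModuleCat.{u} R} {i j k : ℕ}
    (x : Abelian.Ext (Q I n) M i) (y : Abelian.Ext M N j) (hk : i + j = k) :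
    res I h (x.comp y hk) = (res I h x).comp y hk := by
  unfold res
  rw [Abelian.Ext.comp_assoc]
  omega

def V (I : Ideal R) (S : Submonoid R) (i : ℕ) (M : ModuleCat.{u} R) : Prop :=
  ∀ n (x : Abelian.Ext (Q I n) M i), ∃ m, ∃ h : n ≤ m, ∃ s ∈ S, s • res I h x = 0

lemma V_iff_LC (I : Ideal R) (S : Submonoid R) (i : ℕ) (M : ModuleCat.{u} R) :
    V I S (i+1) M ↔ ∀ x : LC R I (i+1) M, ∃ s ∈ S, s • x = 0 := by
  let D := localCohomology.diagram (localCohomology.idealPowersDiagram I) (i+1)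
  let D' : (ℕᵒᵖ)ᵒᵖ ⥤ ModuleCat.{u} R := D ⋙ (evaluation _ _).obj M
  let c : Cocone D' := ((evaluation _ _).obj M).mapCocone (colimit.cocone D)
  have hc : IsColimit c := isColimitOfPreserves ((evaluation _ _).obj M) (colimit.isColimit D)
  have hmap : ∀ {n m : ℕ} (h : n ≤ m) (x : OE (i+1) (Q I n) M) (y) (hW : W (i+1) x y),
    W (i+1) (D'.map (homOfLE h).op.op x) (res I h y) := by
    intro n m h x y hW
    exact hW.nat (i+1) (pr I h)
  have hfp : PreservesColimit D' (forget (ModuleCat.{u} R)) := by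
    have : PreservesFilteredColimitsOfSize.{0,0} (forget (ModuleCat.{u} R)) :=
      preservesFilteredColimitsOfSize_shrink.{0,u,0,u} _
    infer_instance
  have hzero : ∀ (n : ℕ) (x : D'.obj (op (op n))), c.ι.app _ x = 0 ↔
    ∃ m, ∃ h : n ≤ m, D'.map (homOfLE h).op.op x = 0 := by
    intro n x
    constructor
    · intro h
      rw [← map_zero (c.ι.app (op (op n))).hom] at h
      obtain ⟨k, f, g, hk⟩ := Concrete.isColimit_exists_of_rep_eq D' hc _ _ h
      refine ⟨k.unop.unop, leOfHom f.unop.unop, ?_⟩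
      refine Eq.trans hk (map_zero _)
    · rintro ⟨m, h, hx⟩
      have := c.w (homOfLE h).op.op
      rw [← this, ModuleCat.comp_apply, hx, map_zero]
  constructor
  · intro hV x
    obtain ⟨⟨⟨n⟩⟩, x, rfl⟩ := Concrete.isColimit_exists_rep D' hc x
    obtain ⟨y, hy⟩ := W.ex1 (A := Q I n) (i+1) x
    obtain ⟨m, h, s, hs, hm⟩ := hV n y
    refine ⟨s, hs, ?_⟩
    have h1 : c.ι.app (op (op n)) (s • x) = 0 := by
      refine (hzero n (s • x)).2 ⟨m, h, ?_⟩
      refine ((hmap h (s • x) (s • y) (hy.smul _ s)).zero).2 ?_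
      exact (res_smul _ _ _ _).trans hm
    rw [map_smul] at h1
    exact h1
  · intro hL n y
    obtain ⟨x, hx⟩ := W.ex2 (i+1) y
    obtain ⟨s, hs, h⟩ := hL (c.ι.app (op (op n)) x)
    have h1 : c.ι.app (op (op n)) (s • x : OE (i+1) (Q I n) M) = 0 := (map_smul (c.ι.app (op (op n))).hom s x).trans h
    obtain ⟨m, hm, h2⟩ := (hzero n _).1 h1
    refine ⟨m, hm, s, hs, ?_⟩
    rw [← res_smul]
    exact ((hmap hm _ _ (hx.smul _ s)).zero).1 h2
end V
end S18

namespace S18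
open Opposite Limits
section V
variable {R : Type u} [CommRing R]

lemma V.X₃ {I : Ideal R} {S : Submonoid R} {i : ℕ} {T : ShortComplex (ModuleCat.{u} R)}
    (hT : T.ShortExact) (h2 : V I S i T.X₂) (h1 : V I S (i+1) T.X₁) : V I S i T.X₃ := by
  intro n x
  obtain ⟨m, h, s, hs, e⟩ := h1 n (x.comp hT.extClass rfl)
  rw [res_comp, ← Abelian.Ext.smul_comp] at e
  obtain ⟨y, hy⟩ := Abelian.Ext.covariant_sequence_exact₃ _ hT _ rfl e
  obtain ⟨m', h', s', hs', e'⟩ := h2 m y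
  refine ⟨m', h.trans h', s' * s, S.mul_mem hs' hs, ?_⟩
  rw [mul_smul, ← res_res I h h', ← res_smul, ← hy, res_comp, ← Abelian.Ext.smul_comp, e']
  simp

lemma V.X₂ {I : Ideal R} {S : Submonoid R} {i : ℕ} {T : ShortComplex (ModuleCat.{u} R)}
    (hT : T.ShortExact) (h1 : V I S i T.X₁) (h3 : V I S i T.X₃) : V I S i T.X₂ := by
  intro n x
  obtain ⟨m, h, s, hs, e⟩ := h3 n (x.comp (Abelian.Ext.mk₀ T.g) (add_zero _))
  rw [res_comp, ← Abelian.Ext.smul_comp] at e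
  obtain ⟨y, hy⟩ := Abelian.Ext.covariant_sequence_exact₂ _ hT _ e
  obtain ⟨m', h', s', hs', e'⟩ := h1 m y
  refine ⟨m', h.trans h', s' * s, S.mul_mem hs' hs, ?_⟩
  rw [mul_smul, ← res_res I h h', ← res_smul, ← hy, res_comp, ← Abelian.Ext.smul_comp, e']
  simp

lemma V.of_iso {I : Ideal R} {S : Submonoid R} {i : ℕ} {M N : ModuleCat.{u} R} (e : M ≅ N)
    (h : V I S i M) : V I S i N := by
  intro n x
  obtain ⟨m, h, s, hs, e'⟩ := h n (x.comp (Abelian.Ext.mk₀ e.inv) (add_zero _))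
  refine ⟨m, h, s, hs, ?_⟩
  rw [res_comp, ← Abelian.Ext.smul_comp] at e'
  have := congrArg (fun t => t.comp (Abelian.Ext.mk₀ e.hom) (add_zero _)) e'
  simpa using this

lemma V.mono {I : Ideal R} {S S' : Submonoid R} (hS : S ≤ S') {i : ℕ} {M : ModuleCat.{u} R}
    (h : V I S i M) : V I S' i M := by
  intro n x
  obtain ⟨m, h, s, hs, e'⟩ := h n x
  exact ⟨m, h, s, hS hs, e'⟩

lemma V.inj {I : Ideal R} {S : Submonoid R} {i : ℕ} {M : ModuleCat.{u} R} [Injective M] :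
    V I S (i+1) M := by
  intro n x
  exact ⟨n, le_rfl, 1, S.one_mem, by rw [Abelian.Ext.eq_zero_of_injective x, res_zero, smul_zero]⟩

lemma shortExact_of {A B C : Type u} [AddCommGroup A] [AddCommGroup B] [AddCommGroup C]
    [Module R A] [Module R B] [Module R C] (f : A →ₗ[R] B) (g : B →ₗ[R] C)
    (hf : Function.Injective f) (hg : Function.Surjective g) (h : Function.Exact f g) :
    (ShortComplex.mk (ModuleCat.ofHom f) (ModuleCat.ofHom g)
      (by ext x; exact h.apply_apply_eq_zero x)).ShortExact where
  exact := (ShortComplex.ShortExact.moduleCat_exact_iff_function_exact _).mpr h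
  mono_f := (ModuleCat.mono_iff_injective _).mpr hf
  epi_g := (ModuleCat.epi_iff_surjective _).mpr hg

variable [IsNoetherianRing R]

lemma V_fg {I : Ideal R} {S : Submonoid R} (N : ℕ)
    (hN : ∀ i ≥ N, ∀ M : ModuleCat.{u} R, V I S i M) (i₀ : ℕ)
    (hR : ∀ i ≥ i₀, V I S i (ModuleCat.of R R)) :
    ∀ k : ℕ, ∀ i ≥ i₀, N ≤ i + k → ∀ (M : Type u) [AddCommGroup M] [Module R M]
      [Module.Finite R M], V I S i (ModuleCat.of R M) := by
  intro k
  induction k with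
  | zero => intro i _ h M _ _ _; exact hN i h _
  | succ k ih =>
    intro i hi h M _ _ hM
    induction hM using IsNoetherianRing.induction_on_isQuotientEquivQuotientPrime R with
    | subsingleton N =>
      have : IsZero (ModuleCat.of R N) := ModuleCat.isZero_of_subsingleton _
      intro n x
      refine ⟨n, le_rfl, 1, S.one_mem, ?_⟩
      have h0 : x = x.comp (Abelian.Ext.mk₀ (𝟙 _)) (add_zero _) := by simp
      rw [this.eq_of_src (𝟙 _) 0] at h0
      rw [h0]; simp [res]
    | quotient N p e =>
      have h1 := shortExact_of (p.1.subtype) (Submodule.mkQ p.1) (Submodule.subtype_injective _)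
        (Submodule.mkQ_surjective _) (LinearMap.exact_subtype_mkQ _)
      exact V.of_iso e.symm.toModuleIso (V.X₃ h1 (hR i hi) (ih (i+1) (by omega) (by omega) p.1))
    | exact N₁ N₂ N₃ f g hf hg hfg h1 h3 =>
      exact V.X₂ (shortExact_of f g hf hg hfg) h1 h3

lemma Ext_fg (i : ℕ) : ∀ (A : ModuleCat.{u} R) [Module.Finite R A] (M : ModuleCat.{u} R)
    (x : Abelian.Ext A M i), ∃ M' : Submodule R M, M'.FG ∧
      ∃ x' : Abelian.Ext A (ModuleCat.of R M') i,
        x'.comp (Abelian.Ext.mk₀ (ModuleCat.ofHom M'.subtype)) (add_zero _) = x := by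
  induction i with
  | zero =>
    intro A _ M x
    obtain ⟨f, rfl⟩ := Abelian.Ext.addEquiv₀.symm.surjective x
    refine ⟨LinearMap.range f.hom, Module.Finite.iff_fg.1 inferInstance,
      Abelian.Ext.mk₀ (ModuleCat.ofHom f.hom.rangeRestrict), ?_⟩
    rw [Abelian.Ext.mk₀_comp_mk₀]
    rfl
  | succ n ih =>
    intro A _ M x
    obtain ⟨N, _, _, _, _, f, surjf⟩ := Module.exists_finite_presentation R A
    let exac := LinearMap.shortExact_shortComplexKer surjf
    obtain ⟨y, hy⟩ := precomp_extClass_surjective_of_projective_X₂ M exac n x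
    obtain ⟨M', hM', y', rfl⟩ := ih _ _ y
    refine ⟨M', hM', exac.extClass.comp y' (add_comm 1 n), ?_⟩
    rw [← hy]
    rw [Abelian.Ext.comp_assoc _ _ _ _ (add_zero n) (by omega)]
    rfl

lemma V_all {I : Ideal R} {S : Submonoid R} (N : ℕ)
    (hN : ∀ i ≥ N, ∀ M : ModuleCat.{u} R, V I S i M) (i₀ : ℕ)
    (hR : ∀ i ≥ i₀, V I S i (ModuleCat.of R R)) (i : ℕ) (hi : i₀ ≤ i) (M : ModuleCat.{u} R) :
    V I S i M := by
  intro n x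
  obtain ⟨M', hM', x', rfl⟩ := Ext_fg i _ M x
  have : Module.Finite R M' := Module.Finite.iff_fg.2 hM'
  obtain ⟨m, h, s, hs, e⟩ := V_fg N hN i₀ hR N i hi (by omega) M' n x'
  refine ⟨m, h, s, hs, ?_⟩
  rw [res_comp, ← Abelian.Ext.smul_comp, e]
  simp
end V
end S18

namespace S18
open Opposite Limits
section B
variable {R : Type u} [CommRing R]

def G (I : Ideal R) {E : Type u} [AddCommGroup E] [Module R E] (e : E) : Prop :=
  ∃ n, ∀ r ∈ I ^ n, r • e = 0

structure IR (M : ModuleCat.{u} R) where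
  E : ℕ → ModuleCat.{u} R
  inj : ∀ j, Module.Injective R (E j)
  d : ∀ j, E j →ₗ[R] E (j+1)
  dd : ∀ j x, d (j+1) (d j x) = 0
  ex : ∀ j e, d (j+1) e = 0 → ∃ a, d j a = e
  br : ∀ (I : Ideal R) (S : Submonoid R) i, V I S (i+1) M ↔
    ∀ e : E (i+1), d (i+1) e = 0 → G I e → ∃ s ∈ S, ∃ e' : E i, G I e' ∧ d i e' = s • e

def toHom (I : Ideal R) (n : ℕ) (E : ModuleCat.{u} R) (e : E) (h : ∀ r ∈ I ^ n, r • e = 0) :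
    Q I n ⟶ E :=
  ModuleCat.ofHom (Submodule.liftQ _ (LinearMap.toSpanSingleton R E e) (fun r hr => by
    rw [LinearMap.mem_ker, LinearMap.toSpanSingleton_apply]; exact h r hr))

lemma toHom_one (I : Ideal R) (n : ℕ) (E : ModuleCat.{u} R) (e : E) (h) :
    toHom I n E e h (Ideal.Quotient.mk _ 1) = e := by
  change (LinearMap.toSpanSingleton R E e) 1 = e
  simp

lemma hom_ext_one {I : Ideal R} {n : ℕ} {E : ModuleCat.{u} R} {f g : Q I n ⟶ E}
    (h : f (Ideal.Quotient.mk _ 1) = g (Ideal.Quotient.mk _ 1)) : f = g := by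
  apply ModuleCat.hom_ext
  apply LinearMap.ext
  intro x
  obtain ⟨r, rfl⟩ := Ideal.Quotient.mk_surjective x
  have : (Ideal.Quotient.mk (I^n) r) = r • (Ideal.Quotient.mk (I^n) 1) := by
    rw [← Ideal.Quotient.mkₐ_eq_mk R, ← map_smul]; simp
  rw [this, map_smul, map_smul]
  exact congrArg _ h

lemma hom_kill {I : Ideal R} {n : ℕ} {E : ModuleCat.{u} R} (f : Q I n ⟶ E) :
    ∀ r ∈ I ^ n, r • f (Ideal.Quotient.mk _ 1) = 0 := by
  intro r hr
  have : r • (Ideal.Quotient.mk (I^n) 1) = 0 := by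
    rw [← Ideal.Quotient.mkₐ_eq_mk R, ← map_smul]
    simpa using Ideal.Quotient.eq_zero_iff_mem.2 hr
  have h2 := map_smul f.hom r (Ideal.Quotient.mk _ 1)
  rw [this, map_zero] at h2
  exact h2.symm

lemma G.mono {I : Ideal R} {E : Type u} [AddCommGroup E] [Module R E] {e : E} {n m : ℕ}
    (h : n ≤ m) (h1 : ∀ r ∈ I ^ n, r • e = 0) : ∀ r ∈ I ^ m, r • e = 0 :=
  fun r hr => h1 r (Ideal.pow_le_pow_right h hr)

lemma smul_extMk {A M : ModuleCat.{u} R} (P : InjectiveResolution M) {n : ℕ}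
    (f : A ⟶ P.cocomplex.X n) (m : ℕ) (hm : n + 1 = m) (hf : f ≫ P.cocomplex.d n m = 0) (s : R) :
    s • P.extMk f m hm hf = P.extMk (s • f) m hm (by simp [hf]) := by
  have h1 : s • P.extMk f m hm hf =
      (Abelian.Ext.mk₀ (s • 𝟙 A)).comp (P.extMk f m hm hf) (zero_add _) := by
    rw [Abelian.Ext.mk₀_smul, Abelian.Ext.smul_comp]; simp
  rw [h1, InjectiveResolution.mk₀_comp_extMk]
  simp

lemma IR_exists (M : ModuleCat.{u} R) : Nonempty (IR M) := by
  let P : InjectiveResolution M := injectiveResolution M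
  refine ⟨⟨P.cocomplex.X, fun j => ?_, fun j => (P.cocomplex.d j (j+1)).hom, ?_, ?_, ?_⟩⟩
  · exact (Module.injective_iff_injective_object R _).2 (P.injective j)
  · intro j x
    have := P.cocomplex.d_comp_d j (j+1) (j+1+1)
    exact congrArg (fun f => f.hom x) this
  · intro j e he
    have := P.cocomplex_exactAt_succ j
    rw [HomologicalComplex.exactAt_iff' _ j (j+1) (j+1+1) (by simp) (by simp)] at this
    rw [ShortComplex.moduleCat_exact_iff] at this
    exact this e he
  · intro I S i
    constructor
    · rintro hV e he ⟨n, hn⟩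
      have hz : toHom I n _ e hn ≫ P.cocomplex.d (i+1) (i+1+1) = 0 := by
        apply hom_ext_one
        rw [ModuleCat.comp_apply, toHom_one]
        exact he
      obtain ⟨m, h, s, hs, e'⟩ := hV n (P.extMk (toHom I n _ e hn) (i+1+1) rfl hz)
      rw [res, InjectiveResolution.mk₀_comp_extMk, smul_extMk,
        P.extMk_eq_zero_iff _ _ _ _ i rfl] at e'
      obtain ⟨g, hg⟩ := e'
      refine ⟨s, hs, g (Ideal.Quotient.mk _ 1), ⟨m, hom_kill g⟩, ?_⟩
      have := congrArg (fun f => f.hom (Ideal.Quotient.mk _ 1)) hg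
      refine this.trans ?_
      change s • (toHom I n _ e hn) (pr I h (Ideal.Quotient.mk _ 1)) = _
      rw [pr_apply, toHom_one]
    · intro H n x
      obtain ⟨f, hf, rfl⟩ := P.extMk_surjective x (i+1+1) rfl
      obtain ⟨s, hs, e', ⟨m, hm⟩, h2⟩ := H (f (Ideal.Quotient.mk _ 1))
        (congrArg (fun f => f.hom (Ideal.Quotient.mk _ 1)) hf) ⟨n, hom_kill f⟩
      refine ⟨max n m, le_max_left _ _, s, hs, ?_⟩
      rw [res, InjectiveResolution.mk₀_comp_extMk, smul_extMk,
        P.extMk_eq_zero_iff _ _ _ _ i rfl]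
      refine ⟨toHom I _ _ e' (G.mono (le_max_right n m) hm), ?_⟩
      apply hom_ext_one
      rw [ModuleCat.comp_apply, toHom_one]
      refine h2.trans ?_
      change _ = s • f (pr I _ (Ideal.Quotient.mk _ 1))
      rw [pr_apply]
end B

section L
variable {R : Type u} [CommRing R] {E : Type u} [AddCommGroup E] [Module R E]

lemma G.add {I : Ideal R} {a b : E} (ha : G I a) (hb : G I b) : G I (a + b) := by
  obtain ⟨n, hn⟩ := ha
  obtain ⟨m, hm⟩ := hb
  refine ⟨max n m, fun r hr => ?_⟩
  rw [smul_add, G.mono (le_max_left n m) hn r hr, G.mono (le_max_right n m) hm r hr, add_zero]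

lemma G.smul {I : Ideal R} {a : E} (s : R) (ha : G I a) : G I (s • a) := by
  obtain ⟨n, hn⟩ := ha
  refine ⟨n, fun r hr => ?_⟩
  rw [smul_comm, hn r hr, smul_zero]

lemma G.zero {I : Ideal R} : G I (0 : E) := ⟨0, by simp⟩

lemma G.neg {I : Ideal R} {a : E} (ha : G I a) : G I (-a) := by
  simpa using ha.smul (-1 : R)

lemma G.sub {I : Ideal R} {a b : E} (ha : G I a) (hb : G I b) : G I (a - b) := by
  rw [sub_eq_add_neg]; exact ha.add hb.neg

lemma G.map {I : Ideal R} {a : E} {F : Type u} [AddCommGroup F] [Module R F] (f : E →ₗ[R] F)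
    (ha : G I a) : G I (f a) := by
  obtain ⟨n, hn⟩ := ha
  exact ⟨n, fun r hr => by rw [← map_smul, hn r hr, map_zero]⟩

lemma G.anti {I J : Ideal R} (h : I ≤ J) {a : E} (ha : G J a) : G I a := by
  obtain ⟨n, hn⟩ := ha
  exact ⟨n, fun r hr => hn r (Ideal.pow_right_mono h n hr)⟩

def Gam (I : Ideal R) (E : Type u) [AddCommGroup E] [Module R E] : Submodule R E where
  carrier := {e | G I e}
  add_mem' := G.add
  zero_mem' := G.zero
  smul_mem' := fun s _ h => G.smul s h

lemma mem_Gam {I : Ideal R} {e : E} : e ∈ Gam I E ↔ G I e := Iff.rfl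

lemma G.sup {I J : Ideal R} {a : E} (ha : G I a) (hb : G J a) : G (I ⊔ J) a := by
  obtain ⟨n, hn⟩ := ha
  obtain ⟨m, hm⟩ := hb
  refine ⟨n + m, fun r hr => ?_⟩
  have h := Ideal.sup_pow_add_le_pow_sup_pow (I := I) (J := J) (n := n) (m := m) hr
  obtain ⟨x, hx, y, hy, rfl⟩ := Submodule.mem_sup.1 h
  rw [add_smul, hn x hx, hm y hy, add_zero]

lemma G_of_fg [IsNoetherianRing R] {I : Ideal R} {N : Submodule R E} {a : E}
    (h : ∀ x ∈ I, ∃ n : ℕ, x ^ n • a ∈ N) : ∃ n, ∀ r ∈ I ^ n, r • a ∈ N := by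
  let A : Ideal R := Submodule.comap (LinearMap.toSpanSingleton R E a) N
  have h1 : I ≤ A.radical := fun x hx => by
    obtain ⟨n, hn⟩ := h x hx
    exact ⟨n, by simpa [A] using hn⟩
  obtain ⟨n, hn⟩ := Ideal.exists_pow_le_of_le_radical_of_fg h1 (IsNoetherian.noetherian I)
  exact ⟨n, fun r hr => by simpa [A] using hn hr⟩

lemma G_inf_of_mul {I J : Ideal R} {a : E} (h : G (I * J) a) : G (I ⊓ J) a := by
  obtain ⟨n, hn⟩ := h
  refine ⟨n * 2, fun r hr => hn r ?_⟩
  have : (I ⊓ J)^2 ≤ I * J := by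
    rw [pow_two]; exact Ideal.mul_mono inf_le_left inf_le_right
  rw [mul_comm, pow_mul] at hr
  exact Ideal.pow_right_mono this n hr

lemma ext_inj [Module.Injective R E] {X Y : Type u} [AddCommGroup X] [Module R X]
    [AddCommGroup Y] [Module R Y] (f : X →ₗ[R] Y) (hf : Function.Injective f) (g : X →ₗ[R] E) :
    ∃ h : Y →ₗ[R] E, ∀ x, h (f x) = g x := Module.Injective.out f hf g

lemma divis [IsDomain R] [Module.Injective R E] {x : R} (hx : x ≠ 0) (e : E) : ∃ e', x • e' = e := by
  let f : R →ₗ[R] R := LinearMap.toSpanSingleton R R x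
  have hf : Function.Injective f := by
    intro a b h
    have h' : a * x = b * x := by simpa [f] using h
    exact mul_right_cancel₀ hx h'
  obtain ⟨h, hh⟩ := ext_inj f hf (LinearMap.toSpanSingleton R E e)
  refine ⟨h 1, ?_⟩
  have := hh 1
  rw [← map_smul]
  simpa [f] using this
variable [IsNoetherianRing R]

lemma exists_inf_le (A B : Ideal R) (n : ℕ) : ∃ m, A ^ m ⊓ B ≤ A ^ n * B := by
  obtain ⟨k, hk⟩ := Ideal.exists_pow_inf_eq_pow_smul (R := R) (M := R) A B
  refine ⟨n + k, ?_⟩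
  have := hk (n + k) (by omega)
  simp only [smul_eq_mul, Ideal.mul_top, add_tsub_cancel_right] at this
  rw [this]
  exact Ideal.mul_mono_right inf_le_right

lemma MV [Module.Injective R E] {I J : Ideal R} {e : E} (he : G (I ⊓ J) e) :
    ∃ a b : E, G I a ∧ G J b ∧ e = a + b := by
  obtain ⟨n, hn⟩ := he
  obtain ⟨m, hm⟩ := exists_inf_le I (J ^ n) n
  have h1 : ∀ r ∈ I ^ m ⊓ J ^ n, r • e = 0 := fun r hr => by
    refine hn r ?_
    have := hm hr
    rw [← mul_pow] at this
    exact Ideal.pow_right_mono Ideal.mul_le_inf n this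
  let f : (R ⧸ (I ^ m ⊓ J ^ n)) →ₗ[R] (R ⧸ I ^ m) × (R ⧸ J ^ n) :=
    Submodule.liftQ _ ((Submodule.mkQ (I^m)).prod (Submodule.mkQ (J^n))) (by
      rintro x ⟨hx, hy⟩
      refine Prod.ext ?_ ?_
      exacts [(Submodule.Quotient.mk_eq_zero _).2 hx, (Submodule.Quotient.mk_eq_zero _).2 hy])
  have hf : Function.Injective f := by
    rw [← LinearMap.ker_eq_bot, Submodule.ker_liftQ_eq_bot]
    rintro x hx
    have h1 := congrArg Prod.fst hx
    have h2 := congrArg Prod.snd hx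
    exact ⟨(Submodule.Quotient.mk_eq_zero _).1 h1, (Submodule.Quotient.mk_eq_zero _).1 h2⟩
  let g : (R ⧸ (I ^ m ⊓ J ^ n)) →ₗ[R] E :=
    Submodule.liftQ _ (LinearMap.toSpanSingleton R E e) (fun r hr => by simpa using h1 r hr)
  obtain ⟨h, hh⟩ := ext_inj f hf g
  refine ⟨h (Submodule.Quotient.mk 1, 0), h (0, Submodule.Quotient.mk 1), ⟨m, fun r hr => ?_⟩,
    ⟨n, fun r hr => ?_⟩, ?_⟩
  · rw [← map_smul, Prod.smul_mk, smul_zero, ← Submodule.Quotient.mk_smul,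
      (Submodule.Quotient.mk_eq_zero _).2 (by simpa using hr)]
    exact map_zero h
  · rw [← map_smul, Prod.smul_mk, smul_zero, ← Submodule.Quotient.mk_smul,
      (Submodule.Quotient.mk_eq_zero _).2 (by simpa using hr)]
    exact map_zero h
  · have := hh (Submodule.Quotient.mk 1)
    have h3 : g (Submodule.Quotient.mk 1) = e := by
      change (LinearMap.toSpanSingleton R E e) 1 = e
      simp
    rw [← map_add, ← h3, ← this]
    congr 1
    exact Prod.ext (add_zero _).symm (zero_add _).symm

lemma Gam_inj [Module.Injective R E] (K : Ideal R) : Module.Injective R (Gam K E) := by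
  apply Module.Baer.injective
  intro A g
  -- a power of K kills the image
  obtain ⟨n, hn⟩ : ∃ n, ∀ r ∈ K ^ n, ∀ x, r • g x = 0 := by
    have hfg : (⊤ : Submodule R A).FG := IsNoetherian.noetherian _
    obtain ⟨s, hs⟩ := hfg
    have : ∀ t : Finset A, ∃ n, ∀ r ∈ K ^ n, ∀ x ∈ t, r • g x = 0 := by
      intro t
      classical
      induction t using Finset.induction_on with
      | empty => exact ⟨0, by simp⟩
      | insert a t _ ih =>
        obtain ⟨n, hn⟩ := ih
        obtain ⟨m, hm⟩ := (g a).2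
        refine ⟨max n m, fun r hr x hx => ?_⟩
        rcases Finset.mem_insert.1 hx with rfl | hx
        · exact Subtype.ext (hm r (Ideal.pow_le_pow_right (le_max_right _ _) hr))
        · exact hn r (Ideal.pow_le_pow_right (le_max_left _ _) hr) x hx
    obtain ⟨n, hn⟩ := this s
    refine ⟨n, fun r hr x => ?_⟩
    have hx : x ∈ Submodule.span R (s : Set A) := by rw [hs]; trivial
    induction hx using Submodule.span_induction with
    | mem x h => exact hn r hr x h
    | zero => simp
    | add x y _ _ h1 h2 => rw [map_add, smul_add, h1, h2, add_zero]
    | smul c x _ h => rw [map_smul, smul_comm, h, smul_zero]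
  obtain ⟨m, hm⟩ := exists_inf_le K A n
  have hk : ∀ x : A, (x : R) ∈ K ^ m → g x = 0 := by
    intro x hx
    have h1 : (x : R) ∈ K ^ n * A := hm ⟨hx, x.2⟩
    have key : ∀ y ∈ K ^ n * A, ∀ hy : y ∈ A, g ⟨y, hy⟩ = 0 := by
      intro y hy
      induction hy using Submodule.mul_induction_on' with
      | mem_mul_mem r hr a ha =>
        intro _
        have : g (r • ⟨a, ha⟩) = 0 := by rw [map_smul]; exact hn r hr _
        exact this
      | add x hx y hy h1 h2 =>
        intro h
        have hxA := Ideal.mul_le_right hx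
        have hyA := Ideal.mul_le_right hy
        have : g (⟨x, hxA⟩ + ⟨y, hyA⟩) = 0 := by rw [map_add, h1, h2, add_zero]
        exact this
    exact key x h1 x.2
  let p : A →ₗ[R] R ⧸ (K ^ m) := (Submodule.mkQ _).comp A.subtype
  have hp : LinearMap.ker p ≤ LinearMap.ker g := fun x hx =>
    hk x ((Submodule.Quotient.mk_eq_zero _).1 hx)
  let f := (LinearMap.ker p).liftQ p le_rfl
  have hf : Function.Injective f := by
    rw [← LinearMap.ker_eq_bot, Submodule.ker_liftQ_eq_bot]; exact le_rfl
  obtain ⟨h, hh⟩ := ext_inj f hf ((Gam K E).subtype.comp ((LinearMap.ker p).liftQ g hp))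
  have hG : ∀ x, h x ∈ Gam K E := by
    intro x
    refine ⟨m, fun r hr => ?_⟩
    obtain ⟨y, rfl⟩ := Submodule.Quotient.mk_surjective _ x
    rw [← map_smul, ← Submodule.Quotient.mk_smul,
      (Submodule.Quotient.mk_eq_zero (K^m)).2 (show r • y ∈ K ^ m from Ideal.mul_mem_right y _ hr), map_zero]
  refine ⟨(h.codRestrict _ hG).comp (Submodule.mkQ _), fun x hx => ?_⟩
  apply Subtype.ext
  exact hh (Submodule.Quotient.mk ⟨x, hx⟩)

end L
end S18

namespace S18
open Opposite Limits
section A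
variable {R : Type u} [CommRing R]

lemma IR.br1 {M : ModuleCat.{u} R} (P : IR M) (I : Ideal R) (i : ℕ) : V I ⊥ (i+1) M ↔
    ∀ e : P.E (i+1), P.d (i+1) e = 0 → G I e → ∃ e' : P.E i, G I e' ∧ P.d i e' = e := by
  rw [P.br]
  refine forall_congr' fun e => forall_congr' fun _ => forall_congr' fun _ => ?_
  constructor
  · rintro ⟨s, hs, e', h1, h2⟩
    rw [Submonoid.mem_bot.1 hs, one_smul] at h2
    exact ⟨e', h1, h2⟩
  · rintro ⟨e', h1, h2⟩
    exact ⟨1, Submonoid.one_mem _, e', h1, by rw [one_smul, h2]⟩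

lemma G_span {E : Type u} [AddCommGroup E] [Module R E] (x : R) (e : E) :
    G (Ideal.span {x}) e ↔ ∃ n : ℕ, x ^ n • e = 0 := by
  refine exists_congr fun n => ?_
  rw [Ideal.span_singleton_pow]
  constructor
  · intro h; exact h _ (Ideal.mem_span_singleton_self _)
  · intro h r hr
    obtain ⟨c, rfl⟩ := Ideal.mem_span_singleton'.1 hr
    rw [mul_smul, h, smul_zero]

lemma van_x [IsDomain R] (x : R) (i : ℕ) (M : ModuleCat.{u} R) :
    V (Ideal.span {x}) ⊥ (i+2) M := by
  obtain ⟨P⟩ := IR_exists M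
  have := P.inj
  rw [P.br1]
  intro e he hG
  obtain ⟨a, rfl⟩ := P.ex _ e he
  rw [G_span] at hG
  obtain ⟨n, hn⟩ := hG
  by_cases hx : x = 0
  · subst hx
    exact ⟨a, (G_span _ _).2 ⟨1, by simp⟩, rfl⟩
  rw [← map_smul] at hn
  obtain ⟨b, hb⟩ := P.ex _ _ hn
  obtain ⟨b', rfl⟩ := divis (pow_ne_zero n hx) b
  refine ⟨a - P.d i b', (G_span _ _).2 ⟨n, ?_⟩, ?_⟩
  · rw [smul_sub, ← hb, map_smul, sub_self]
  · rw [map_sub, P.dd, sub_zero]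

lemma aux1 {A : Type u} [AddCommGroup A] {a b x y : A} (h : x + y = a - b) : a - x = b + y := by
  have h3 : a = x + y + b := sub_eq_iff_eq_add.1 h.symm
  rw [h3]; abel

lemma van_sup [IsNoetherianRing R] {A B : Ideal R} {i : ℕ} {M : ModuleCat.{u} R}
    (hA : V A ⊥ (i+2) M) (hB : V B ⊥ (i+2) M) (hAB : V (A * B) ⊥ (i+1) M) :
    V (A ⊔ B) ⊥ (i+2) M := by
  obtain ⟨P⟩ := IR_exists M
  have := P.inj
  have hA := (P.br1 A (i+1)).1 hA
  have hB := (P.br1 B (i+1)).1 hB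
  have hAB := (P.br1 _ i).1 hAB
  refine (P.br1 _ (i+1)).2 ?_
  intro e he hG
  obtain ⟨a, ha, rfl⟩ := hA e he (hG.anti le_sup_left)
  obtain ⟨b, hb, hab⟩ := hB _ he (hG.anti le_sup_right)
  have h0 : P.d (i+1) (a - b) = 0 := by rw [map_sub, hab, sub_self]
  obtain ⟨c, hc, hc'⟩ := hAB (a - b) h0
    ((ha.anti Ideal.mul_le_left).sub (hb.anti Ideal.mul_le_right))
  obtain ⟨a', b', ha', hb', rfl⟩ := MV (G_inf_of_mul hc)
  refine ⟨a - P.d i a', ?_, by rw [map_sub, P.dd, sub_zero]⟩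
  refine (ha.sub (ha'.map _)).sup ?_
  have : a - P.d i a' = b + P.d i b' := by
    rw [map_add] at hc'
    exact aux1 hc'
  rw [this]
  exact hb.add (hb'.map _)

lemma ofList_mul (x : R) (l : List R) :
    Ideal.span {x} * Ideal.ofList l = Ideal.ofList (l.map (x * ·)) := by
  induction l with
  | nil => simp
  | cons y l ih =>
    rw [List.map_cons, Ideal.ofList_cons, Ideal.ofList_cons, Ideal.mul_sup, ih,
      Ideal.span_singleton_mul_span_singleton]

lemma van_list [IsDomain R] [IsNoetherianRing R] (r : ℕ) : ∀ (l : List R), l.length = r →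
    ∀ (i : ℕ) (M : ModuleCat.{u} R), V (Ideal.ofList l) ⊥ (r+1+i) M := by
  induction r with
  | zero =>
    intro l hl i M
    obtain rfl := List.length_eq_zero_iff.1 hl
    obtain ⟨P⟩ := IR_exists M
    rw [show 0 + 1 + i = i + 1 by omega, P.br1]
    intro e he _
    obtain ⟨a, rfl⟩ := P.ex _ e he
    exact ⟨a, ⟨1, fun r hr => by rw [show r = 0 by simpa using hr, zero_smul]⟩, rfl⟩
  | succ r ih =>
    intro l hl i M
    cases l with
    | nil => simp at hl
    | cons x l =>
      have hl' : l.length = r := by simpa using hl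
      rw [Ideal.ofList_cons, show r + 1 + 1 + i = (r + i) + 2 by omega]
      apply van_sup (van_x _ _ _)
      · have := ih l hl' (i+1) M
        rwa [show r + 1 + (i + 1) = r + i + 2 by omega] at this
      · have := ih (l.map (x * ·)) (by simpa using hl') i M
        rwa [ofList_mul, show r + i + 1 = r + 1 + i by omega]

lemma van [IsDomain R] [IsNoetherianRing R] (I : Ideal R) (S : Submonoid R) :
    ∃ N, ∀ i ≥ N, ∀ M : ModuleCat.{u} R, V I S i M := by
  obtain ⟨s, hs⟩ := IsNoetherian.noetherian I
  refine ⟨s.toList.length + 1, fun i hi M => V.mono bot_le ?_⟩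
  obtain ⟨k, rfl⟩ := Nat.exists_eq_add_of_le hi
  have := van_list _ s.toList rfl k M
  have h2 : Ideal.ofList s.toList = I := by
    rw [← hs, Ideal.ofList]; congr 1; ext; simp
  rwa [h2] at this

lemma nonvan [IsDomain R] [IsNoetherianRing R] (I p : Ideal R) [p.IsPrime] (hI : I ≠ ⊥)
    (hp : I ≤ p) : ∃ i, ¬ V I p.primeCompl (i+1) (ModuleCat.of R R) := by
  by_contra! H
  obtain ⟨N, hN⟩ := van I p.primeCompl
  have h0 : V I p.primeCompl 0 (ModuleCat.of R R) := by
    intro n x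
    refine ⟨n, le_rfl, 1, Submonoid.one_mem _, ?_⟩
    obtain ⟨f, rfl⟩ := Abelian.Ext.addEquiv₀.symm.surjective x
    have hf : f = 0 := by
      apply hom_ext_one
      obtain ⟨r, hr, hr0⟩ := Submodule.exists_mem_ne_zero_of_ne_bot (pow_ne_zero n hI : I ^ n ≠ 0)
      have := hom_kill f r hr
      exact (mul_eq_zero.1 this).resolve_left hr0
    rw [hf, map_zero, res_zero, smul_zero]
  have hall := V_all N hN 0 (fun i _ => by
    cases i with
    | zero => exact h0
    | succ i => exact H i) 0 le_rfl (Q I 1) 1 (Abelian.Ext.mk₀ (𝟙 _))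
  obtain ⟨m, h, s, hs, e⟩ := hall
  rw [res, Abelian.Ext.mk₀_comp_mk₀, ← Abelian.Ext.mk₀_smul, Abelian.Ext.mk₀_eq_zero_iff] at e
  have := congrArg (fun f => f.hom (Ideal.Quotient.mk _ 1)) e
  replace this : (Ideal.Quotient.mk (I ^ 1) (s * 1)) = 0 := this
  rw [Ideal.Quotient.eq_zero_iff_mem, pow_one, mul_one] at this
  exact hs (hp this)
end A
end S18

namespace S18
open Opposite Limits
section C
variable {R : Type u} [CommRing R]

lemma lift1 {J : Ideal R} {T : ShortComplex (ModuleCat.{u} R)} (hT : T.ShortExact)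
    (h1 : V J ⊥ 1 T.X₁) (y : T.X₃) (hy : G J y) : ∃ x : T.X₂, G J x ∧ T.g x = y := by
  obtain ⟨n, hn⟩ := hy
  obtain ⟨m, h, s, hs, e⟩ := h1 n ((Abelian.Ext.mk₀ (toHom J n _ y hn)).comp hT.extClass (zero_add 1))
  rw [Submonoid.mem_bot.1 hs, one_smul, res_comp] at e
  obtain ⟨z, hz⟩ := Abelian.Ext.covariant_sequence_exact₃ _ hT _ rfl e
  obtain ⟨f, rfl⟩ := Abelian.Ext.addEquiv₀.symm.surjective z
  refine ⟨f (Ideal.Quotient.mk _ 1), ⟨m, hom_kill f⟩, ?_⟩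
  change (Abelian.Ext.mk₀ f).comp _ _ = _ at hz
  rw [res, Abelian.Ext.mk₀_comp_mk₀, Abelian.Ext.mk₀_comp_mk₀] at hz
  have h3 := Abelian.Ext.addEquiv₀.symm.injective hz
  have h4 := congrArg (fun f => f.hom (Ideal.Quotient.mk _ 1)) h3
  refine Eq.trans h4 ?_
  change (toHom J n _ y hn) (pr J h (Ideal.Quotient.mk _ 1)) = _
  rw [pr_apply, toHom_one]

lemma pow_kill {J : Ideal R} {E : Type u} [AddCommGroup E] [Module R E] {e : E} (h : G J e)
    {a : R} (ha : a ∈ J) : ∃ n : ℕ, a ^ n • e = 0 := by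
  obtain ⟨n, hn⟩ := h
  exact ⟨n, hn _ (Ideal.pow_mem_pow ha n)⟩

variable [IsNoetherianRing R]

lemma G_of_pow {J : Ideal R} {E : Type u} [AddCommGroup E] [Module R E] {e : E}
    (h : ∀ a ∈ J, ∃ n : ℕ, a ^ n • e = 0) : G J e := by
  obtain ⟨n, hn⟩ := G_of_fg (N := (⊥ : Submodule R E)) h
  exact ⟨n, hn⟩

lemma tf {J : Ideal R} {E : Type u} [AddCommGroup E] [Module R E] (x : E ⧸ Gam J E)
    (hx : G J x) : x = 0 := by
  obtain ⟨e, rfl⟩ := Submodule.Quotient.mk_surjective _ x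
  rw [Submodule.Quotient.mk_eq_zero]
  refine G_of_pow fun a ha => ?_
  obtain ⟨n, hn⟩ := pow_kill hx ha
  rw [← Submodule.Quotient.mk_smul, Submodule.Quotient.mk_eq_zero] at hn
  obtain ⟨m, hm⟩ := pow_kill hn ha
  exact ⟨m + n, by rw [pow_add, mul_smul, hm]⟩

lemma V1_quot {J : Ideal R} (hJ : ∀ M : ModuleCat.{u} R, V J ⊥ 2 M) {F B : Type u}
    [AddCommGroup F] [Module R F] [AddCommGroup B] [Module R B] [hF : Module.Injective R F]
    (g : F →ₗ[R] B) (hg : Function.Surjective g) : V J ⊥ 1 (ModuleCat.of R B) := by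
  have hT := shortExact_of (LinearMap.ker g).subtype g (Submodule.subtype_injective _) hg
    (LinearMap.exact_subtype_ker_map g)
  have : Injective (ModuleCat.of R F) := (Module.injective_iff_injective_object R _).1 hF
  exact V.X₃ hT (V.inj (i := 0)) (hJ _)

lemma dir1 {I J : Ideal R} {i : ℕ} {M : ModuleCat.{u} R} (h : V (I ⊓ J) ⊥ (i+2) M)
    {a : R} (ha : a ∈ J) : V I (Submonoid.powers a) (i+2) M := by
  obtain ⟨P⟩ := IR_exists M
  have := P.inj
  refine (P.br _ _ (i+1)).2 ?_
  have h := (P.br1 _ (i+1)).1 h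
  intro e he hG
  obtain ⟨c, hc, hce⟩ := h e he (hG.anti inf_le_left)
  obtain ⟨b, v, hb, hv, rfl⟩ := MV hc
  have h1 : e - P.d (i+1) b = P.d (i+1) v := by
    rw [map_add] at hce
    exact sub_eq_of_eq_add' hce.symm
  obtain ⟨n, hn⟩ := pow_kill (hv.map (P.d (i+1))) ha
  refine ⟨a ^ n, ⟨n, rfl⟩, a ^ n • b, hb.smul _, ?_⟩
  rw [← h1, smul_sub, sub_eq_zero] at hn
  rw [hn, map_smul]

lemma dir2 {I J : Ideal R} {i : ℕ} {M : ModuleCat.{u} R}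
    (hJ : ∀ M : ModuleCat.{u} R, V J ⊥ 2 M) (hJi : V J ⊥ (i+2) M)
    (h : ∀ a ∈ J, V I (Submonoid.powers a) (i+2) M) : V (I ⊓ J) ⊥ (i+2) M := by
  obtain ⟨P⟩ := IR_exists M
  have hPi := P.inj
  refine (P.br1 _ (i+1)).2 ?_
  have hJi := (P.br1 _ (i+1)).1 hJi
  have h := fun a ha => (P.br _ _ (i+1)).1 (h a ha)
  intro e he hG
  let K := I ⊓ J
  let F := Gam K (P.E (i+1))
  let N : Submodule R (P.E (i+2)) := F.map (P.d (i+1))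
  have step1 : ∃ n, ∀ r ∈ J ^ n, r • e ∈ N := by
    refine G_of_fg fun a ha => ?_
    obtain ⟨b, v, hb, hv, rfl⟩ := MV hG
    obtain ⟨n, hn⟩ := pow_kill hv ha
    have h1 : P.d (i+1+1) (a ^ n • b) = 0 := by
      have : a ^ n • b = a ^ n • (b + v) := by rw [smul_add, hn, add_zero]
      rw [this, map_smul]
      exact (congrArg _ he).trans (smul_zero _)
    obtain ⟨s, ⟨m, rfl⟩, c, hc, hc'⟩ := h a ha (a ^ n • b) h1 (hb.smul _)
    refine ⟨m + n, c, hc.anti inf_le_left, ?_⟩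
    rw [hc', pow_add, mul_smul, smul_add, hn, add_zero]
  obtain ⟨n, hn⟩ := step1
  let T := Gam J (P.E (i+2))
  let f : F →ₗ[R] (P.E (i+2) ⧸ T) := T.mkQ.comp ((P.d (i+1)).comp F.subtype)
  let B := LinearMap.range f
  have hF : Module.Injective R F := Gam_inj K
  have hB : V J ⊥ 1 (ModuleCat.of R B) := V1_quot hJ f.rangeRestrict f.surjective_rangeRestrict
  have hT := shortExact_of B.subtype B.mkQ (Submodule.subtype_injective _)
    (Submodule.mkQ_surjective _) (LinearMap.exact_subtype_mkQ _)
  obtain ⟨x, hx, hxe⟩ := lift1 hT hB (B.mkQ (T.mkQ e)) ⟨n, fun r hr => by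
    rw [← map_smul, ← map_smul]
    refine (Submodule.Quotient.mk_eq_zero _).2 ?_
    obtain ⟨c, hc, hce⟩ := hn r hr
    exact ⟨⟨c, hc⟩, congrArg T.mkQ hce⟩⟩
  have hx0 : x = 0 := tf (J := J) (E := P.E (i+2)) x hx
  have h5 : B.mkQ (T.mkQ e) = 0 := by
    rw [← hxe, hx0]; exact map_zero _
  have h6 : T.mkQ e ∈ B := (Submodule.Quotient.mk_eq_zero _).1 h5
  obtain ⟨⟨c, hc⟩, hce⟩ := h6
  have h7 : e - P.d (i+1) c ∈ T := (Submodule.Quotient.eq T).1 hce.symm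
  obtain ⟨g, hg, hg'⟩ := hJi _ (by rw [map_sub, P.dd, he, sub_zero]) h7
  refine ⟨c + g, G.add hc (hg.anti inf_le_right), ?_⟩
  rw [map_add, hg', add_sub_cancel]
end C
end S18

namespace S18
section D
variable {R : Type u} [CommRing R]

lemma sub_iff (I : Ideal R) (i : ℕ) (M : ModuleCat.{u} R) :
    Subsingleton (LC R I (i+1) M) ↔ V I ⊥ (i+1) M := by
  rw [V_iff_LC]
  constructor
  · intro h x
    exact ⟨1, Submonoid.one_mem _, Subsingleton.elim _ _⟩
  · intro h
    refine subsingleton_of_forall_eq 0 fun x => ?_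
    obtain ⟨s, hs, e⟩ := h x
    rwa [Submonoid.mem_bot.1 hs, one_smul] at e

lemma supp_iff (I J : Ideal R) (i : ℕ) (M : ModuleCat.{u} R) :
    Module.support R (LC R I (i+1) M) ⊆ PrimeSpectrum.zeroLocus (J : Set R) ↔
      ∀ a ∈ J, V I (Submonoid.powers a) (i+1) M := by
  simp_rw [V_iff_LC]
  constructor
  · intro h a ha x
    let A : Ideal R := LinearMap.ker (LinearMap.toSpanSingleton R (LC R I (i+1) M) x)
    have hA : ∀ r, r ∈ A ↔ r • x = 0 := fun r => by
      rw [LinearMap.mem_ker, LinearMap.toSpanSingleton_apply]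
    have : a ∈ A.radical := by
      rw [Ideal.radical_eq_sInf, Ideal.mem_sInf]
      rintro p ⟨hp, hpp⟩
      by_contra hap
      have h1 : (⟨p, hpp⟩ : PrimeSpectrum R) ∉ Module.support R (LC R I (i+1) M) :=
        fun h2 => hap (h h2 ha)
      rw [Module.notMem_support_iff'] at h1
      obtain ⟨r, hr, hr'⟩ := h1 x
      exact hr (hp ((hA r).2 hr'))
    obtain ⟨n, hn⟩ := this
    exact ⟨a ^ n, ⟨n, rfl⟩, (hA _).1 hn⟩
  · intro h p hp a ha
    by_contra hap
    refine absurd hp ?_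
    rw [Module.notMem_support_iff']
    intro x
    obtain ⟨s, ⟨n, rfl⟩, hs⟩ := h a ha x
    exact ⟨a ^ n, fun h => hap (p.2.mem_of_pow_mem n h), hs⟩

lemma comb {A B : Set ℕ} (h : ∀ i, i + 2 ∈ A ↔ i + 2 ∈ B) (hA : ∃ i, i + 1 ∈ A)
    (hB : ∃ i, i + 1 ∈ B) (bA : ∃ N, ∀ i ≥ N, i + 1 ∉ A) (bB : ∃ N, ∀ i ≥ N, i + 1 ∉ B) :
    ∃ t, IsGreatest A t ∧ IsGreatest B t := by
  have key : ∀ A : Set ℕ, (∃ i, i + 1 ∈ A) → (∃ N, ∀ i ≥ N, i + 1 ∉ A) →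
      ∃ t, IsGreatest A t ∧ 1 ≤ t := by
    rintro A ⟨i, hi⟩ ⟨N, hN⟩
    have hb : BddAbove A := ⟨N, fun j hj => by
      by_contra hlt
      refine hN (j - 1) (by omega) ?_
      rwa [show j - 1 + 1 = j by omega]⟩
    have h1 : IsGreatest A (sSup A) := ⟨Nat.sSup_mem ⟨_, hi⟩ hb, fun j hj => le_csSup hb hj⟩
    exact ⟨_, h1, le_trans (by omega) (h1.2 hi)⟩
  obtain ⟨s, hs, hs1⟩ := key A hA bA
  obtain ⟨t, ht, ht1⟩ := key B hB bB
  have e : s = t := by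
    apply le_antisymm
    · by_cases h2 : s = 1
      · omega
      · obtain ⟨k, rfl⟩ : ∃ k, s = k + 2 := ⟨s - 2, by omega⟩
        exact ht.2 ((h k).1 hs.1)
    · by_cases h2 : t = 1
      · omega
      · obtain ⟨k, rfl⟩ : ∃ k, t = k + 2 := ⟨t - 2, by omega⟩
        exact hs.2 ((h k).2 ht.1)
  subst e
  exact ⟨s, hs, ht⟩
end D
end S18

theorem stmt18 (R : Type u) [CommRing R] [IsDomain R] [IsNoetherianRing R] (I J : Ideal R)
    (hI0 : I ≠ ⊥) (hJ0 : J ≠ ⊥) (hItop : I ≠ ⊤) (hJtop : J ≠ ⊤)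
    (hJcd₁ : ¬ Subsingleton (LC R J 1 (ModuleCat.of R R)))
    (hJcd₂ : ∀ i : ℕ, 2 ≤ i → Subsingleton (LC R J i (ModuleCat.of R R)))
    (hrad : ¬ J ≤ I.radical) :
    ∃ t : ℕ,
      IsGreatest {i : ℕ | ¬ Subsingleton (LC R (I ⊓ J) i (ModuleCat.of R R))} t ∧
        IsGreatest {i : ℕ |
          ¬ Module.support R (LC R I i (ModuleCat.of R R)) ⊆
              PrimeSpectrum.zeroLocus (J : Set R)} t := by
  have hJV : ∀ i, S18.V J ⊥ (i+2) (ModuleCat.of R R) := fun i =>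
    (S18.sub_iff J (i+1) _).1 (hJcd₂ (i+2) (by omega))
  have hJ2 : ∀ M : ModuleCat.{u} R, S18.V J ⊥ 2 M := fun M => by
    obtain ⟨N, hN⟩ := S18.van J ⊥
    refine S18.V_all N hN 2 (fun i hi => ?_) 2 le_rfl M
    obtain ⟨k, rfl⟩ := Nat.exists_eq_add_of_le' hi
    exact hJV k
  apply S18.comb
  · intro i
    rw [Set.mem_setOf_eq, Set.mem_setOf_eq, not_iff_not]
    refine (S18.sub_iff (I ⊓ J) (i+1) _).trans (Iff.trans ?_ (S18.supp_iff I J (i+1) _).symm)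
    exact ⟨fun h a ha => S18.dir1 h ha, fun h => S18.dir2 hJ2 (hJV i) h⟩
  · have hne : I ⊓ J ≠ ⊤ := fun h => hItop (top_le_iff.1 (h ▸ inf_le_left))
    have hnb : I ⊓ J ≠ ⊥ := fun h => by
      have : I * J = ⊥ := le_bot_iff.1 (h ▸ Ideal.mul_le_inf)
      rcases Ideal.mul_eq_bot.1 this with h | h
      exacts [hI0 h, hJ0 h]
    obtain ⟨p, hp, hle⟩ := Ideal.exists_le_maximal _ hne
    have := hp.isPrime
    obtain ⟨i, hi⟩ := S18.nonvan (I ⊓ J) p hnb hle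
    exact ⟨i, fun h => hi (S18.V.mono bot_le ((S18.sub_iff _ i _).1 h))⟩
  · obtain ⟨a, ha, har⟩ := SetLike.not_le_iff_exists.1 hrad
    rw [Ideal.radical_eq_sInf, Ideal.mem_sInf] at har
    push Not at har
    obtain ⟨p, ⟨hle, hp⟩, hap⟩ := har
    obtain ⟨i, hi⟩ := S18.nonvan I p hI0 hle
    refine ⟨i, fun h => hi (S18.V.mono ?_ ((S18.supp_iff I J i _).1 h a ha))⟩
    exact Submonoid.powers_le.2 hap
  · obtain ⟨N, hN⟩ := S18.van (I ⊓ J) ⊥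
    exact ⟨N, fun i hi h => h ((S18.sub_iff _ i _).2 (hN (i+1) (by omega) _))⟩
  · obtain ⟨N, hN⟩ := S18.van I ⊥
    exact ⟨N, fun i hi h => h ((S18.supp_iff I J i _).2
      fun a ha => S18.V.mono bot_le (hN (i+1) (by omega) _))⟩
end
end
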